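/- arXiv:2409.16527 — 5 statements merged into one kernel-verified Lean document; each statement's English description precedes it below -/
import Mathlib

section
/- (Hildebrand, 1984) Suppose that for every ε ∈ (0, 1/2) there exists a constant C_ε > 0 such that for all integers n, m with m ≥ 2 and Υ(n,m) ≤ m^{1/2 − ε}, one has (log(m)/log(Υ(n,m) + 1)) · |log(Ψ(n,m)/(n·ρ(Υ(n,m))))| ≤ C_ε. Then the Riemann hypothesis holds, i.e., every nontrivial zero of the Riemann zeta function has real part 1/2. -/
open Real
open scoped Classical

/-- `Psi n m` is the number of `m`-smooth integers in `{1,…,n}`. -/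
noncomputable def Psi (n m : ℕ) : ℕ :=
  ((Finset.Icc 1 n).filter (fun k => ∀ p : ℕ, p.Prime → p ∣ k → p ≤ m)).card

/-- `Upsilon n m = log n / log m`. -/
noncomputable def Upsilon (n m : ℕ) : ℝ := Real.log n / Real.log m

/-! ### The Dickman function -/

/-- The Dickman function, extended by `1` to the negative half-line. -/
structure IsDickman (ρ : ℝ → ℝ) : Prop where
  continuous : Continuous ρ
  eq_one : ∀ u ≤ 1, ρ u = 1
  hasDerivAt : ∀ u, 1 < u → HasDerivAt ρ (-ρ (u - 1) / u) u

theorem IsDickman.of_continuousOn {ρ : ℝ → ℝ} (hρ_cont : ContinuousOn ρ (Set.Ici (0 : ℝ)))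
    (hρ_init : ∀ u : ℝ, 0 ≤ u → u ≤ 1 → ρ u = 1)
    (hρ_delay : ∀ u : ℝ, 1 < u → HasDerivAt ρ (-ρ (u - 1) / u) u) :
    IsDickman fun u ↦ ρ (max u 0) where
  continuous := hρ_cont.comp_continuous (by fun_prop) fun u ↦
    Set.mem_Ici.2 (le_max_right _ _)
  eq_one u hu := hρ_init _ (le_max_right _ _) (max_le hu zero_le_one)
  hasDerivAt u hu := by
    rw [max_eq_left (by linarith : (0 : ℝ) ≤ u - 1)]
    refine (hρ_delay u hu).congr_of_eventuallyEq ?_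
    filter_upwards [lt_mem_nhds (zero_lt_one.trans hu)] with v hv
    rw [max_eq_left hv.le]

namespace IsDickman

variable {ρ : ℝ → ℝ}

theorem intervalIntegrable (hρ : IsDickman ρ) (a b : ℝ) :
    IntervalIntegrable ρ MeasureTheory.volume a b :=
  hρ.continuous.intervalIntegrable a b

theorem mul_self_eq_integral (hρ : IsDickman ρ) {u : ℝ} (hu : 1 ≤ u) :
    u * ρ u = ∫ x in (u - 1)..u, ρ x := by
  set g : ℝ → ℝ := fun u ↦ u * ρ u - ((∫ x in (0)..u, ρ x) - ∫ x in (0)..(u - 1), ρ x) with hg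
  have hI : ∀ u, HasDerivAt (fun u ↦ ∫ x in (0)..u, ρ x) (ρ u) u := fun u ↦
    hρ.continuous.integral_hasStrictDerivAt 0 u |>.hasDerivAt
  have hI' : ∀ u, HasDerivAt (fun u ↦ ∫ x in (0)..(u - 1), ρ x) (ρ (u - 1)) u := fun u ↦
    (hI (u - 1)).comp_sub_const u 1
  have hcont : Continuous g := by
    refine (continuous_id.mul hρ.continuous).sub (Continuous.sub ?_ ?_)
    · exact continuous_iff_continuousAt.2 fun u ↦ (hI u).continuousAt
    · exact continuous_iff_continuousAt.2 fun u ↦ (hI' u).continuousAt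
  have hg1 : g 1 = 0 := by
    have : ∫ x in (0 : ℝ)..1, ρ x = ∫ x in (0 : ℝ)..1, (1 : ℝ) := by
      refine intervalIntegral.integral_congr fun x hx ↦ ?_
      rw [Set.uIcc_of_le zero_le_one] at hx
      exact hρ.eq_one x hx.2
    simp [hg, hρ.eq_one 1 le_rfl, this]
  have hgu : g u = 0 := by
    rcases hu.eq_or_lt with rfl | hu
    · exact hg1
    obtain ⟨c, hc, hc'⟩ := exists_hasDerivAt_eq_slope g (fun _ ↦ 0) hu hcont.continuousOn
      (fun x hx ↦ by
        have hx0 : x ≠ 0 := by linarith [hx.1]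
        refine (((hasDerivAt_id x).mul (hρ.hasDerivAt x hx.1)).sub
          ((hI x).sub (hI' x))).congr_deriv ?_
        simp only [id]
        field_simp
        ring)
    rw [hg1, sub_zero, eq_comm, div_eq_zero_iff] at hc'
    rcases hc' with h | h
    · exact h
    · linarith
  have hsplit := intervalIntegral.integral_add_adjacent_intervals
    (hρ.intervalIntegrable 0 (u - 1)) (hρ.intervalIntegrable (u - 1) u)
  simp only [hg] at hgu
  linarith

theorem pos (hρ : IsDickman ρ) (u : ℝ) : 0 < ρ u := by
  by_contra! hu
  have h1 : 1 ≤ u := by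
    by_contra! h
    rw [hρ.eq_one u h.le] at hu
    linarith
  set S : Set ℝ := {u | 1 ≤ u ∧ ρ u ≤ 0} with hS
  have hcl : IsClosed S :=
    (isClosed_le continuous_const continuous_id).inter (isClosed_le hρ.continuous continuous_const)
  have hbdd : BddBelow S := ⟨1, fun x hx ↦ hx.1⟩
  have hmem : sInf S ∈ S := hcl.csInf_mem ⟨u, h1, hu⟩ hbdd
  have hlt : ∀ v < sInf S, 0 < ρ v := by
    intro v hv
    by_contra! h
    rcases le_total v 1 with h' | h'
    · rw [hρ.eq_one v h'] at h
      linarith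
    · exact absurd (csInf_le hbdd (⟨h', h⟩ : v ∈ S)) (not_le.2 hv)
  have hint := intervalIntegral.intervalIntegral_pos_of_pos_on
    (hρ.intervalIntegrable (sInf S - 1) (sInf S)) (fun x hx ↦ hlt x hx.2) (by linarith)
  rw [← hρ.mul_self_eq_integral hmem.1] at hint
  nlinarith [hmem.1, hmem.2]

theorem antitone (hρ : IsDickman ρ) : Antitone ρ := by
  refine AntitoneOn.Iic_union_Ici (a := 1) (fun x hx y hy _ ↦ ?_) ?_
  · rw [hρ.eq_one x hx, hρ.eq_one y hy]
  · refine antitoneOn_of_deriv_nonpos (convex_Ici 1) hρ.continuous.continuousOn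
      (fun x hx ↦ ?_) fun x hx ↦ ?_ <;> rw [interior_Ici] at hx
    · exact (hρ.hasDerivAt x hx).differentiableAt.differentiableWithinAt
    · rw [(hρ.hasDerivAt x hx).deriv]
      have hx' : (1 : ℝ) < x := hx
      exact div_nonpos_of_nonpos_of_nonneg (by linarith [hρ.pos (x - 1)]) (by linarith)

theorem le_one (hρ : IsDickman ρ) (u : ℝ) : ρ u ≤ 1 := by
  rcases le_total u 1 with h | h
  · exact (hρ.eq_one u h).le
  · exact (hρ.antitone h).trans (hρ.eq_one 1 le_rfl).le

theorem le_inv_factorial (hρ : IsDickman ρ) (n : ℕ) :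
    ∀ u : ℝ, n ≤ u → ρ u ≤ ((n.factorial : ℝ))⁻¹ := by
  induction n with
  | zero => intro u _; simpa using hρ.le_one u
  | succ n ih =>
    intro u hu
    push_cast at hu
    have hn : (0 : ℝ) ≤ n := n.cast_nonneg
    have h1 : u * ρ u ≤ ((n.factorial : ℝ))⁻¹ := by
      rw [hρ.mul_self_eq_integral (by linarith)]
      calc ∫ x in (u - 1)..u, ρ x ≤ ∫ x in (u - 1)..u, ((n.factorial : ℝ))⁻¹ :=
            intervalIntegral.integral_mono_on (by linarith) (hρ.intervalIntegrable _ _)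
              intervalIntegrable_const fun x hx ↦ ih x (by linarith [hx.1])
        _ = _ := by simp
    have h2 : ((n : ℝ) + 1) * ρ u ≤ u * ρ u := mul_le_mul_of_nonneg_right hu (hρ.pos u).le
    rw [Nat.factorial_succ, Nat.cast_mul, mul_inv, inv_mul_eq_div, Nat.cast_succ,
      le_div_iff₀ (by positivity)]
    linarith

theorem le_exp (hρ : IsDickman ρ) {s u : ℝ} (hs : 0 ≤ s) (hu : 0 ≤ u) :
    ρ u ≤ exp (exp s + s) * exp (-s * u) := by
  have h1 := hρ.le_inv_factorial ⌊u⌋₊ u (Nat.floor_le hu)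
  have h2 := Real.pow_div_factorial_le_exp (exp s) (exp_pos s).le ⌊u⌋₊
  rw [← Real.exp_nat_mul, div_eq_mul_inv] at h2
  have h3 : u < ⌊u⌋₊ + 1 := Nat.lt_floor_add_one u
  calc ρ u ≤ exp (-(⌊u⌋₊ * s)) * (exp (⌊u⌋₊ * s) * ((⌊u⌋₊.factorial : ℝ))⁻¹) := by
        rw [← mul_assoc, ← Real.exp_add]; simpa using h1
    _ ≤ exp (-(⌊u⌋₊ * s)) * exp (exp s) := by gcongr
    _ ≤ _ := by
        rw [← Real.exp_add, ← Real.exp_add]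
        refine exp_le_exp.2 ?_
        nlinarith

/-! ### The Laplace transform of the Dickman function -/

/-- The Laplace transform of `ρ` on the positive half-line, evaluated at `-s`. -/
noncomputable def laplace (ρ : ℝ → ℝ) (s : ℝ) : ℝ := ∫ u in Set.Ioi 0, ρ u * exp (s * u)

theorem norm_mul_exp_le (hρ : IsDickman ρ) {s t u : ℝ} (ht : 0 ≤ t) (hu : 0 ≤ u) :
    ‖ρ u * exp (s * u)‖ ≤ exp (exp t + t) * exp (-(t - s) * u) := by
  rw [Real.norm_of_nonneg (mul_nonneg (hρ.pos u).le (exp_pos _).le)]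
  calc _ ≤ exp (exp t + t) * exp (-t * u) * exp (s * u) := by
        gcongr
        exact hρ.le_exp ht hu
    _ = _ := by rw [mul_assoc, ← Real.exp_add]; congr 2; ring

theorem integrableOn_mul_exp (hρ : IsDickman ρ) (s : ℝ) :
    MeasureTheory.IntegrableOn (fun u ↦ ρ u * exp (s * u)) (Set.Ioi 0) := by
  have hint := (integrableOn_exp_mul_Ioi (a := -(max (s + 1) 0 - s)) (by
    have := le_max_left (s + 1) 0
    linarith) 0).const_mul (exp (exp (max (s + 1) 0) + max (s + 1) 0))
  refine MeasureTheory.Integrable.mono' hint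
    (hρ.continuous.mul (by fun_prop)).aestronglyMeasurable ?_
  refine MeasureTheory.ae_restrict_of_forall_mem measurableSet_Ioi fun u hu ↦ ?_
  exact hρ.norm_mul_exp_le (le_max_right _ _) (le_of_lt hu)

theorem norm_mul_self_mul_exp_le (hρ : IsDickman ρ) {s t u : ℝ} (hst : s ≤ t) (hu : 0 < u) :
    ‖u * ρ u * exp (s * u)‖ ≤ ρ u * exp ((t + 1) * u) := by
  have hp := hρ.pos u
  have h1 : u ≤ exp u := by linarith [Real.add_one_le_exp u]
  rw [Real.norm_of_nonneg (by positivity)]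
  calc _ ≤ exp u * ρ u * exp (t * u) := by gcongr
    _ = _ := by rw [add_mul, Real.exp_add, one_mul]; ring

theorem integrableOn_mul_self_mul_exp (hρ : IsDickman ρ) (s : ℝ) :
    MeasureTheory.IntegrableOn (fun u ↦ u * ρ u * exp (s * u)) (Set.Ioi 0) := by
  refine MeasureTheory.Integrable.mono' (hρ.integrableOn_mul_exp (s + 1))
    ((continuous_id.mul hρ.continuous).mul (by fun_prop)).aestronglyMeasurable ?_
  exact MeasureTheory.ae_restrict_of_forall_mem measurableSet_Ioi fun u hu ↦
    hρ.norm_mul_self_mul_exp_le le_rfl hu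

theorem hasDerivAt_laplace (hρ : IsDickman ρ) (s : ℝ) :
    HasDerivAt (laplace ρ) (∫ u in Set.Ioi 0, u * ρ u * exp (s * u)) s := by
  refine (hasDerivAt_integral_of_dominated_loc_of_deriv_le
    (μ := MeasureTheory.volume.restrict (Set.Ioi 0))
    (F := fun s u ↦ ρ u * exp (s * u)) (F' := fun s u ↦ u * ρ u * exp (s * u))
    (bound := fun u ↦ ρ u * exp ((s + 1 + 1) * u)) (s := Set.Iio (s + 1))
    (Iio_mem_nhds (by linarith)) ?_ (hρ.integrableOn_mul_exp s)
    (hρ.integrableOn_mul_self_mul_exp s).aestronglyMeasurable ?_ (hρ.integrableOn_mul_exp _) ?_).2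
  · exact Filter.Eventually.of_forall fun t ↦ (hρ.integrableOn_mul_exp t).aestronglyMeasurable
  · exact MeasureTheory.ae_restrict_of_forall_mem measurableSet_Ioi fun u hu t ht ↦
      hρ.norm_mul_self_mul_exp_le (le_of_lt ht) hu
  · refine Filter.Eventually.of_forall fun u t _ ↦ ?_
    refine ((((hasDerivAt_id t).mul_const u).exp).const_mul (ρ u)).congr_deriv ?_
    simp only [id]
    ring

theorem laplace_ge (hρ : IsDickman ρ) {s : ℝ} (hs : 0 ≤ s) : 1 ≤ laplace ρ s := by
  calc (1 : ℝ) = ∫ u in Set.Ioc (0 : ℝ) 1, (1 : ℝ) := by simp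
    _ ≤ ∫ u in Set.Ioc (0 : ℝ) 1, ρ u * exp (s * u) := by
        refine MeasureTheory.setIntegral_mono_on (by simp)
          ((hρ.integrableOn_mul_exp s).mono_set Set.Ioc_subset_Ioi_self) measurableSet_Ioc
          fun u hu ↦ ?_
        rw [hρ.eq_one u hu.2, one_mul]
        exact Real.one_le_exp (mul_nonneg hs hu.1.le)
    _ ≤ laplace ρ s := by
        refine MeasureTheory.setIntegral_mono_set (hρ.integrableOn_mul_exp s)
          (Filter.Eventually.of_forall fun u ↦ ?_) (Set.Ioc_subset_Ioi_self).eventuallyLE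
        exact mul_nonneg (hρ.pos u).le (exp_pos _).le

theorem integral_shift (ρ : ℝ → ℝ) (s : ℝ) :
    ∫ u in Set.Ioi 1, ρ (u - 1) * exp (s * u) = exp s * laplace ρ s := by
  have h := (MeasureTheory.measurePreserving_sub_right MeasureTheory.volume
    (1 : ℝ)).setIntegral_preimage_emb (measurableEmbedding_subRight 1)
    (fun u ↦ ρ u * exp (s * (u + 1))) (Set.Ioi 0)
  have hset : (fun x : ℝ ↦ x - 1) ⁻¹' Set.Ioi 0 = Set.Ioi 1 := by ext; simp
  rw [hset] at h
  simp only [sub_add_cancel] at h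
  rw [h, laplace, ← MeasureTheory.integral_const_mul]
  congr 1
  ext u
  rw [mul_add, Real.exp_add, mul_one]
  ring

theorem mul_deriv_laplace (hρ : IsDickman ρ) (s : ℝ) :
    s * (∫ u in Set.Ioi 0, u * ρ u * exp (s * u)) = (exp s - 1) * laplace ρ s := by
  have hA := hρ.integrableOn_mul_exp s
  have hB := hρ.integrableOn_mul_self_mul_exp s
  have hsub : Set.Ioi (1 : ℝ) ⊆ Set.Ioi 0 := Set.Ioi_subset_Ioi zero_le_one
  have hC : MeasureTheory.IntegrableOn (fun u ↦ ρ (u - 1) * exp (s * u)) (Set.Ioi 1) := by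
    have h := (MeasureTheory.measurePreserving_sub_right MeasureTheory.volume
      (1 : ℝ)).integrableOn_comp_preimage (measurableEmbedding_subRight 1)
      (f := fun u ↦ exp s * (ρ u * exp (s * u))) (s := Set.Ioi 0)
    have hset : (fun x : ℝ ↦ x - 1) ⁻¹' Set.Ioi 0 = Set.Ioi 1 := by ext; simp
    rw [hset] at h
    refine (h.2 (hA.const_mul _)).congr_fun (fun u _ ↦ ?_) measurableSet_Ioi
    simp only [Function.comp]
    rw [mul_sub, Real.exp_sub, mul_one]
    field_simp
  have hsplit : ∀ {f : ℝ → ℝ}, MeasureTheory.IntegrableOn f (Set.Ioi 0) →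
      ∫ u in Set.Ioi 0, f u = (∫ u in (0 : ℝ)..1, f u) + ∫ u in Set.Ioi 1, f u := by
    intro f hf
    rw [intervalIntegral.integral_of_le zero_le_one, ← MeasureTheory.setIntegral_union
      (Set.Ioc_disjoint_Ioi le_rfl) measurableSet_Ioi (hf.mono_set Set.Ioc_subset_Ioi_self)
      (hf.mono_set hsub), Set.Ioc_union_Ioi_eq_Ioi zero_le_one]
  have h01 : (∫ u in (0 : ℝ)..1, ρ u * exp (s * u)) + s * ∫ u in (0 : ℝ)..1, u * ρ u * exp (s * u)
      = exp s := by
    have hc1 : Continuous fun u ↦ ρ u * exp (s * u) := hρ.continuous.mul (by fun_prop)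
    have hc2 : Continuous fun u ↦ s * (u * ρ u * exp (s * u)) :=
      continuous_const.mul ((continuous_id.mul hρ.continuous).mul (by fun_prop))
    rw [← intervalIntegral.integral_const_mul, ← intervalIntegral.integral_add
      (hc1.intervalIntegrable _ _) (hc2.intervalIntegrable _ _)]
    have h := intervalIntegral.integral_eq_sub_of_hasDerivAt (f := fun u ↦ u * exp (s * u))
      (f' := fun u ↦ 1 * exp (s * u) + u * (exp (s * u) * (s * 1))) (a := 0) (b := 1)
      (fun u _ ↦ (hasDerivAt_id u).mul ((hasDerivAt_id u).const_mul s).exp)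
      (Continuous.intervalIntegrable (by fun_prop) _ _)
    simp only [mul_one, one_mul, mul_zero, zero_mul, sub_zero] at h
    rw [← h]
    refine intervalIntegral.integral_congr fun u hu ↦ ?_
    rw [Set.uIcc_of_le zero_le_one] at hu
    simp only [hρ.eq_one u hu.2]
    ring
  have htend : Filter.Tendsto (fun u ↦ u * ρ u * exp (s * u)) Filter.atTop (nhds 0) := by
    set t := max (s + 2) 0 with ht
    have hts : 0 < t - (s + 1) := by
      have := le_max_left (s + 2) 0
      linarith
    refine squeeze_zero_norm' (a := fun u ↦ exp (exp t + t) * exp (-(t - (s + 1)) * u)) ?_ ?_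
    · filter_upwards [Filter.eventually_gt_atTop 0] with u hu
      exact (hρ.norm_mul_self_mul_exp_le le_rfl hu).trans
        ((le_abs_self _).trans (hρ.norm_mul_exp_le (le_max_right _ _) hu.le))
    · rw [← mul_zero (exp (exp t + t))]
      refine Filter.Tendsto.const_mul _ (Real.tendsto_exp_atBot.comp ?_)
      exact Filter.tendsto_id.const_mul_atTop_of_neg (by linarith)
  have h1 := MeasureTheory.integral_Ioi_of_hasDerivAt_of_tendsto (a := 1)
    (f := fun u ↦ u * ρ u * exp (s * u))
    (f' := fun u ↦ ρ u * exp (s * u) - ρ (u - 1) * exp (s * u) + s * (u * ρ u * exp (s * u)))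
    ((continuous_id.mul hρ.continuous).mul (by fun_prop)).continuousWithinAt
    (fun u hu ↦ by
      have hu0 : u ≠ 0 := by
        have : (1 : ℝ) < u := hu
        linarith
      refine (((hasDerivAt_id u).mul (hρ.hasDerivAt u hu)).mul
        ((hasDerivAt_id u).const_mul s).exp).congr_deriv ?_
      simp only [id, Pi.mul_apply]
      field_simp
      ring)
    (((hA.mono_set hsub).sub hC).add ((hB.mono_set hsub).const_mul s)) htend
  rw [MeasureTheory.integral_add (f := fun u ↦ ρ u * exp (s * u) - ρ (u - 1) * exp (s * u))
    ((hA.mono_set hsub).sub hC) ((hB.mono_set hsub).const_mul s),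
    MeasureTheory.integral_sub (hA.mono_set hsub) hC, MeasureTheory.integral_const_mul,
    integral_shift, hρ.eq_one 1 le_rfl] at h1
  have h2 := hsplit hA
  rw [← laplace] at h2
  rw [hsplit hB]
  simp only [mul_one, one_mul] at h1
  linear_combination h01 + h1 + h2

/-- The logarithm of `∫ ρ(log t / log y) t ^ (-σ) dt` over `1 < t`, and its derivative in `y`. -/
theorem hasDerivAt_log_laplace (hρ : IsDickman ρ) {σ y : ℝ} (hσ : σ < 1) (hy : 1 < y) :
    HasDerivAt (fun y ↦ log (log y) + log (laplace ρ ((1 - σ) * log y)))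
      (y ^ (-σ) / log y) y := by
  have hly : 0 < log y := log_pos hy
  have hy0 : 0 < y := by linarith
  have hs : 0 < (1 - σ) * log y := mul_pos (by linarith) hly
  have hF := hρ.laplace_ge hs.le
  have h1 := (Real.hasDerivAt_log hy0.ne').log hly.ne'
  have h2 := ((hρ.hasDerivAt_laplace ((1 - σ) * log y)).comp y
    ((Real.hasDerivAt_log hy0.ne').const_mul (1 - σ))).log (by simp only [Function.comp]; linarith)
  have h3 := hρ.mul_deriv_laplace ((1 - σ) * log y)
  refine (h1.add h2).congr_deriv ?_
  have hexp : y ^ (-σ) = exp ((1 - σ) * log y) / y := by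
    rw [Real.rpow_def_of_pos hy0, sub_mul, one_mul, sub_eq_neg_add, Real.exp_add, exp_log hy0]
    rw [mul_div_assoc, div_self hy0.ne', mul_one]
    congr 1; ring
  rw [hexp]
  simp only [Function.comp]
  generalize (∫ u in Set.Ioi 0, u * ρ u * exp ((1 - σ) * log y * u)) = D at *
  generalize laplace ρ ((1 - σ) * log y) = L at *
  generalize exp ((1 - σ) * log y) = E at *
  have hL : L ≠ 0 := by linarith
  field_simp
  linear_combination h3

end IsDickman

theorem integral_le_sum_Icc_and_le {f : ℝ → ℝ} {a b : ℕ} (hab : a ≤ b)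
    (hf : AntitoneOn f (Set.Icc a b)) (hb : 0 ≤ f b) :
    ∫ x in (a : ℝ)..b, f x ≤ ∑ k ∈ Finset.Icc a b, f k ∧
      ∑ k ∈ Finset.Icc a b, f k ≤ f a + ∫ x in (a : ℝ)..b, f x := by
  have h1 := hf.integral_le_sum_Ico hab
  have h2 := hf.sum_le_integral_Ico hab
  constructor
  · rw [← Finset.Ico_insert_right hab, Finset.sum_insert (by simp)]
    linarith
  · have : ∑ k ∈ Finset.Icc a b, f k = f a + ∑ k ∈ Finset.Ico a b, f ((k + 1 : ℕ) : ℝ) := by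
      rw [Finset.sum_Ico_add' (fun k : ℕ ↦ f k) a b 1, ← Finset.insert_Icc_add_one_left_eq_Icc hab,
        Finset.sum_insert (by simp)]
      rfl
    linarith

namespace IsDickman

variable {ρ : ℝ → ℝ}

theorem exists_abs_sum_sub_log_laplace_le (hρ : IsDickman ρ) {σ : ℝ} (hσ0 : 0 < σ) (hσ : σ < 1) :
    ∃ K, ∀ N : ℕ, 2 ≤ N → |∑ k ∈ Finset.Icc 1 N, (log k)⁻¹ * (k : ℝ) ^ (-σ) -
      (log (log N) + log (laplace ρ ((1 - σ) * log N)))| ≤ K := by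
  set f : ℝ → ℝ := fun y ↦ y ^ (-σ) / log y with hf
  set J : ℝ → ℝ := fun y ↦ log (log y) + log (laplace ρ ((1 - σ) * log y)) with hJ
  refine ⟨|f 2| + |J 2|, fun N hN ↦ ?_⟩
  have hN' : (2 : ℝ) ≤ N := by exact_mod_cast hN
  have hpos : ∀ x : ℝ, 2 ≤ x → 0 < log x := fun x hx ↦ log_pos (by linarith)
  have hanti : AntitoneOn f (Set.Icc (2 : ℕ) N) := by
    intro x hx y _ hxy
    have hx' : (2 : ℝ) ≤ x := by exact_mod_cast hx.1
    have := hpos x hx'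
    refine div_le_div₀ (Real.rpow_nonneg (by linarith) _) ?_ this (log_le_log (by linarith) hxy)
    exact Real.rpow_le_rpow_of_nonpos (by linarith) hxy (by linarith)
  obtain ⟨h1, h2⟩ := integral_le_sum_Icc_and_le hN hanti
    (div_nonneg (Real.rpow_nonneg (by linarith) _) (hpos _ hN').le)
  have hint : ∫ x in ((2 : ℕ) : ℝ)..N, f x = J N - J 2 := by
    refine intervalIntegral.integral_eq_sub_of_hasDerivAt (fun x hx ↦ ?_) ?_
    · rw [Set.uIcc_of_le (by exact_mod_cast hN)] at hx
      have hx' : (2 : ℝ) ≤ x := by exact_mod_cast hx.1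
      exact hρ.hasDerivAt_log_laplace hσ (by linarith)
    · refine AntitoneOn.intervalIntegrable ?_
      rwa [Set.uIcc_of_le (by exact_mod_cast hN)]
  have hsum : ∑ k ∈ Finset.Icc 1 N, (log k)⁻¹ * (k : ℝ) ^ (-σ) = ∑ k ∈ Finset.Icc 2 N, f k := by
    rw [← Finset.insert_Icc_add_one_left_eq_Icc (by omega : 1 ≤ N), Finset.sum_insert (by simp)]
    simp [hf, div_eq_inv_mul]
  rw [hsum]
  rw [hint] at h1 h2
  have h3 := le_abs_self (f 2)
  have h4 := le_abs_self (J 2)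
  have h5 := neg_abs_le (J 2)
  have h6 := abs_nonneg (f 2)
  have h7 : J N = log (log N) + log (laplace ρ ((1 - σ) * log N)) := rfl
  rw [Nat.cast_ofNat] at h2
  rw [← h7, abs_le]
  constructor <;> linarith

theorem integral_rho_log (hρ : IsDickman ρ) (σ : ℝ) {y X : ℝ} (hy : 1 < y) (hX : 1 ≤ X) :
    ∫ t in (1 : ℝ)..X, ρ (log t / log y) * t ^ (-σ) =
      log y * ∫ u in (0 : ℝ)..(log X / log y), ρ u * exp ((1 - σ) * log y * u) := by
  have hly : 0 < log y := log_pos hy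
  have h := intervalIntegral.integral_comp_mul_deriv (a := 1) (b := X)
    (f := fun t ↦ log t / log y) (f' := fun t ↦ t⁻¹ / log y)
    (g := fun u ↦ ρ u * exp ((1 - σ) * log y * u)) (fun t ht ↦ ?_) ?_
    (hρ.continuous.mul (by fun_prop))
  · simp only [log_one, zero_div] at h
    rw [← h, ← intervalIntegral.integral_const_mul]
    refine intervalIntegral.integral_congr fun t ht ↦ ?_
    rw [Set.uIcc_of_le hX] at ht
    have ht0 : 0 < t := by linarith [ht.1]
    have hexp : t ^ (-σ) = exp ((1 - σ) * log y * (log t / log y)) * t⁻¹ := by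
      rw [mul_assoc, mul_div_cancel₀ _ hly.ne', Real.rpow_def_of_pos ht0, sub_mul, one_mul,
        sub_eq_neg_add, Real.exp_add, exp_log ht0, mul_assoc, mul_inv_cancel₀ ht0.ne', mul_one]
      congr 1
      ring
    simp only [Function.comp, hexp]
    field_simp
  · rw [Set.uIcc_of_le hX] at ht
    exact (Real.hasDerivAt_log (by linarith [ht.1])).div_const _
  · rw [Set.uIcc_of_le hX]
    exact (continuousOn_inv₀.mono fun t ht ↦ by
      have : (1 : ℝ) ≤ t := ht.1
      exact ne_of_gt (by linarith)).div_const _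

theorem integral_tail_le (hρ : IsDickman ρ) {s t U : ℝ} (ht : 0 ≤ t) (hst : s < t) (hU : 0 ≤ U) :
    laplace ρ s - exp (exp t + t) * exp (-(t - s) * U) / (t - s) ≤
      ∫ u in (0 : ℝ)..U, ρ u * exp (s * u) := by
  have hA := hρ.integrableOn_mul_exp s
  have hsub : Set.Ioi U ⊆ Set.Ioi 0 := Set.Ioi_subset_Ioi hU
  have hsplit : laplace ρ s = (∫ u in (0 : ℝ)..U, ρ u * exp (s * u)) +
      ∫ u in Set.Ioi U, ρ u * exp (s * u) := by
    rw [laplace, intervalIntegral.integral_of_le hU, ← MeasureTheory.setIntegral_union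
      (Set.Ioc_disjoint_Ioi le_rfl) measurableSet_Ioi (hA.mono_set Set.Ioc_subset_Ioi_self)
      (hA.mono_set hsub), Set.Ioc_union_Ioi_eq_Ioi hU]
  have hneg : -(t - s) < 0 := by linarith
  have hle : ∫ u in Set.Ioi U, ρ u * exp (s * u) ≤
      ∫ u in Set.Ioi U, exp (exp t + t) * exp (-(t - s) * u) := by
    refine MeasureTheory.setIntegral_mono_on (hA.mono_set hsub)
      ((integrableOn_exp_mul_Ioi hneg U).const_mul _) measurableSet_Ioi fun u hu ↦ ?_
    exact (le_abs_self _).trans (hρ.norm_mul_exp_le ht (hU.trans (le_of_lt hu)))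
  rw [MeasureTheory.integral_const_mul, integral_exp_mul_Ioi hneg] at hle
  have : -exp (-(t - s) * U) / -(t - s) = exp (-(t - s) * U) / (t - s) := by
    rw [neg_div_neg_eq]
  rw [this, ← mul_div_assoc] at hle
  linarith

theorem sum_rho_bounds (hρ : IsDickman ρ) {σ : ℝ} (hσ0 : 0 ≤ σ) {y : ℝ} (hy : 1 < y) {X : ℕ}
    (hX : 1 ≤ X) :
    log y * ∫ u in (0 : ℝ)..(log X / log y), ρ u * exp ((1 - σ) * log y * u) ≤
        ∑ n ∈ Finset.Icc 1 X, ρ (log n / log y) * (n : ℝ) ^ (-σ) ∧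
      ∑ n ∈ Finset.Icc 1 X, ρ (log n / log y) * (n : ℝ) ^ (-σ) ≤
        1 + log y * laplace ρ ((1 - σ) * log y) := by
  have hly : 0 < log y := log_pos hy
  have hX' : (1 : ℝ) ≤ X := by exact_mod_cast hX
  have hanti : AntitoneOn (fun t ↦ ρ (log t / log y) * t ^ (-σ)) (Set.Icc (1 : ℕ) X) := by
    intro a ha b _ hab
    have ha' : (1 : ℝ) ≤ a := by exact_mod_cast ha.1
    refine mul_le_mul (hρ.antitone ?_) ?_ (Real.rpow_nonneg (by linarith) _) (hρ.pos _).le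
    · exact div_le_div_of_nonneg_right (log_le_log (by linarith) hab) hly.le
    · exact Real.rpow_le_rpow_of_nonpos (by linarith) hab (by linarith)
  obtain ⟨h1, h2⟩ := integral_le_sum_Icc_and_le hX hanti
    (mul_nonneg (hρ.pos _).le (Real.rpow_nonneg (by linarith) _))
  rw [Nat.cast_one, hρ.integral_rho_log σ hy hX'] at h1 h2
  refine ⟨h1, h2.trans ?_⟩
  rw [log_one, zero_div, hρ.eq_one 0 zero_le_one, Real.one_rpow, mul_one]
  gcongr
  rw [laplace, intervalIntegral.integral_of_le (div_nonneg (log_nonneg hX') hly.le)]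
  refine MeasureTheory.setIntegral_mono_set (hρ.integrableOn_mul_exp _)
    (Filter.Eventually.of_forall fun u ↦ ?_) (Set.Ioc_subset_Ioi_self).eventuallyLE
  exact mul_nonneg (hρ.pos u).le (exp_pos _).le

end IsDickman

/-! ### Analytic continuation -/

theorem AnalyticAt.ne_zero_of_deriv_eventuallyEq_mul {f K : ℂ → ℂ} {z : ℂ} (hf : AnalyticAt ℂ f z)
    (hK : AnalyticAt ℂ K z) (h : deriv f =ᶠ[nhds z] fun w ↦ K w * f w)
    (hne : ¬ f =ᶠ[nhds z] 0) : f z ≠ 0 := by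
  intro h0
  have h1 := hf.analyticOrderAt_deriv_add_one
  simp only [h0, sub_zero] at h1
  rw [analyticOrderAt_congr h, show (fun w ↦ K w * f w) = K * f from rfl,
    analyticOrderAt_mul hK hf] at h1
  have hfin : analyticOrderAt f z ≠ ⊤ := by
    rwa [Ne, analyticOrderAt_eq_top]
  change _ = analyticOrderAt f z at h1
  generalize analyticOrderAt f z = a at *
  generalize analyticOrderAt K z = b at *
  lift a to ℕ using hfin
  cases b with
  | top => simp at h1
  | coe b => norm_cast at h1; omega

theorem AnalyticOnNhd.ne_zero_of_deriv_eq_mul {f K : ℂ → ℂ} {U V : Set ℂ}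
    (hf : AnalyticOnNhd ℂ f U) (hK : AnalyticOnNhd ℂ K U) (hU : IsOpen U) (hUc : IsPreconnected U)
    (hV : IsOpen V) {z₀ : ℂ} (hz₀ : z₀ ∈ V) (hVU : V ⊆ U) (hne : f z₀ ≠ 0)
    (h : ∀ z ∈ V, deriv f z = K z * f z) : ∀ z ∈ U, f z ≠ 0 := by
  have key : Set.EqOn (deriv f) (fun w ↦ K w * f w) U :=
    AnalyticOnNhd.eqOn_of_preconnected_of_eventuallyEq hf.deriv (hK.mul hf) hUc (hVU hz₀)
      (Filter.eventually_of_mem (hV.mem_nhds hz₀) h)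
  intro z hz
  refine (hf z hz).ne_zero_of_deriv_eventuallyEq_mul (hK z hz)
    (Filter.eventually_of_mem (hU.mem_nhds hz) key) fun h0 ↦ hne ?_
  exact hf.eqOn_zero_of_preconnected_of_eventuallyEq_zero hUc hz h0 (hVU hz₀)

theorem isPreconnected_re_gt_diff_one (σ : ℝ) (hσ : σ < 1) :
    IsPreconnected ({s : ℂ | σ < s.re} \ {1}) := by
  have h1 : IsPreconnected {s : ℂ | σ < s.re ∧ 0 < s.im} :=
    ((convex_halfSpace_re_gt σ).inter (convex_halfSpace_im_gt 0)).isPreconnected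
  have h2 : IsPreconnected {s : ℂ | σ < s.re ∧ s.im < 0} :=
    ((convex_halfSpace_re_gt σ).inter (convex_halfSpace_im_lt 0)).isPreconnected
  have h3 : IsPreconnected {s : ℂ | 1 < s.re} := (convex_halfSpace_re_gt 1).isPreconnected
  have h4 : IsPreconnected {s : ℂ | σ < s.re ∧ s.re < 1} :=
    ((convex_halfSpace_re_gt σ).inter (convex_halfSpace_re_lt 1)).isPreconnected
  have h13 := h1.union' (t := {s : ℂ | 1 < s.re}) ⟨⟨2, 1⟩,
    And.intro (And.intro (by simp; linarith) (by simp)) (by simp)⟩ h3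
  have h132 := h13.union' (t := {s : ℂ | σ < s.re ∧ s.im < 0})
    ⟨⟨2, -1⟩, Or.inr (by simp), by simp; linarith, by simp⟩ h2
  have h1324 := h132.union' (t := {s : ℂ | σ < s.re ∧ s.re < 1}) ⟨⟨(σ + 1) / 2, 1⟩,
    Or.inl (Or.inl ⟨by simp; linarith, by simp⟩), by simp; linarith, by simp; linarith⟩ h4
  convert h1324 using 1
  ext s
  simp only [Set.mem_sdiff, Set.mem_ofPred_eq, Set.mem_singleton_iff, Set.mem_union, Complex.ext_iff,
    Complex.one_re, Complex.one_im]
  constructor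
  · rintro ⟨h, h'⟩
    rcases lt_trichotomy s.im 0 with hi | hi | hi
    · tauto
    · rcases lt_trichotomy s.re 1 with hr | hr | hr <;> tauto
    · tauto
  · rintro (((h | h) | h) | h)
    · exact ⟨h.1, fun hs ↦ h.2.ne' hs.2⟩
    · exact ⟨hσ.trans h, fun hs ↦ h.ne' hs.1⟩
    · exact ⟨h.1, fun hs ↦ h.2.ne hs.2⟩
    · exact ⟨h.1, fun hs ↦ h.2.ne hs.1⟩

/-- If `ζ` has no zeros to the right of the critical line, then the Riemann hypothesis holds. -/
theorem riemannHypothesis_of_ne_zero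
    (h : ∀ s : ℂ, 1 / 2 < s.re → s ≠ 1 → riemannZeta s ≠ 0) : RiemannHypothesis := by
  intro s hs htriv hs1
  rcases lt_trichotomy s.re (1 / 2) with hlt | heq | hgt
  · exfalso
    have hs0 : s ≠ 0 := by
      rintro rfl
      simp [riemannZeta_zero] at hs
    have hre : 1 / 2 < (1 - s).re := by
      simp only [Complex.sub_re, Complex.one_re]; linarith
    have hfe := riemannZeta_one_sub (s := 1 - s) (fun n hn ↦ by
      rw [hn] at hre
      simp at hre
      have : (0 : ℝ) ≤ n := n.cast_nonneg
      linarith) (by simpa using hs0)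
    rw [sub_sub_cancel, hs] at hfe
    have hz := h (1 - s) hre (by simpa using hs0)
    have hG : Complex.Gamma (1 - s) ≠ 0 := Complex.Gamma_ne_zero_of_re_pos (by linarith)
    have h2 : (2 * (2 * (Real.pi : ℂ)) ^ (-(1 - s))) ≠ 0 := by
      simp [Complex.cpow_eq_zero_iff, Real.pi_ne_zero]
    have hcos : Complex.cos (Real.pi * (1 - s) / 2) = 0 := by
      by_contra hc
      exact mul_ne_zero (mul_ne_zero (mul_ne_zero h2 hG) hc) hz hfe.symm
    obtain ⟨k, hk⟩ := Complex.cos_eq_zero_iff.1 hcos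
    have hs' : s = -2 * (k : ℂ) := by
      have hpi : (Real.pi : ℂ) ≠ 0 := by exact_mod_cast Real.pi_ne_zero
      have : (Real.pi : ℂ) * (1 - s) = Real.pi * (2 * k + 1) := by linear_combination 2 * hk
      have := mul_left_cancel₀ hpi this
      linear_combination -this
    have hk0 : 0 ≤ k := by
      rw [hs'] at hlt
      simp at hlt
      by_contra! hneg
      have : (k : ℝ) ≤ -1 := by exact_mod_cast (by omega : k ≤ -1)
      linarith
    have hk1 : k ≠ 0 := by
      rintro rfl
      simp at hs'
      exact hs0 hs'
    apply htriv
    refine ⟨(k - 1).toNat, ?_⟩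
    have : ((k - 1).toNat : ℤ) = k - 1 := Int.toNat_of_nonneg (by omega)
    have h3 : (((k - 1).toNat : ℕ) : ℂ) = (k : ℂ) - 1 := by
      exact_mod_cast congrArg (Int.cast : ℤ → ℂ) this
    rw [h3, hs']; ring
  · exact heq
  · exact absurd hs (h s hgt hs1)

/-- If the partial sums of `f` are bounded, then `LSeries f` extends holomorphically to the
half-plane `0 < re w`. -/
theorem exists_differentiableOn_eq_LSeries_of_sum_bounded {f : ℕ → ℂ} (h1 : f 1 = 0) {B : ℝ}
    (hB : ∀ N, ‖∑ k ∈ Finset.Icc 1 N, f k‖ ≤ B) :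
    ∃ G : ℂ → ℂ, DifferentiableOn ℂ G {w | 0 < w.re} ∧
      ∀ w, 0 < w.re → LSeriesSummable f w → G w = LSeries f w := by
  set S : ℝ → ℂ := fun t ↦ ∑ k ∈ Finset.Icc 1 ⌊t⌋₊, f k with hS
  have hS0 : ∀ t < 2, S t = 0 := by
    intro t ht
    have : ⌊t⌋₊ ≤ 1 := by
      have := Nat.floor_lt' (a := t) (n := 2) (by norm_num)
      have : ⌊t⌋₊ < 2 := this.2 (by exact_mod_cast ht)
      omega
    interval_cases h : ⌊t⌋₊ <;> simp [hS, h, h1]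
  have hmeas : Measurable S :=
    (measurable_from_top (f := fun n : ℕ ↦ ∑ k ∈ Finset.Icc 1 n, f k)).comp Nat.measurable_floor
  have hloc : MeasureTheory.LocallyIntegrableOn S (Set.Ioi 0) := by
    refine MeasureTheory.LocallyIntegrable.locallyIntegrableOn ?_ _
    refine (MeasureTheory.locallyIntegrable_const B).mono hmeas.aestronglyMeasurable
      (Filter.Eventually.of_forall fun t ↦ ?_)
    exact (hB _).trans (le_abs_self B)
  refine ⟨fun w ↦ w * mellin S (-w), fun w hw ↦ ?_, fun w hw hsum ↦ ?_⟩
  · refine DifferentiableAt.differentiableWithinAt ?_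
    have : DifferentiableAt ℂ (mellin S) (-w) := by
      refine mellin_differentiableAt_of_isBigO_rpow (a := 0) (b := (-w).re - 1) hloc ?_ ?_ ?_ ?_
      · refine Asymptotics.IsBigO.of_bound B (Filter.Eventually.of_forall fun t ↦ ?_)
        simpa using hB _
      · simpa using hw
      · refine Asymptotics.IsBigO.of_bound 0 ?_
        filter_upwards [nhdsWithin_le_nhds (Iio_mem_nhds (two_pos : (0 : ℝ) < 2))]
          with t ht
        simp [hS0 t ht]
      · linarith
    exact differentiableAt_id.mul (this.comp w differentiableAt_id.neg)
  · rw [LSeries_eq_mul_integral f le_rfl hw hsum]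
    · change w * mellin S (-w) = _
      congr 1
      rw [mellin, MeasureTheory.setIntegral_eq_of_subset_of_forall_sdiff_eq_zero measurableSet_Ioi
        (Set.Ioi_subset_Ioi zero_le_one)]
      · refine MeasureTheory.integral_congr_ae (Filter.Eventually.of_forall fun t ↦ ?_)
        simp only [smul_eq_mul]
        rw [mul_comm, neg_add']
      · rintro t ⟨-, ht⟩
        rw [hS0 t (by simp at ht; linarith), smul_zero]
    · refine Asymptotics.IsBigO.of_bound B (Filter.Eventually.of_forall fun t ↦ ?_)
      simpa using hB _

/-- The coefficients of `∑ p⁻ˢ - ∑ n⁻ˢ / log n`. -/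
noncomputable def primeDefect (n : ℕ) : ℝ := (if n.Prime then 1 else 0) - (Real.log n)⁻¹

theorem abs_inv_log_le (n : ℕ) : |(Real.log n)⁻¹| ≤ (Real.log 2)⁻¹ := by
  have h2 : 0 < Real.log 2 := Real.log_pos one_lt_two
  rcases lt_or_ge n 2 with h | h
  · interval_cases n <;> simp [h2.le]
  · have : Real.log 2 ≤ Real.log n := Real.log_le_log two_pos (by exact_mod_cast h)
    rw [abs_of_nonneg (inv_nonneg.2 (h2.le.trans this))]
    exact inv_anti₀ h2 this

theorem LSeries_primeIndicator (s : ℂ) :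
    LSeries (fun n ↦ if n.Prime then 1 else 0) s = ∑' p : Nat.Primes, (p : ℂ) ^ (-s) := by
  rw [LSeries, ← tsum_subtype_eq_of_support_subset (s := {p | p.Prime})]
  · refine tsum_congr fun p ↦ ?_
    rw [LSeries.term_of_ne_zero p.2.ne_zero, if_pos (show Nat.Prime p from p.2), Complex.cpow_neg, one_div]
  · intro n hn
    by_contra hp
    simp only [Set.mem_ofPred_eq] at hp
    simp [LSeries.term, hp] at hn

theorem hasDerivAt_LSeries_inv_log {s : ℂ} (hs : 1 < s.re) :
    HasDerivAt (LSeries fun n ↦ ((Real.log n)⁻¹ : ℝ)) (-(riemannZeta s - 1)) s := by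
  have habs : LSeries.abscissaOfAbsConv (fun n ↦ (((Real.log n)⁻¹ : ℝ) : ℂ)) < s.re := by
    refine (LSeries.abscissaOfAbsConv_le_of_le_const ⟨(Real.log 2)⁻¹, fun n _ ↦ ?_⟩).trans_lt
      (by exact_mod_cast hs)
    rw [Complex.norm_real]
    exact abs_inv_log_le n
  have h := LSeries_hasDerivAt habs
  have hd : LSeries (LSeries.logMul fun n ↦ (((Real.log n)⁻¹ : ℝ) : ℂ)) s = riemannZeta s - 1 := by
    rw [← LSeries_one_eq_riemannZeta hs, ← Pi.one_apply (M := fun _ : ℂ ↦ ℂ) s,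
      ← LSeries_delta, ← LSeries_sub]
    · refine LSeries_congr (fun {n} hn ↦ ?_) s
      rcases eq_or_ne n 1 with rfl | h1
      · simp [LSeries.logMul, LSeries.delta]
      · have : Real.log n ≠ 0 := (Real.log_pos (by exact_mod_cast (by omega : 1 < n))).ne'
        simp only [LSeries.logMul, Pi.sub_apply, Pi.one_apply, LSeries.delta, h1, if_false, sub_zero]
        rw [← Complex.natCast_log, ← Complex.ofReal_mul, mul_inv_cancel₀ this, Complex.ofReal_one]
    · exact LSeriesSummable_one_iff.2 hs
    · refine LSeriesSummable_of_bounded_of_one_lt_re (m := 1) (fun n _ ↦ ?_) hs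
      rw [LSeries.delta]
      split_ifs <;> simp
  rwa [hd] at h

theorem rpow_neg_le_two_rpow_neg {p : ℕ} (hp : 2 ≤ p) {σ : ℝ} (hσ : 0 < σ) :
    (p : ℝ) ^ (-σ) ≤ 2 ^ (-σ) :=
  Real.rpow_le_rpow_of_nonpos two_pos (by exact_mod_cast hp) (by linarith)

theorem two_rpow_neg_lt_one {σ : ℝ} (hσ : 0 < σ) : (2 : ℝ) ^ (-σ) < 1 :=
  Real.rpow_lt_one_of_one_lt_of_neg one_lt_two (by linarith)

theorem norm_prime_cpow_neg_le {p : ℕ} (hp : p.Prime) {σ : ℝ} {s : ℂ} (hs : σ ≤ s.re) :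
    ‖(p : ℂ) ^ (-s)‖ ≤ (p : ℝ) ^ (-σ) := by
  rw [Complex.norm_natCast_cpow_of_pos hp.pos]
  exact Real.rpow_le_rpow_of_exponent_le (by exact_mod_cast hp.one_le) (by simpa using hs)

theorem norm_log_one_sub_add_le {p : ℕ} (hp : p.Prime) {σ : ℝ} (hσ : 0 < σ) {s : ℂ}
    (hs : σ ≤ s.re) : ‖-Complex.log (1 - (p : ℂ) ^ (-s)) - (p : ℂ) ^ (-s)‖ ≤
      (1 - (2 : ℝ) ^ (-σ))⁻¹ / 2 * (p : ℝ) ^ (-(2 * σ)) := by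
  have h1 := norm_prime_cpow_neg_le hp hs
  have h2 := rpow_neg_le_two_rpow_neg hp.two_le hσ
  have h3 := two_rpow_neg_lt_one hσ
  have h := Complex.norm_log_one_add_sub_self_le (z := -(p : ℂ) ^ (-s))
    (by rw [norm_neg]; linarith)
  rw [norm_neg] at h
  have hsq : (p : ℝ) ^ (-(2 * σ)) = ((p : ℝ) ^ (-σ)) ^ 2 := by
    rw [← Real.rpow_natCast, ← Real.rpow_mul p.cast_nonneg]
    congr 1
    push_cast
    ring
  calc _ = ‖Complex.log (1 + -(p : ℂ) ^ (-s)) - -(p : ℂ) ^ (-s)‖ := by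
        rw [← norm_neg]; congr 1; ring_nf
    _ ≤ _ := h
    _ ≤ ((p : ℝ) ^ (-σ)) ^ 2 * (1 - (2 : ℝ) ^ (-σ))⁻¹ / 2 := by
        gcongr
        · exact inv_nonneg.2 (by linarith)
        · linarith
    _ = _ := by rw [hsq]; ring

theorem differentiableOn_tsum_primes_log {σ : ℝ} (hσ : 1 / 2 < σ) :
    DifferentiableOn ℂ
      (fun s : ℂ ↦ ∑' p : Nat.Primes, (-Complex.log (1 - (p : ℂ) ^ (-s)) - (p : ℂ) ^ (-s)))
      {s | σ < s.re} := by
  refine Complex.differentiableOn_tsum_of_summable_norm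
    (u := fun p : Nat.Primes ↦ (1 - (2 : ℝ) ^ (-σ))⁻¹ / 2 * (p : ℝ) ^ (-(2 * σ)))
    ((Nat.Primes.summable_rpow.2 (by linarith)).mul_left _) (fun p s hs ↦ ?_)
    (isOpen_lt continuous_const Complex.continuous_re) (fun p s hs ↦
      norm_log_one_sub_add_le p.2 (by linarith) (le_of_lt hs))
  refine DifferentiableAt.differentiableWithinAt ?_
  have hp0 : (p : ℂ) ≠ 0 := by exact_mod_cast p.2.ne_zero
  have hd : DifferentiableAt ℂ (fun s : ℂ ↦ (p : ℂ) ^ (-s)) s :=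
    (differentiableAt_id.neg).const_cpow (Or.inl hp0)
  refine (((differentiableAt_const _).sub hd).clog ?_).neg.sub hd
  refine Complex.mem_slitPlane_of_norm_lt_one (z := -(p : ℂ) ^ (-s)) ?_
  rw [norm_neg]
  exact (norm_prime_cpow_neg_le p.2 (le_of_lt hs)).trans_lt
    ((rpow_neg_le_two_rpow_neg p.2.two_le (by linarith)).trans_lt
      (two_rpow_neg_lt_one (by linarith)))

theorem riemannZeta_ne_zero_of_sum_primeDefect_bounded {σ : ℝ} (hσ : 1 / 2 < σ) (hσ1 : σ < 1)
    {B : ℝ} (hB : ∀ N, |∑ k ∈ Finset.Icc 1 N, primeDefect k * (k : ℝ) ^ (-σ)| ≤ B) :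
    ∀ s : ℂ, σ < s.re → s ≠ 1 → riemannZeta s ≠ 0 := by
  obtain ⟨G, hG, hGL⟩ := exists_differentiableOn_eq_LSeries_of_sum_bounded
    (f := fun k ↦ ((primeDefect k * (k : ℝ) ^ (-σ) : ℝ) : ℂ)) (by simp [primeDefect, Nat.not_prime_one]) (B := B)
    (fun N ↦ by rw [← Complex.ofReal_sum, Complex.norm_real]; exact hB N)
  set T : ℂ → ℂ := fun s ↦
    ∑' p : Nat.Primes, (-Complex.log (1 - (p : ℂ) ^ (-s)) - (p : ℂ) ^ (-s)) with hT
  have hTd : DifferentiableOn ℂ T {s | σ < s.re} := differentiableOn_tsum_primes_log hσ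
  set H : ℂ → ℂ := fun s ↦ G (s - σ) with hH
  have hHd : DifferentiableOn ℂ H {s | σ < s.re} :=
    hG.comp (differentiableOn_id.sub_const _) (fun s hs ↦ by simpa using hs)
  have hopen : IsOpen {s : ℂ | σ < s.re} := isOpen_lt continuous_const Complex.continuous_re
  have hbdd : ∀ n : ℕ, |primeDefect n| ≤ 1 + (Real.log 2)⁻¹ := fun n ↦ by
    refine (abs_sub _ _).trans (add_le_add ?_ (abs_inv_log_le n))
    split_ifs <;> simp
  have hzeta : ∀ s : ℂ, 1 < s.re → riemannZeta s =
      Complex.exp (T s + (H s + LSeries (fun n ↦ ((Real.log n)⁻¹ : ℝ)) s)) := by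
    intro s hs
    have hsum1 : LSeriesSummable (fun n ↦ ((primeDefect n : ℝ) : ℂ)) s :=
      LSeriesSummable_of_bounded_of_one_lt_re (m := 1 + (Real.log 2)⁻¹)
        (fun n _ ↦ by rw [Complex.norm_real]; exact hbdd n) hs
    have hsum2 : LSeriesSummable (fun n ↦ (((Real.log n)⁻¹ : ℝ) : ℂ)) s :=
      LSeriesSummable_of_bounded_of_one_lt_re (m := (Real.log 2)⁻¹)
        (fun n _ ↦ by rw [Complex.norm_real]; exact abs_inv_log_le n) hs
    have hterm : LSeries.term (fun k ↦ ((primeDefect k * (k : ℝ) ^ (-σ) : ℝ) : ℂ)) (s - σ) =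
        LSeries.term (fun n ↦ ((primeDefect n : ℝ) : ℂ)) s := by
      ext n
      rcases eq_or_ne n 0 with rfl | hn
      · simp
      have hn' : (n : ℂ) ≠ 0 := by exact_mod_cast hn
      rw [LSeries.term_of_ne_zero hn, LSeries.term_of_ne_zero hn, Complex.cpow_sub _ _ hn',
        Complex.ofReal_mul, Complex.ofReal_cpow n.cast_nonneg, Complex.ofReal_natCast,
        Complex.ofReal_neg, Complex.cpow_neg]
      have : (n : ℂ) ^ (σ : ℂ) ≠ 0 := by simp [Complex.cpow_eq_zero_iff, hn]
      field_simp
    have hHs : H s = LSeries (fun n ↦ ((primeDefect n : ℝ) : ℂ)) s := by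
      rw [hH]
      simp only
      rw [hGL (s - σ) (by simp; linarith) (by rw [LSeriesSummable, hterm]; exact hsum1), LSeries,
        hterm, LSeries]
    have hprimes : H s + LSeries (fun n ↦ ((Real.log n)⁻¹ : ℝ)) s =
        ∑' p : Nat.Primes, (p : ℂ) ^ (-s) := by
      rw [hHs, ← LSeries_add hsum1 hsum2, ← LSeries_primeIndicator]
      refine LSeries_congr (fun {n} _ ↦ ?_) s
      simp only [Pi.add_apply, primeDefect]
      push_cast
      split_ifs <;> simp
    rw [hprimes, hT]
    simp only
    rw [← riemannZeta_eulerProduct_exp_log hs, ← Summable.tsum_add]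
    · simp
    · refine Summable.of_norm_bounded
        ((Nat.Primes.summable_rpow.2 (by linarith : -(2 * σ) < -1)).mul_left _) fun p ↦
        norm_log_one_sub_add_le p.2 (by linarith) (by linarith : σ ≤ s.re)
    · exact Summable.of_norm_bounded (Nat.Primes.summable_rpow.2 (by linarith : -s.re < -1))
        fun p ↦ norm_prime_cpow_neg_le p.2 le_rfl
  have hU : IsOpen ({s : ℂ | σ < s.re} \ {1}) := hopen.sdiff isClosed_singleton
  have hzd : DifferentiableOn ℂ riemannZeta ({s : ℂ | σ < s.re} \ {1}) := fun s hs ↦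
    (differentiableAt_riemannZeta hs.2).differentiableWithinAt
  have hV : IsOpen {s : ℂ | 1 < s.re} := isOpen_lt continuous_const Complex.continuous_re
  have hKd : DifferentiableOn ℂ
      (fun s ↦ deriv T s + (deriv H s + -(riemannZeta s - 1))) ({s : ℂ | σ < s.re} \ {1}) :=
    ((hTd.deriv hopen).mono Set.sdiff_subset).add
      (((hHd.deriv hopen).mono Set.sdiff_subset).add (hzd.sub_const 1).neg)
  have hmain := AnalyticOnNhd.ne_zero_of_deriv_eq_mul (hzd.analyticOnNhd hU)
    (hKd.analyticOnNhd hU) hU (isPreconnected_re_gt_diff_one σ hσ1) hV (z₀ := 2) (by simp)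
    (fun s hs ↦ ⟨lt_trans hσ1 hs, by rintro rfl; simp at hs⟩)
    (riemannZeta_ne_zero_of_one_lt_re (by simp)) (fun s hs ↦ by
      have hs' : s ∈ {s : ℂ | σ < s.re} := lt_trans hσ1 hs
      have hT' := (hTd.differentiableAt (hopen.mem_nhds hs')).hasDerivAt
      have hH' := (hHd.differentiableAt (hopen.mem_nhds hs')).hasDerivAt
      have h := (hT'.add (hH'.add (hasDerivAt_LSeries_inv_log hs))).cexp
      have heq : riemannZeta =ᶠ[nhds s] _ := Filter.eventually_of_mem (hV.mem_nhds hs) hzeta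
      refine (heq.deriv_eq.trans h.deriv).trans ?_
      rw [mul_comm]
      congr 1
      exact (hzeta s hs).symm)
  exact fun s hs hs1 ↦ hmain s ⟨hs, hs1⟩

/-! ### Smooth numbers -/

/-- The Euler product of the zeta function at the real point `σ`, over the primes `p ≤ m`. -/
noncomputable def smoothZeta (m : ℕ) (σ : ℝ) : ℝ :=
  ∏ p ∈ (m + 1).primesBelow, (1 - (p : ℝ) ^ (-σ))⁻¹

/-- The multiplicative map `k ↦ k ^ (-σ)`, for `0 < σ`. -/
noncomputable def rpowNegHom {σ : ℝ} (hσ : 0 < σ) : ℕ →*₀ ℝ where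
  toFun k := (k : ℝ) ^ (-σ)
  map_zero' := by simp [Real.zero_rpow (neg_ne_zero.2 hσ.ne')]
  map_one' := by simp
  map_mul' a b := by
    push_cast
    exact Real.mul_rpow a.cast_nonneg b.cast_nonneg

theorem hasSum_smoothZeta (m : ℕ) {σ : ℝ} (hσ : 0 < σ) :
    HasSum ((m + 1).smoothNumbers.indicator fun k : ℕ ↦ (k : ℝ) ^ (-σ)) (smoothZeta m σ) := by
  rw [← hasSum_subtype_iff_indicator]
  refine (EulerProduct.summable_and_hasSum_smoothNumbers_prod_primesBelow_geometric
    (f := (rpowNegHom hσ).toMonoidHom) (fun {p} hp ↦ ?_) (m + 1)).2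
  change ‖(p : ℝ) ^ (-σ)‖ < 1
  rw [Real.norm_of_nonneg (Real.rpow_nonneg p.cast_nonneg _)]
  exact (rpow_neg_le_two_rpow_neg hp.two_le hσ).trans_lt (two_rpow_neg_lt_one hσ)

theorem sum_primesBelow_eq (m : ℕ) (f : ℕ → ℝ) :
    ∑ p ∈ (m + 1).primesBelow, f p =
      ∑ k ∈ Finset.Icc 1 m, (if k.Prime then 1 else 0) * f k := by
  simp_rw [ite_mul, one_mul, zero_mul, ← Finset.sum_filter]
  refine Finset.sum_congr ?_ fun _ _ ↦ rfl
  ext p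
  simp only [Nat.mem_primesBelow, Finset.mem_filter, Finset.mem_Icc]
  constructor
  · rintro ⟨h1, h2⟩
    exact ⟨⟨h2.one_le, by omega⟩, h2⟩
  · rintro ⟨⟨_, h1⟩, h2⟩
    exact ⟨by omega, h2⟩

theorem log_smoothZeta (m : ℕ) {σ : ℝ} (hσ : 0 < σ) :
    log (smoothZeta m σ) = ∑ p ∈ (m + 1).primesBelow, -log (1 - (p : ℝ) ^ (-σ)) := by
  rw [smoothZeta, log_prod]
  · exact Finset.sum_congr rfl fun p _ ↦ log_inv _
  · intro p hp
    have := (rpow_neg_le_two_rpow_neg (Nat.prime_of_mem_primesBelow hp).two_le hσ).trans_lt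
      (two_rpow_neg_lt_one hσ)
    exact inv_ne_zero (by linarith)

theorem smoothZeta_pos (m : ℕ) {σ : ℝ} (hσ : 0 < σ) : 0 < smoothZeta m σ := by
  refine Finset.prod_pos fun p hp ↦ inv_pos.2 ?_
  have := (rpow_neg_le_two_rpow_neg (Nat.prime_of_mem_primesBelow hp).two_le hσ).trans_lt
    (two_rpow_neg_lt_one hσ)
  linarith

theorem neg_log_one_sub_bounds {x c : ℝ} (hx : 0 ≤ x) (hxc : x ≤ c) (hc : c < 1) :
    x ≤ -log (1 - x) ∧ -log (1 - x) ≤ x + (1 - c)⁻¹ * x ^ 2 ∧ -log (1 - x) ≤ (1 - c)⁻¹ * x := by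
  have h1 : 0 < 1 - x := by linarith
  have h2 := log_le_sub_one_of_pos h1
  have h3 := log_le_sub_one_of_pos (inv_pos.2 h1)
  rw [log_inv] at h3
  have h4 : (1 - x)⁻¹ ≤ (1 - c)⁻¹ := inv_anti₀ (by linarith) (by linarith)
  have h5 : (1 - x)⁻¹ - 1 = (1 - x)⁻¹ * x := by field_simp; ring
  have h6 : (1 - x)⁻¹ - 1 = x + (1 - x)⁻¹ * x ^ 2 := by field_simp; ring
  refine ⟨by linarith, ?_, ?_⟩
  · rw [h6] at h3
    exact h3.trans (by gcongr)
  · rw [h5] at h3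
    exact h3.trans (by gcongr)

theorem exists_abs_log_smoothZeta_sub_le {σ : ℝ} (hσ : 1 / 2 < σ) :
    ∃ K, ∀ m : ℕ, |log (smoothZeta m σ) -
      ∑ k ∈ Finset.Icc 1 m, (if k.Prime then 1 else 0) * (k : ℝ) ^ (-σ)| ≤ K := by
  have hσ0 : 0 < σ := by linarith
  have hs : Summable fun k : ℕ ↦ ((k : ℝ) ^ (-σ)) ^ 2 := by
    have : (fun k : ℕ ↦ ((k : ℝ) ^ (-σ)) ^ 2) = fun k : ℕ ↦ (k : ℝ) ^ (-(2 * σ)) := by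
      funext k
      rw [← Real.rpow_natCast, ← Real.rpow_mul k.cast_nonneg]
      congr 1
      push_cast
      ring
    rw [this]
    exact Real.summable_nat_rpow.2 (by linarith)
  have hc := two_rpow_neg_lt_one hσ0
  set c := (2 : ℝ) ^ (-σ)
  refine ⟨(1 - c)⁻¹ * ∑' k : ℕ, ((k : ℝ) ^ (-σ)) ^ 2, fun m ↦ ?_⟩
  have hb : ∀ p ∈ (m + 1).primesBelow, _ := fun p hp ↦
    neg_log_one_sub_bounds (Real.rpow_nonneg p.cast_nonneg (-σ))
      (rpow_neg_le_two_rpow_neg (Nat.prime_of_mem_primesBelow hp).two_le hσ0) hc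
  rw [← sum_primesBelow_eq m fun k ↦ (k : ℝ) ^ (-σ), log_smoothZeta m hσ0,
    ← Finset.sum_sub_distrib, abs_of_nonneg
      (Finset.sum_nonneg fun p hp ↦ sub_nonneg.2 (hb p hp).1)]
  calc _ ≤ ∑ p ∈ (m + 1).primesBelow, (1 - c)⁻¹ * ((p : ℝ) ^ (-σ)) ^ 2 :=
        Finset.sum_le_sum fun p hp ↦ by linarith [(hb p hp).2.1]
    _ ≤ _ := by
        rw [← Finset.mul_sum]
        have : 0 ≤ (1 - c)⁻¹ := inv_nonneg.2 (by linarith)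
        gcongr
        exact hs.sum_le_tsum _ fun _ _ ↦ sq_nonneg _

theorem sum_rpow_neg_le {σ : ℝ} (hσ0 : 0 < σ) (hσ : σ < 1) {m : ℕ} (hm : 1 ≤ m) :
    ∑ k ∈ Finset.Icc 1 m, (k : ℝ) ^ (-σ) ≤ (1 - σ)⁻¹ * (m : ℝ) ^ (1 - σ) := by
  have h := (integral_le_sum_Icc_and_le (f := fun x : ℝ ↦ x ^ (-σ)) hm (fun x hx y _ hxy ↦
    Real.rpow_le_rpow_of_nonpos (by simpa using zero_lt_one.trans_le (by simpa using hx.1)) hxy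
      (by linarith)) (by positivity)).2
  rw [integral_rpow (Or.inl (by linarith))] at h
  simp only [Nat.cast_one, Real.one_rpow] at h
  refine h.trans ?_
  have h1 : 1 ≤ (1 - σ)⁻¹ := (one_le_inv₀ (by linarith)).2 (by linarith)
  rw [show -σ + 1 = 1 - σ by ring, div_eq_mul_inv]
  nlinarith

theorem exists_log_smoothZeta_le {σ : ℝ} (hσ0 : 0 < σ) (hσ : σ < 1) :
    ∃ c, 0 < c ∧ ∀ m : ℕ, 1 ≤ m → log (smoothZeta m σ) ≤ c * (m : ℝ) ^ (1 - σ) := by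
  have hc := two_rpow_neg_lt_one hσ0
  set c := (2 : ℝ) ^ (-σ)
  have hc' : 0 < (1 - c)⁻¹ := inv_pos.2 (by linarith)
  refine ⟨(1 - c)⁻¹ * (1 - σ)⁻¹, mul_pos hc' (inv_pos.2 (by linarith)), fun m hm ↦ ?_⟩
  rw [log_smoothZeta m hσ0, mul_assoc]
  refine le_trans ?_ (mul_le_mul_of_nonneg_left (sum_rpow_neg_le hσ0 hσ hm) hc'.le)
  rw [Finset.mul_sum]
  calc _ ≤ ∑ p ∈ (m + 1).primesBelow, (1 - c)⁻¹ * (p : ℝ) ^ (-σ) :=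
        Finset.sum_le_sum fun p hp ↦ (neg_log_one_sub_bounds (Real.rpow_nonneg p.cast_nonneg (-σ))
          (rpow_neg_le_two_rpow_neg (Nat.prime_of_mem_primesBelow hp).two_le hσ0) hc).2.2
    _ ≤ _ := by
        refine Finset.sum_le_sum_of_subset_of_nonneg (fun p hp ↦ ?_) fun _ _ _ ↦ by positivity
        have h1 := (Nat.prime_of_mem_primesBelow hp).one_le
        have h2 := Nat.lt_of_mem_primesBelow hp
        exact Finset.mem_Icc.2 ⟨h1, by omega⟩

theorem mem_smoothNumbers_succ_iff {m k : ℕ} :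
    k ∈ (m + 1).smoothNumbers ↔ ∀ p : ℕ, p.Prime → p ∣ k → p ≤ m := by
  simp_rw [Nat.mem_smoothNumbers', Nat.lt_succ_iff]

/-- The partial sum up to `X` of the Dirichlet series of the `m`-smooth numbers, at `σ`. -/
noncomputable def smoothSum (m X : ℕ) (σ : ℝ) : ℝ :=
  ∑ k ∈ Finset.Icc 1 X, (m + 1).smoothNumbers.indicator (fun k : ℕ ↦ (k : ℝ) ^ (-σ)) k

theorem smoothSum_le_smoothZeta (m X : ℕ) {σ : ℝ} (hσ : 0 < σ) :
    smoothSum m X σ ≤ smoothZeta m σ :=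
  sum_le_hasSum _ (fun _ _ ↦ Set.indicator_nonneg (fun _ _ ↦ by positivity) _)
    (hasSum_smoothZeta m hσ)

theorem smoothZeta_le_smoothSum_add (m : ℕ) {X : ℕ} (hX : 1 ≤ X) {σ δ : ℝ} (hδ : 0 < δ)
    (hσ : δ < σ) :
    smoothZeta m σ ≤ smoothSum m X σ + (X : ℝ) ^ (-δ) * smoothZeta m (σ - δ) := by
  have h1 := hasSum_smoothZeta m (hδ.trans hσ)
  have h2 := (hasSum_smoothZeta m (sub_pos.2 hσ)).mul_left ((X : ℝ) ^ (-δ))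
  have h3 : HasSum (fun k ↦ if k ∈ Finset.Icc 1 X then
      (m + 1).smoothNumbers.indicator (fun k : ℕ ↦ (k : ℝ) ^ (-σ)) k else 0) (smoothSum m X σ) := by
    have := hasSum_sum_of_ne_finset_zero (L := .unconditional ℕ) (s := Finset.Icc 1 X)
      (f := fun k ↦ if k ∈ Finset.Icc 1 X then
        (m + 1).smoothNumbers.indicator (fun k : ℕ ↦ (k : ℝ) ^ (-σ)) k else 0)
      (fun b hb ↦ if_neg hb)
    rwa [Finset.sum_congr rfl fun k hk ↦ if_pos hk] at this
  refine hasSum_le (fun k ↦ ?_) h1 (h3.add h2)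
  by_cases hk : k ∈ (m + 1).smoothNumbers
  · simp only [Set.indicator_of_mem hk]
    split_ifs with hkX
    · linarith [show 0 ≤ (X : ℝ) ^ (-δ) * (k : ℝ) ^ (-(σ - δ)) by positivity]
    · have hk0 : 1 ≤ k := Nat.one_le_iff_ne_zero.2 (Nat.ne_zero_of_mem_smoothNumbers hk)
      have hXk : X ≤ k := by
        by_contra hlt
        exact hkX (Finset.mem_Icc.2 ⟨hk0, by omega⟩)
      rw [zero_add, show -σ = -δ + -(σ - δ) by ring, Real.rpow_add (by exact_mod_cast hk0)]
      gcongr ?_ * _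
      exact Real.rpow_le_rpow_of_nonpos (by exact_mod_cast hX) (by exact_mod_cast hXk)
        (by linarith)
  · simp only [Set.indicator_of_notMem hk, mul_zero, add_zero]
    split_ifs <;> rfl

theorem Psi_mul_rpow_le (m : ℕ) {X : ℕ} (hX : 1 ≤ X) {σ δ : ℝ} (hσ : δ < σ) :
    Psi X m * (X : ℝ) ^ (-σ) ≤ (X : ℝ) ^ (-δ) * smoothZeta m (σ - δ) := by
  have hX' : (0 : ℝ) < X := by exact_mod_cast hX
  refine le_trans ?_ (mul_le_mul_of_nonneg_left
    (smoothSum_le_smoothZeta m X (sub_pos.2 hσ)) (by positivity))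
  rw [show -σ = -δ + -(σ - δ) by ring, Real.rpow_add hX', mul_left_comm]
  gcongr
  rw [Psi, smoothSum, ← nsmul_eq_mul, ← Finset.sum_const, Finset.sum_filter]
  refine Finset.sum_le_sum fun k hk ↦ ?_
  obtain ⟨hk1, hk2⟩ := Finset.mem_Icc.1 hk
  simp only [Set.indicator_apply, mem_smoothNumbers_succ_iff]
  split_ifs
  · exact Real.rpow_le_rpow_of_nonpos (by exact_mod_cast hk1) (by exact_mod_cast hk2) (by linarith)
  · rfl

theorem Psi_succ (X m : ℕ) : (Psi (X + 1) m : ℝ) =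
    Psi X m + if X + 1 ∈ (m + 1).smoothNumbers then 1 else 0 := by
  simp only [Psi, Finset.card_filter, Finset.sum_Icc_succ_top (Nat.le_add_left 1 X),
    mem_smoothNumbers_succ_iff]
  push_cast
  rfl

theorem smoothSum_eq (m X : ℕ) (σ : ℝ) : smoothSum m X σ = Psi X m * ((X : ℝ) + 1) ^ (-σ) +
    ∑ n ∈ Finset.Icc 1 X, Psi n m * ((n : ℝ) ^ (-σ) - ((n : ℝ) + 1) ^ (-σ)) := by
  induction X with
  | zero => simp [smoothSum, Psi]
  | succ X ih =>
    rw [smoothSum] at ih ⊢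
    rw [Finset.sum_Icc_succ_top (Nat.le_add_left 1 X), Finset.sum_Icc_succ_top
      (Nat.le_add_left 1 X), ih, Psi_succ, Set.indicator_apply]
    push_cast
    split_ifs <;> ring

theorem rpow_neg_sub_bounds {σ x : ℝ} (hσ0 : 0 ≤ σ) (hσ : σ ≤ 1) (hx : 1 ≤ x) :
    σ / 2 * x ^ (-σ) ≤ x * (x ^ (-σ) - (x + 1) ^ (-σ)) ∧
      x * (x ^ (-σ) - (x + 1) ^ (-σ)) ≤ x ^ (-σ) := by
  have hx0 : 0 < x := by linarith
  have h1 : (x + 1) ^ (-σ) = x ^ (-σ) * (1 + -(x + 1)⁻¹) ^ σ := by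
    rw [show 1 + -(x + 1)⁻¹ = x / (x + 1) by field_simp; ring, Real.div_rpow hx0.le (by linarith),
      Real.rpow_neg (by linarith), Real.rpow_neg hx0.le]
    have : x ^ σ ≠ 0 := (Real.rpow_pos_of_pos hx0 _).ne'
    field_simp
  have hi : (x + 1)⁻¹ ≤ 1 := inv_le_one_of_one_le₀ (by linarith)
  have hi0 : 0 < (x + 1)⁻¹ := inv_pos.2 (by linarith)
  have h2 := rpow_one_add_le_one_add_mul_self (s := -(x + 1)⁻¹) (by linarith) hσ0 hσ
  have h3 := Real.rpow_le_rpow_of_exponent_ge' (x := 1 + -(x + 1)⁻¹) (by linarith) (by linarith)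
    hσ0 hσ
  rw [Real.rpow_one] at h3
  have hxi : x * (x + 1)⁻¹ = 1 - (x + 1)⁻¹ := by field_simp; ring
  have hi2 : (x + 1)⁻¹ ≤ 1 / 2 := by
    rw [inv_le_comm₀ (by linarith) (by norm_num)]; linarith
  have hp := Real.rpow_pos_of_pos hx0 (-σ)
  rw [h1, show x * (x ^ (-σ) - x ^ (-σ) * (1 + -(x + 1)⁻¹) ^ σ) =
    (x * (1 - (1 + -(x + 1)⁻¹) ^ σ)) * x ^ (-σ) by ring]
  constructor
  · gcongr
    have : x * (σ * (x + 1)⁻¹) ≤ x * (1 - (1 + -(x + 1)⁻¹) ^ σ) := by gcongr; linarith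
    nlinarith
  · have : x * (1 - (1 + -(x + 1)⁻¹) ^ σ) ≤ x * (x + 1)⁻¹ := by gcongr; linarith
    nlinarith

theorem smoothSum_bounds {m X : ℕ} {σ c C : ℝ} (hσ0 : 0 ≤ σ) (hσ : σ ≤ 1) (hc : 0 ≤ c)
    (hC : 0 ≤ C) {g : ℕ → ℝ} (hg : ∀ n, 0 ≤ g n)
    (h : ∀ n, 1 ≤ n → n ≤ X → c * (n * g n) ≤ Psi n m ∧ Psi n m ≤ C * (n * g n)) (hX : 1 ≤ X) :
    c * (σ / 2) * ∑ n ∈ Finset.Icc 1 X, g n * (n : ℝ) ^ (-σ) ≤ smoothSum m X σ ∧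
      smoothSum m X σ ≤ Psi X m * (X : ℝ) ^ (-σ) +
        C * ∑ n ∈ Finset.Icc 1 X, g n * (n : ℝ) ^ (-σ) := by
  have hn' : ∀ n ∈ Finset.Icc 1 X, (1 : ℝ) ≤ n := fun n hn ↦ by
    exact_mod_cast (Finset.mem_Icc.1 hn).1
  have hd : ∀ n ∈ Finset.Icc 1 X, 0 ≤ (n : ℝ) ^ (-σ) - ((n : ℝ) + 1) ^ (-σ) := fun n hn ↦
    sub_nonneg.2 (Real.rpow_le_rpow_of_nonpos (by linarith [hn' n hn]) (by linarith) (by linarith))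
  rw [smoothSum_eq, Finset.mul_sum, Finset.mul_sum]
  constructor
  · refine le_add_of_nonneg_of_le (by positivity) (Finset.sum_le_sum fun n hn ↦ ?_)
    obtain ⟨h1, h2⟩ := Finset.mem_Icc.1 hn
    calc _ = c * g n * (σ / 2 * (n : ℝ) ^ (-σ)) := by ring
      _ ≤ c * g n * (n * ((n : ℝ) ^ (-σ) - ((n : ℝ) + 1) ^ (-σ))) := by
          have := hg n
          gcongr ?_ * ?_
          exact (rpow_neg_sub_bounds hσ0 hσ (hn' n hn)).1
      _ = c * (n * g n) * ((n : ℝ) ^ (-σ) - ((n : ℝ) + 1) ^ (-σ)) := by ring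
      _ ≤ _ := mul_le_mul_of_nonneg_right (h n h1 h2).1 (hd n hn)
  · refine add_le_add ?_ (Finset.sum_le_sum fun n hn ↦ ?_)
    · gcongr ?_ * ?_
      exact Real.rpow_le_rpow_of_nonpos (by exact_mod_cast hX) (by linarith) (by linarith)
    · obtain ⟨h1, h2⟩ := Finset.mem_Icc.1 hn
      calc _ ≤ C * (n * g n) * ((n : ℝ) ^ (-σ) - ((n : ℝ) + 1) ^ (-σ)) :=
            mul_le_mul_of_nonneg_right (h n h1 h2).2 (hd n hn)
        _ = C * g n * (n * ((n : ℝ) ^ (-σ) - ((n : ℝ) + 1) ^ (-σ))) := by ring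
        _ ≤ C * g n * (n : ℝ) ^ (-σ) := by
            have := hg n
            gcongr ?_ * ?_
            exact (rpow_neg_sub_bounds hσ0 hσ (hn' n hn)).2
        _ = _ := by ring

/-! ### Comparison of the smooth zeta function with the Laplace transform -/

theorem isLittleO_rpow_rpow_atTop {a b : ℝ} (hab : b < a) :
    (fun x : ℝ ↦ x ^ b) =o[Filter.atTop] fun x ↦ x ^ a := by
  refine Asymptotics.isLittleO_of_tendsto' ?_ ?_
  · filter_upwards [Filter.eventually_gt_atTop 0] with x hx h
    exact absurd h (Real.rpow_pos_of_pos hx a).ne'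
  · refine (tendsto_rpow_neg_atTop (sub_pos.2 hab)).congr' ?_
    filter_upwards [Filter.eventually_gt_atTop 0] with x hx
    rw [← Real.rpow_sub hx, neg_sub]

theorem eventually_mul_rpow_add_log_le {a b : ℝ} (ha : 0 < a) (hab : b < a) (K : ℝ) :
    ∀ᶠ m : ℕ in Filter.atTop, K * ((m : ℝ) ^ b + log m + 1) ≤ (m : ℝ) ^ a := by
  have h1 : (fun x : ℝ ↦ K * (x ^ b + log x + 1)) =o[Filter.atTop] fun x ↦ x ^ a := by
    refine (((isLittleO_rpow_rpow_atTop hab).add (isLittleO_log_rpow_atTop ha)).add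
      ?_).const_mul_left K
    simpa using isLittleO_rpow_rpow_atTop ha
  filter_upwards [tendsto_natCast_atTop_atTop.eventually (h1.bound one_pos)] with m hm
  rw [one_mul, Real.norm_of_nonneg (Real.rpow_nonneg m.cast_nonneg a)] at hm
  exact (le_abs_self _).trans hm

theorem one_le_Psi {n m : ℕ} (hn : 1 ≤ n) : 1 ≤ Psi n m := by
  refine Finset.card_pos.2 ⟨1, Finset.mem_filter.2 ⟨Finset.mem_Icc.2 ⟨le_rfl, hn⟩, ?_⟩⟩
  intro p hp h1
  exact absurd (Nat.dvd_one.1 h1) hp.one_lt.ne'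

theorem Psi_one (m : ℕ) : Psi 1 m = 1 :=
  le_antisymm ((Finset.card_filter_le _ _).trans (by simp)) (one_le_Psi le_rfl)

theorem Psi_bounds {ρ : ℝ → ℝ} (hρ : IsDickman ρ) {a C : ℝ} (ha : a ≤ 1) {n m : ℕ} (hm : 2 ≤ m)
    (hn : 1 ≤ n) (hU : Upsilon n m ≤ (m : ℝ) ^ a) (hC : 0 ≤ C)
    (h : log m / log (Upsilon n m + 1) * |log ((Psi n m : ℝ) / (n * ρ (Upsilon n m)))| ≤ C) :
    exp (-(2 * C)) * (n * ρ (Upsilon n m)) ≤ Psi n m ∧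
      (Psi n m : ℝ) ≤ exp (2 * C) * (n * ρ (Upsilon n m)) := by
  have hm' : (2 : ℝ) ≤ m := by exact_mod_cast hm
  have hn' : (1 : ℝ) ≤ n := by exact_mod_cast hn
  have hL : 0 < log m := log_pos (by linarith)
  have hden : 0 < n * ρ (Upsilon n m) := mul_pos (by linarith) (hρ.pos _)
  have hP : (0 : ℝ) < Psi n m := by exact_mod_cast one_le_Psi hn
  have key : |log ((Psi n m : ℝ) / (n * ρ (Upsilon n m)))| ≤ 2 * C := by
    rcases hn.eq_or_lt with rfl | hn1
    · simp [Psi_one, Upsilon, hρ.eq_one 0 zero_le_one, hC]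
    · have hU0 : 0 < Upsilon n m := div_pos (log_pos (by exact_mod_cast hn1)) hL
      have hl0 : 0 < log (Upsilon n m + 1) := log_pos (by linarith)
      have hl : log (Upsilon n m + 1) ≤ 2 * log m := by
        rw [← Nat.cast_two, ← log_pow]
        refine log_le_log (by linarith) ?_
        have : (m : ℝ) ^ a ≤ m := by
          simpa using Real.rpow_le_rpow_of_exponent_le (by linarith : (1 : ℝ) ≤ m) ha
        nlinarith
      rw [div_mul_eq_mul_div, div_le_iff₀ hl0] at h
      have h5 : C * log (Upsilon n m + 1) ≤ C * (2 * log m) := by gcongr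
      exact le_of_mul_le_mul_left (by linarith) hL
  obtain ⟨h1, h2⟩ := abs_le.1 key
  rw [le_log_iff_exp_le (div_pos hP hden), le_div_iff₀ hden] at h1
  rw [log_le_iff_le_exp (div_pos hP hden), div_le_iff₀ hden] at h2
  exact ⟨h1, h2⟩

theorem floor_exp_bounds {T : ℝ} (hT : 0 ≤ T) :
    1 ≤ ⌊exp T⌋₊ ∧ log ⌊exp T⌋₊ ≤ T ∧ T - log 2 ≤ log ⌊exp T⌋₊ := by
  have h1 : 1 ≤ ⌊exp T⌋₊ := Nat.le_floor (by simpa using hT)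
  have h1' : (1 : ℝ) ≤ ⌊exp T⌋₊ := by exact_mod_cast h1
  refine ⟨h1, ?_, ?_⟩
  · rw [log_le_iff_le_exp (by linarith)]
    exact Nat.floor_le (exp_pos T).le
  · rw [sub_le_iff_le_add, ← log_mul (by linarith) two_ne_zero, le_log_iff_exp_le (by linarith)]
    linarith [Nat.lt_floor_add_one (exp T)]

theorem exists_abs_log_smoothZeta_sub_laplace_le {ρ : ℝ → ℝ} (hρ : IsDickman ρ) {ε σ C : ℝ}
    (hε : 0 < ε) (hσε : σ = 1 / 2 + 3 * ε) (hσ1 : σ < 1) (hC : 0 ≤ C)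
    (h : ∀ n m : ℕ, 2 ≤ m → Upsilon n m ≤ (m : ℝ) ^ (1 / 2 - ε) →
      log m / log (Upsilon n m + 1) * |log ((Psi n m : ℝ) / (n * ρ (Upsilon n m)))| ≤ C) :
    ∃ K, ∀ᶠ m : ℕ in Filter.atTop, |log (smoothZeta m σ) -
      (log (log m) + log (IsDickman.laplace ρ ((1 - σ) * log m)))| ≤ K := by
  have hσ0 : 0 < σ := by linarith
  obtain ⟨c, hc0, hc⟩ := exists_log_smoothZeta_le (σ := σ - ε) (by linarith) (by linarith)
  refine ⟨|log (exp (-(2 * C)) * σ / 4)| + |log (2 + 2 * exp (2 * C))|, ?_⟩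
  filter_upwards [Filter.eventually_ge_atTop 2,
    (tendsto_log_atTop.comp tendsto_natCast_atTop_atTop).eventually_ge_atTop 1,
    (tendsto_log_atTop.comp tendsto_natCast_atTop_atTop).eventually_ge_atTop ε⁻¹,
    eventually_mul_rpow_add_log_le (a := 1 / 2 - ε) (b := 1 - (σ - ε)) (by linarith) (by linarith)
      (ε⁻¹ * (c + 2) + 1)] with m hm hL1 hLε hev
  simp only [Function.comp_apply] at hL1 hLε
  have hm' : (2 : ℝ) ≤ m := by exact_mod_cast hm
  set L := log m with hLdef
  set F := IsDickman.laplace ρ ((1 - σ) * L) with hF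
  set A := (m : ℝ) ^ (1 / 2 - ε)
  set D := (m : ℝ) ^ (1 - (σ - ε)) with hD
  have hA0 : 0 ≤ A := by positivity
  have hD0 : 0 ≤ D := by positivity
  have hF1 : 1 ≤ F := hρ.laplace_ge (mul_nonneg (by linarith) (by linarith))
  obtain ⟨hX1, hXT, hTX⟩ := floor_exp_bounds (T := A * L) (by positivity)
  set X := ⌊exp (A * L)⌋₊ with hX
  have hX0 : (0 : ℝ) < X := by exact_mod_cast hX1
  have hlog2 : log 2 ≤ 1 := by linarith [log_two_lt_d9]
  have hXlarge : (c + 2) * (D + L + 1) ≤ ε * log X := by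
    have h1 : A ≤ A * L := le_mul_of_one_le_right hA0 hL1
    have h2 : ε * (ε⁻¹ * (c + 2) * (D + L + 1)) ≤ ε * log X := by
      gcongr
      nlinarith
    have h3 : ε * (ε⁻¹ * (c + 2) * (D + L + 1)) = (c + 2) * (D + L + 1) := by field_simp
    linarith
  have htail : (X : ℝ) ^ (-ε) * smoothZeta m (σ - ε) ≤ 1 := by
    have h1 := hc m (by omega)
    rw [← exp_log (smoothZeta_pos m (σ := σ - ε) (by linarith)), Real.rpow_def_of_pos hX0,
      ← exp_add, exp_le_one_iff]
    nlinarith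
  have hZS := smoothZeta_le_smoothSum_add m hX1 hε (by linarith : ε < σ)
  have hSZ := smoothSum_le_smoothZeta m X hσ0
  have hPX := Psi_mul_rpow_le m hX1 (by linarith : ε < σ)
  obtain ⟨hS1, hS2⟩ := smoothSum_bounds (m := m) (X := X) hσ0.le hσ1.le (exp_pos (-(2 * C))).le
    (exp_pos (2 * C)).le (g := fun n ↦ ρ (log n / L)) (fun n ↦ (hρ.pos _).le)
    (fun n hn1 hnX ↦ by
      have hU : Upsilon n m ≤ A := by
        rw [Upsilon, div_le_iff₀ (by linarith)]
        refine (log_le_log (by exact_mod_cast hn1) ?_).trans hXT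
        exact_mod_cast hnX
      exact Psi_bounds hρ (by linarith : 1 / 2 - ε ≤ 1) hm hn1 hU hC (h n m hm hU)) hX1
  obtain ⟨hR1, hR2⟩ := hρ.sum_rho_bounds hσ0.le (by linarith : (1 : ℝ) < m) hX1
  have hint := hρ.integral_tail_le (s := (1 - σ) * L) (t := (1 - (σ - ε)) * L)
    (U := log X / L) (mul_nonneg (by linarith) (by linarith)) (by nlinarith)
    (div_nonneg (log_nonneg (by exact_mod_cast hX1)) (by linarith))
  have hexpt : exp ((1 - (σ - ε)) * L) = D := by
    rw [hD, Real.rpow_def_of_pos (by linarith), mul_comm]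
  have hts : (1 - (σ - ε)) * L - (1 - σ) * L = ε * L := by ring
  have hεL : 1 ≤ ε * L := by
    rwa [inv_eq_one_div, div_le_iff₀' hε] at hLε
  have htU : -(ε * L) * (log X / L) = -(ε * log X) := by field_simp
  rw [hts, hexpt, htU, ← exp_add] at hint
  have hhalf : exp (D + (1 - (σ - ε)) * L + -(ε * log X)) / (ε * L) ≤ 1 / 2 := by
    refine (div_le_self (exp_pos _).le hεL).trans ?_
    rw [← le_log_iff_exp_le (by norm_num), one_div, log_inv]
    nlinarith
  have hLF : 1 ≤ L * F := one_le_mul_of_one_le_of_one_le hL1 hF1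
  have hlow : exp (-(2 * C)) * σ / 4 * (L * F) ≤ smoothZeta m σ := by
    have h1 : L * (F / 2) ≤ ∑ n ∈ Finset.Icc 1 X, ρ (log n / L) * (n : ℝ) ^ (-σ) := by
      refine le_trans ?_ hR1
      gcongr
      linarith
    have h2 : exp (-(2 * C)) * (σ / 2) * (L * (F / 2)) ≤ exp (-(2 * C)) * (σ / 2) *
      ∑ n ∈ Finset.Icc 1 X, ρ (log n / L) * (n : ℝ) ^ (-σ) := by gcongr
    linarith
  have hup : smoothZeta m σ ≤ (2 + 2 * exp (2 * C)) * (L * F) := by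
    have h1 : exp (2 * C) * ∑ n ∈ Finset.Icc 1 X, ρ (log n / L) * (n : ℝ) ^ (-σ) ≤
      exp (2 * C) * (2 * (L * F)) := by
        gcongr
        linarith
    linarith
  have hZ := smoothZeta_pos m hσ0
  have hq : 0 < exp (-(2 * C)) * σ / 4 := by positivity
  have hlow' := log_le_log (by positivity) hlow
  have hup' := log_le_log hZ hup
  rw [log_mul (by positivity) (by positivity), log_mul (x := L) (by positivity) (by positivity)]
    at hlow' hup'
  rw [abs_le]
  constructor <;>
    linarith [neg_abs_le (log (exp (-(2 * C)) * σ / 4)), le_abs_self (log (2 + 2 * exp (2 * C))),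
      abs_nonneg (log (exp (-(2 * C)) * σ / 4)), abs_nonneg (log (2 + 2 * exp (2 * C)))]

theorem exists_sum_primeDefect_bound {ρ : ℝ → ℝ} (hρ : IsDickman ρ) {ε σ C : ℝ}
    (hε : 0 < ε) (hσε : σ = 1 / 2 + 3 * ε) (hσ1 : σ < 1) (hC : 0 ≤ C)
    (h : ∀ n m : ℕ, 2 ≤ m → Upsilon n m ≤ (m : ℝ) ^ (1 / 2 - ε) →
      log m / log (Upsilon n m + 1) * |log ((Psi n m : ℝ) / (n * ρ (Upsilon n m)))| ≤ C) :
    ∃ B, ∀ N, |∑ k ∈ Finset.Icc 1 N, primeDefect k * (k : ℝ) ^ (-σ)| ≤ B := by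
  obtain ⟨K1, hK1⟩ := exists_abs_log_smoothZeta_sub_laplace_le hρ hε hσε hσ1 hC h
  obtain ⟨K2, hK2⟩ := exists_abs_log_smoothZeta_sub_le (by linarith : 1 / 2 < σ)
  obtain ⟨K3, hK3⟩ := hρ.exists_abs_sum_sub_log_laplace_le (by linarith : 0 < σ) hσ1
  obtain ⟨m₀, hm₀⟩ := Filter.eventually_atTop.1 (hK1.and (Filter.eventually_ge_atTop 2))
  refine ⟨max (∑ M ∈ Finset.range m₀, |∑ k ∈ Finset.Icc 1 M, primeDefect k * (k : ℝ) ^ (-σ)|)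
    (K1 + K2 + K3), fun N ↦ ?_⟩
  rcases lt_or_ge N m₀ with hN | hN
  · exact le_max_of_le_left (Finset.single_le_sum
      (f := fun M ↦ |∑ k ∈ Finset.Icc 1 M, primeDefect k * (k : ℝ) ^ (-σ)|)
      (fun _ _ ↦ abs_nonneg _) (Finset.mem_range.2 hN))
  · refine le_max_of_le_right ?_
    obtain ⟨h1, h2⟩ := hm₀ N hN
    have h3 := hK2 N
    have h4 := hK3 N h2
    have h5 : ∑ k ∈ Finset.Icc 1 N, primeDefect k * (k : ℝ) ^ (-σ) =
        ∑ k ∈ Finset.Icc 1 N, (if k.Prime then 1 else 0) * (k : ℝ) ^ (-σ) -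
          ∑ k ∈ Finset.Icc 1 N, (log k)⁻¹ * (k : ℝ) ^ (-σ) := by
      simp_rw [primeDefect, sub_mul, Finset.sum_sub_distrib]
    rw [h5]
    rw [abs_le] at *
    constructor <;> linarith [h1.1, h1.2, h3.1, h3.2, h4.1, h4.2]

/-- (Hildebrand, 1984) If for every `ε ∈ (0, 1/2)` there is a constant `C_ε > 0` such that for
all integers `n, m` with `m ≥ 2` and `Υ(n,m) ≤ m^(1/2 − ε)` one has
`(log m / log(Υ(n,m)+1)) |log(Ψ(n,m)/(n ρ(Υ(n,m))))| ≤ C_ε`, then the Riemann hypothesis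
holds. Here `ρ` is the Dickman function. -/
theorem hildebrand_criterion_riemannHypothesis
    (ρ : ℝ → ℝ)
    (hρ_cont : ContinuousOn ρ (Set.Ici (0 : ℝ)))
    (hρ_init : ∀ u : ℝ, 0 ≤ u → u ≤ 1 → ρ u = 1)
    (hρ_delay : ∀ u : ℝ, 1 < u → HasDerivAt ρ (-ρ (u - 1) / u) u)
    (h : ∀ ε : ℝ, 0 < ε → ε < 1 / 2 →
      ∃ C : ℝ, 0 < C ∧ ∀ n m : ℕ, 2 ≤ m →
        Upsilon n m ≤ (m : ℝ) ^ ((1 : ℝ) / 2 - ε) →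
        Real.log m / Real.log (Upsilon n m + 1) *
            |Real.log ((Psi n m : ℝ) / (n * ρ (Upsilon n m)))| ≤ C) :
    RiemannHypothesis := by
  set ρ' : ℝ → ℝ := fun u ↦ ρ (max u 0) with hρ'
  have hD : IsDickman ρ' := IsDickman.of_continuousOn hρ_cont hρ_init hρ_delay
  refine riemannHypothesis_of_ne_zero fun s hs hs1 ↦ ?_
  obtain ⟨σ, hσ, hσ'⟩ := exists_between (lt_min hs one_half_lt_one)
  obtain ⟨hσs, hσ1⟩ := lt_min_iff.1 hσ'
  obtain ⟨C, hC, hCh⟩ := h ((σ - 1 / 2) / 3) (by linarith) (by linarith)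
  obtain ⟨B, hB⟩ := exists_sum_primeDefect_bound hD (ε := (σ - 1 / 2) / 3) (by linarith)
    (by ring) hσ1 hC.le fun n m hm hU ↦ by
      have hU0 : 0 ≤ Upsilon n m := div_nonneg (log_natCast_nonneg n) (log_natCast_nonneg m)
      simpa only [hρ', max_eq_left hU0] using hCh n m hm hU
  exact riemannZeta_ne_zero_of_sum_primeDefect_bounded hσ hσ1 hB s hσs hs1
end

section
/- (Dickman) For every real x > 0, the proportion of n^{1/x}-smooth integers up to n converges to ρ(x): lim_{n→∞} Ψ(n, n^{1/x})/n = ρ(x). -/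
open Real Filter
open scoped Classical Topology

/-- `PsiR n y` is the number of `y`-smooth integers in `{1,…,n}`, for a real threshold `y`. -/
noncomputable def PsiR (n : ℕ) (y : ℝ) : ℕ :=
  ((Finset.Icc 1 n).filter (fun k => ∀ p : ℕ, p.Prime → p ∣ k → (p : ℝ) ≤ y)).card

namespace Dickman

/-- The partial sums `∑_{p ≤ n} log p / p` over primes. -/
noncomputable def sumLogDiv (n : ℕ) : ℝ := ∑ p ∈ Nat.primesLE n, log p / p

/-- The primes in the interval `(y, z]`. -/
noncomputable def primesIoc (y z : ℝ) : Finset ℕ := Nat.primesLE ⌊z⌋₊ \ Nat.primesLE ⌊y⌋₊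

lemma mem_primesIoc {y z : ℝ} (hy : 0 ≤ y) (hz : 0 ≤ z) {p : ℕ} :
    p ∈ primesIoc y z ↔ p.Prime ∧ y < p ∧ (p : ℝ) ≤ z := by
  simp only [primesIoc, Finset.mem_sdiff, Nat.mem_primesLE, Nat.le_floor_iff hy,
    Nat.le_floor_iff hz]
  constructor
  · rintro ⟨⟨h1, h2⟩, h3⟩
    exact ⟨h2, not_le.1 fun h => h3 ⟨h, h2⟩, h1⟩
  · rintro ⟨h1, h2, h3⟩
    exact ⟨⟨h3, h1⟩, fun h => absurd h.1 (not_le.2 h2)⟩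

lemma log_factorial_eq_sum (n : ℕ) :
    log (n.factorial : ℝ) =
      ∑ p ∈ Nat.primesLE n, (n.factorial.factorization p : ℝ) * log p := by
  conv_lhs => rw [← Nat.prod_factorization_pow_eq_self n.factorial_ne_zero]
  rw [Finsupp.prod, Nat.cast_prod, log_prod]
  · simp only [Nat.cast_pow, log_pow]
    refine Finset.sum_subset (fun p hp => ?_) fun p _ hp => ?_
    · have h := Nat.prime_of_mem_primeFactors hp
      exact Nat.mem_primesLE.2 ⟨(h.dvd_factorial).1 (Nat.dvd_of_mem_primeFactors hp), h⟩
    · rw [Finsupp.notMem_support_iff.1 hp]; simp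
  · intro p hp
    have h := Nat.prime_of_mem_primeFactors hp
    exact_mod_cast pow_ne_zero _ h.ne_zero

lemma div_le_factorization_factorial {p : ℕ} (hp : p.Prime) (n : ℕ) :
    n / p ≤ n.factorial.factorization p := by
  have h1 := Nat.factorization_factorial_mul (p := p) (n := n / p) hp
  have h2 : (p * (n / p)).factorial ∣ n.factorial :=
    Nat.factorial_dvd_factorial (Nat.mul_div_le n p)
  have h3 := (Nat.factorization_le_iff_dvd (Nat.factorial_ne_zero _)
    (Nat.factorial_ne_zero _)).2 h2 p
  omega

lemma sumLogDiv_le (n : ℕ) (hn : n ≠ 0) : sumLogDiv n ≤ log n + log 4 := by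
  have hn' : (0 : ℝ) < n := by positivity
  have h1 : n * sumLogDiv n - Chebyshev.theta n ≤ log (n.factorial : ℝ) := by
    rw [log_factorial_eq_sum, Chebyshev.theta_eq_sum_primesLE_log, sumLogDiv, Finset.mul_sum,
      ← Finset.sum_sub_distrib]
    refine Finset.sum_le_sum fun p hp => ?_
    have hp' := Nat.prime_of_mem_primesLE hp
    have hl : 0 ≤ log (p : ℝ) := log_natCast_nonneg p
    have h2 : (n : ℝ) / p - 1 ≤ (n.factorial.factorization p : ℝ) := by
      have h3 : ((n / p : ℕ) : ℝ) ≤ (n.factorial.factorization p : ℝ) := by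
        exact_mod_cast div_le_factorization_factorial hp' n
      have h4 := Nat.lt_floor_add_one ((n : ℝ) / p)
      rw [Nat.floor_div_eq_div] at h4
      linarith
    calc (n : ℝ) * (log p / p) - log p = ((n : ℝ) / p - 1) * log p := by ring
      _ ≤ _ := mul_le_mul_of_nonneg_right h2 hl
  have h2 : log (n.factorial : ℝ) ≤ n * log n := by
    rw [← log_pow]
    refine log_le_log (by positivity) ?_
    exact_mod_cast Nat.factorial_le_pow n
  have h3 := Chebyshev.theta_le_log4_mul_x hn'.le
  have h4 : n * sumLogDiv n ≤ n * (log n + log 4) := by linarith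
  exact le_of_mul_le_mul_left h4 hn'

lemma exists_sum_log_div_mul_sub_one_le :
    ∃ C : ℝ, ∀ s : Finset ℕ, (∀ p ∈ s, p.Prime) → ∑ p ∈ s, log p / (p * (p - 1) : ℝ) ≤ C := by
  have hs : Summable fun n : ℕ => 4 * (1 / (n : ℝ) ^ (3 / 2 : ℝ)) :=
    (summable_one_div_nat_rpow.2 (by norm_num)).mul_left 4
  refine ⟨∑' n : ℕ, 4 * (1 / (n : ℝ) ^ (3 / 2 : ℝ)), fun s hsp => ?_⟩
  refine le_trans (Finset.sum_le_sum fun p hp => ?_) (hs.sum_le_tsum s fun n _ => by positivity)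
  have h2 : (2 : ℝ) ≤ p := by exact_mod_cast (hsp p hp).two_le
  have hp0 : (0 : ℝ) < p := by linarith
  have h1 : log (p : ℝ) ≤ 2 * (p : ℝ) ^ (1 / 2 : ℝ) := by
    have := log_le_rpow_div hp0.le (ε := 1 / 2) (by norm_num)
    linarith
  have h3 : (p : ℝ) ^ (3 / 2 : ℝ) * (p : ℝ) ^ (1 / 2 : ℝ) = p ^ 2 := by
    rw [← rpow_add hp0]; norm_num
  rw [mul_one_div, div_le_div_iff₀ (by nlinarith) (by positivity)]
  calc log (p : ℝ) * (p : ℝ) ^ (3 / 2 : ℝ)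
      ≤ 2 * (p : ℝ) ^ (1 / 2 : ℝ) * (p : ℝ) ^ (3 / 2 : ℝ) := by gcongr
    _ = 2 * p ^ 2 := by rw [mul_assoc, mul_comm ((p : ℝ) ^ (1 / 2 : ℝ)), h3]
    _ ≤ 4 * (p * (p - 1)) := by nlinarith

lemma exists_le_sumLogDiv : ∃ C : ℝ, ∀ n : ℕ, n ≠ 0 → log n - C ≤ sumLogDiv n := by
  obtain ⟨C, hC⟩ := exists_sum_log_div_mul_sub_one_le
  refine ⟨C + 1, fun n hn => ?_⟩
  have hn' : (0 : ℝ) < n := by positivity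
  have h1 : log (n.factorial : ℝ) ≤ n * (sumLogDiv n + C) := by
    have h2 := hC (Nat.primesLE n) fun p hp => Nat.prime_of_mem_primesLE hp
    refine le_trans ?_ (mul_le_mul_of_nonneg_left (add_le_add_right h2 (sumLogDiv n)) hn'.le)
    rw [log_factorial_eq_sum, sumLogDiv, ← Finset.sum_add_distrib, Finset.mul_sum]
    refine Finset.sum_le_sum fun p hp => ?_
    have hp' := Nat.prime_of_mem_primesLE hp
    have hl : 0 ≤ log (p : ℝ) := log_natCast_nonneg p
    have h2 : (2 : ℝ) ≤ p := by exact_mod_cast hp'.two_le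
    have h3 : (n.factorial.factorization p : ℝ) ≤ n / (p - 1) := by
      have h4 : (n.factorial.factorization p : ℝ) ≤ ((n / (p - 1) : ℕ) : ℝ) := by
        exact_mod_cast Nat.factorization_factorial_le_div_pred hp' n
      refine h4.trans (Nat.cast_div_le.trans_eq ?_)
      rw [Nat.cast_sub hp'.one_lt.le, Nat.cast_one]
    refine (mul_le_mul_of_nonneg_right h3 hl).trans_eq ?_
    have : (p : ℝ) - 1 ≠ 0 := by linarith
    have : (p : ℝ) ≠ 0 := by linarith
    field_simp
    ring
  have h5 : n * log n - n ≤ log (n.factorial : ℝ) := by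
    have h6 := Stirling.le_log_factorial_stirling hn
    have h7 : 0 ≤ log (n : ℝ) := log_natCast_nonneg n
    have h8 : 0 ≤ log (2 * π) := log_nonneg (by linarith [pi_gt_three])
    linarith
  have h6 : n * (log n - (C + 1)) ≤ n * sumLogDiv n := by linarith
  exact le_of_mul_le_mul_left h6 hn'

lemma log_floor_bounds {y : ℝ} (hy : 1 ≤ y) :
    log ⌊y⌋₊ ≤ log y ∧ log y ≤ log ⌊y⌋₊ + log 2 := by
  have h1 : 1 ≤ ⌊y⌋₊ := Nat.floor_pos.2 hy
  have h1' : (1 : ℝ) ≤ ⌊y⌋₊ := by exact_mod_cast h1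
  refine ⟨log_le_log (by linarith) (Nat.floor_le (by linarith)), ?_⟩
  rw [← log_mul (by linarith) (by norm_num)]
  refine log_le_log (by linarith) ?_
  linarith [Nat.lt_floor_add_one y]

/-- A form of Mertens' first theorem. -/
lemma exists_abs_sum_log_div_sub_le :
    ∃ C : ℝ, ∀ y z : ℝ, 1 ≤ y → y ≤ z →
      |∑ p ∈ primesIoc y z, log p / p - (log z - log y)| ≤ C := by
  obtain ⟨C, hC⟩ := exists_le_sumLogDiv
  refine ⟨|C| + log 4 + log 2, fun y z hy hyz => ?_⟩
  have hsub : Nat.primesLE ⌊y⌋₊ ⊆ Nat.primesLE ⌊z⌋₊ := Nat.primesLE_mono (Nat.floor_mono hyz)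
  have h1 : ∑ p ∈ primesIoc y z, log p / p = sumLogDiv ⌊z⌋₊ - sumLogDiv ⌊y⌋₊ := by
    rw [primesIoc, sumLogDiv, sumLogDiv, ← Finset.sum_sdiff hsub]; ring
  have hy0 : ⌊y⌋₊ ≠ 0 := (Nat.floor_pos.2 hy).ne'
  have hz0 : ⌊z⌋₊ ≠ 0 := (Nat.floor_pos.2 (hy.trans hyz)).ne'
  have := hC _ hy0
  have := hC _ hz0
  have := sumLogDiv_le _ hy0
  have := sumLogDiv_le _ hz0
  have := log_floor_bounds hy
  have := log_floor_bounds (hy.trans hyz)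
  have := le_abs_self C
  rw [h1, abs_le]
  constructor <;> linarith

lemma eventually_sum_inv_bounds {u v ε : ℝ} (hu : 0 < u) (huv : u ≤ v) (hε : 0 < ε) :
    ∀ᶠ x : ℝ in atTop,
      1 - u / v - ε ≤ ∑ p ∈ primesIoc (x ^ (1 / v)) (x ^ (1 / u)), 1 / (p : ℝ) ∧
      ∑ p ∈ primesIoc (x ^ (1 / v)) (x ^ (1 / u)), 1 / (p : ℝ) ≤ v / u - 1 + ε := by
  obtain ⟨C, hC⟩ := exists_abs_sum_log_div_sub_le
  have hv : 0 < v := hu.trans_le huv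
  filter_upwards [eventually_gt_atTop 1,
    tendsto_log_atTop.eventually_ge_atTop (v * |C| / ε)] with x hx1 hxl
  have hx0 : 0 < x := by linarith
  have hl : 0 < log x := log_pos hx1
  have hy : 1 ≤ x ^ (1 / v) := one_le_rpow hx1.le (by positivity)
  have hyz : x ^ (1 / v) ≤ x ^ (1 / u) :=
    rpow_le_rpow_of_exponent_le hx1.le (one_div_le_one_div_of_le hu huv)
  have h := hC _ _ hy hyz
  have hlC : v * |C| ≤ ε * log x := by rwa [div_le_iff₀' hε] at hxl
  rw [log_rpow hx0, log_rpow hx0, abs_le] at h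
  set P := primesIoc (x ^ (1 / v)) (x ^ (1 / u)) with hP
  have hmem : ∀ p ∈ P, 0 < (p : ℝ) ∧ 1 / v * log x ≤ log p ∧ log p ≤ 1 / u * log x := by
    intro p hp
    obtain ⟨h1, h2, h3⟩ := (mem_primesIoc (by positivity) (by positivity)).1 hp
    have hp0 : 0 < (p : ℝ) := by exact_mod_cast h1.pos
    rw [← log_rpow hx0, ← log_rpow hx0]
    exact ⟨hp0, log_le_log (by positivity) h2.le, log_le_log hp0 h3⟩
  have hup : (1 / v * log x) * ∑ p ∈ P, 1 / (p : ℝ) ≤ ∑ p ∈ P, log p / p := by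
    rw [Finset.mul_sum]
    refine Finset.sum_le_sum fun p hp => ?_
    rw [mul_one_div]
    exact div_le_div_of_nonneg_right (hmem p hp).2.1 (hmem p hp).1.le
  have hlo : ∑ p ∈ P, log p / p ≤ (1 / u * log x) * ∑ p ∈ P, 1 / (p : ℝ) := by
    rw [Finset.mul_sum]
    refine Finset.sum_le_sum fun p hp => ?_
    rw [mul_one_div]
    exact div_le_div_of_nonneg_right (hmem p hp).2.2 (hmem p hp).1.le
  have hCa := le_abs_self C
  have huC : u * |C| ≤ v * |C| := mul_le_mul_of_nonneg_right huv (abs_nonneg C)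
  set S := ∑ p ∈ P, 1 / (p : ℝ)
  constructor
  · have h1 : (1 / u * log x) * (1 - u / v - ε) ≤ (1 / u * log x) * S := by
      have h2 : (1 / u * log x) * (1 - u / v - ε) =
          1 / u * log x - 1 / v * log x - 1 / u * (ε * log x) := by field_simp
      have h3 : |C| ≤ 1 / u * (ε * log x) := by
        rw [one_div, inv_mul_eq_div, le_div_iff₀ hu]; linarith
      linarith
    exact le_of_mul_le_mul_left h1 (by positivity)
  · have h1 : (1 / v * log x) * S ≤ (1 / v * log x) * (v / u - 1 + ε) := by
      have h2 : (1 / v * log x) * (v / u - 1 + ε) =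
          1 / u * log x - 1 / v * log x + 1 / v * (ε * log x) := by field_simp
      have h3 : |C| ≤ 1 / v * (ε * log x) := by
        rw [one_div, inv_mul_eq_div, le_div_iff₀ hv]; linarith
      linarith
    exact le_of_mul_le_mul_left h1 (by positivity)

/-- The largest prime factor of `k`. -/
def maxPrimeFac (k : ℕ) : ℕ := k.primeFactors.sup id

lemma le_maxPrimeFac {k p : ℕ} (hk : k ≠ 0) (hp : p.Prime) (hpk : p ∣ k) :
    p ≤ maxPrimeFac k :=
  Finset.le_sup (f := id) (Nat.mem_primeFactors.2 ⟨hp, hpk, hk⟩)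

lemma maxPrimeFac_mem {k p : ℕ} (hk : k ≠ 0) (hp : p.Prime) (hpk : p ∣ k) :
    (maxPrimeFac k).Prime ∧ maxPrimeFac k ∣ k := by
  obtain ⟨q, hq, h⟩ := Finset.exists_mem_eq_sup k.primeFactors
    ⟨p, Nat.mem_primeFactors.2 ⟨hp, hpk, hk⟩⟩ id
  rw [maxPrimeFac, h]
  exact ⟨Nat.prime_of_mem_primeFactors hq, Nat.dvd_of_mem_primeFactors hq⟩

lemma PsiR_mono (n : ℕ) {y z : ℝ} (hyz : y ≤ z) : PsiR n y ≤ PsiR n z :=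
  Finset.card_le_card <| Finset.monotone_filter_right _ fun _ _ h p hp hpk =>
    (h p hp hpk).trans hyz

lemma PsiR_le (n : ℕ) (y : ℝ) : PsiR n y ≤ n :=
  (Finset.card_filter_le _ _).trans_eq (by simp)

lemma PsiR_eq_self {n : ℕ} {y : ℝ} (h : (n : ℝ) ≤ y) : PsiR n y = n := by
  rw [PsiR, Finset.filter_true_of_mem, Nat.card_Icc, Nat.add_sub_cancel]
  intro k hk p _ hpk
  obtain ⟨h1, h2⟩ := Finset.mem_Icc.1 hk
  exact le_trans (by exact_mod_cast (Nat.le_of_dvd h1 hpk).trans h2) h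

/-- Buchstab's identity. -/
lemma PsiR_eq_add_sum (n : ℕ) {y z : ℝ} (hy : 0 ≤ y) (hyz : y ≤ z) :
    PsiR n z = PsiR n y + ∑ p ∈ primesIoc y z, PsiR (n / p) p := by
  have hz : 0 ≤ z := hy.trans hyz
  set A := (Finset.Icc 1 n).filter fun k => ∀ p : ℕ, p.Prime → p ∣ k → (p : ℝ) ≤ z with hA
  set B := (Finset.Icc 1 n).filter fun k => ∀ p : ℕ, p.Prime → p ∣ k → (p : ℝ) ≤ y with hB
  have hBA : B ⊆ A := Finset.monotone_filter_right _ fun _ _ h p hp hpk =>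
    (h p hp hpk).trans hyz
  have h1 : PsiR n z = PsiR n y + (A \ B).card := by
    rw [add_comm]; exact (Finset.card_sdiff_add_card_eq_card hBA).symm
  have hmem : ∀ k, k ∈ A \ B ↔ (1 ≤ k ∧ k ≤ n) ∧
      (∀ p : ℕ, p.Prime → p ∣ k → (p : ℝ) ≤ z) ∧ ∃ p : ℕ, p.Prime ∧ p ∣ k ∧ y < p := by
    intro k
    simp only [hA, hB, Finset.mem_sdiff, Finset.mem_filter, Finset.mem_Icc]
    push Not
    constructor
    · rintro ⟨⟨a, b⟩, c⟩
      exact ⟨a, b, c a⟩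
    · rintro ⟨a, b, c⟩
      exact ⟨⟨a, b⟩, fun _ => c⟩
  have hmaps : Set.MapsTo maxPrimeFac (A \ B : Finset ℕ) (primesIoc y z : Finset ℕ) := by
    intro k hk
    obtain ⟨⟨hk1, _⟩, hkz, p, hp, hpk, hyp⟩ := (hmem k).1 hk
    have hk0 : k ≠ 0 := by omega
    obtain ⟨hq, hqk⟩ := maxPrimeFac_mem hk0 hp hpk
    refine (mem_primesIoc hy hz).2 ⟨hq, hyp.trans_le ?_, hkz _ hq hqk⟩
    exact_mod_cast le_maxPrimeFac hk0 hp hpk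
  rw [h1, Finset.card_eq_sum_card_fiberwise hmaps]
  congr 1
  refine Finset.sum_congr rfl fun p hp => ?_
  obtain ⟨hp, hyp, hpz⟩ := (mem_primesIoc hy hz).1 hp
  symm
  refine Finset.card_bij (fun m _ => p * m) ?_ ?_ ?_
  · intro m hm
    obtain ⟨hm1, hms⟩ := Finset.mem_filter.1 hm
    obtain ⟨hm1, hmn⟩ := Finset.mem_Icc.1 hm1
    have hs : ∀ q : ℕ, q.Prime → q ∣ p * m → q ≤ p := by
      intro q hq hqk
      rcases (Nat.Prime.dvd_mul hq).1 hqk with h | h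
      · exact Nat.le_of_dvd hp.pos h
      · exact_mod_cast hms q hq h
    have hk0 : p * m ≠ 0 := mul_ne_zero hp.ne_zero (by omega)
    refine Finset.mem_filter.2 ⟨(hmem _).2 ⟨⟨by omega, ?_⟩, ?_, p, hp, dvd_mul_right _ _, hyp⟩, ?_⟩
    · exact (Nat.mul_le_mul_left p hmn).trans (Nat.mul_div_le n p)
    · exact fun q hq hqk => le_trans (by exact_mod_cast hs q hq hqk) hpz
    · obtain ⟨hq, hqk⟩ := maxPrimeFac_mem hk0 hp (dvd_mul_right p m)
      exact le_antisymm (hs _ hq hqk) (le_maxPrimeFac hk0 hp (dvd_mul_right p m))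
  · intro a _ b _ h
    exact Nat.eq_of_mul_eq_mul_left hp.pos h
  · intro k hk
    obtain ⟨hk, hkp⟩ := Finset.mem_filter.1 hk
    obtain ⟨⟨hk1, hkn⟩, hkz, q, hq, hqk, _⟩ := (hmem k).1 hk
    have hk0 : k ≠ 0 := by omega
    obtain ⟨m, rfl⟩ : p ∣ k := hkp ▸ (maxPrimeFac_mem hk0 hq hqk).2
    have hm0 : m ≠ 0 := fun h => hk0 (by simp [h])
    refine ⟨m, Finset.mem_filter.2 ⟨Finset.mem_Icc.2 ⟨by omega, ?_⟩, ?_⟩, rfl⟩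
    · rw [Nat.le_div_iff_mul_le hp.pos, mul_comm]; exact hkn
    · intro r hr hrm
      have := le_maxPrimeFac hk0 hr (hrm.mul_left p)
      rw [hkp] at this
      exact_mod_cast this

/-- Eventually `Ψ(t, y) ≥ a t`, uniformly in the range `t ≤ y ^ w`. -/
def LowerAt (a w : ℝ) : Prop :=
  ∃ M : ℝ, 0 ≤ M ∧ ∀ t, M ≤ t → ∀ y : ℝ, 1 ≤ y → t ≤ y ^ w → t * a ≤ PsiR ⌊t⌋₊ y

/-- Eventually `Ψ(t, y) ≤ b t`, uniformly in the range `t ≥ y ^ w`. -/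
def UpperAt (b w : ℝ) : Prop :=
  ∃ M : ℝ, 0 ≤ M ∧ ∀ t, M ≤ t → ∀ y : ℝ, 1 ≤ y → y ^ w ≤ t → PsiR ⌊t⌋₊ y ≤ t * b

/-- The proportion `Ψ(x, x ^ (1 / u)) / x`. -/
noncomputable def smoothRatio (u x : ℝ) : ℝ := PsiR ⌊x⌋₊ (x ^ (1 / u)) / x

lemma LowerAt.mono {a b w : ℝ} (h : LowerAt b w) (hab : a ≤ b) : LowerAt a w := by
  obtain ⟨M, hM, h⟩ := h
  exact ⟨M, hM, fun t ht y hy hty =>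
    (mul_le_mul_of_nonneg_left hab (hM.trans ht)).trans (h t ht y hy hty)⟩

lemma UpperAt.mono {a b w : ℝ} (h : UpperAt a w) (hab : a ≤ b) : UpperAt b w := by
  obtain ⟨M, hM, h⟩ := h
  exact ⟨M, hM, fun t ht y hy hty =>
    (h t ht y hy hty).trans (mul_le_mul_of_nonneg_left hab (hM.trans ht))⟩

lemma PsiR_floor_le {t : ℝ} (ht : 0 ≤ t) (y : ℝ) : (PsiR ⌊t⌋₊ y : ℝ) ≤ t :=
  le_trans (by exact_mod_cast PsiR_le _ _) (Nat.floor_le ht)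

lemma lowerAt_of_le_one {w ε : ℝ} (hw1 : w ≤ 1) (hε : 0 < ε) : LowerAt (1 - ε) w := by
  refine ⟨1 / ε, by positivity, fun t ht y hy hty => ?_⟩
  have ht0 : 0 ≤ t := le_trans (by positivity) ht
  have h1 : (⌊t⌋₊ : ℝ) ≤ y := (Nat.floor_le ht0).trans <| hty.trans <|
    (rpow_le_rpow_of_exponent_le hy hw1).trans_eq (rpow_one y)
  rw [PsiR_eq_self h1]
  rw [div_le_iff₀ hε] at ht
  linarith [Nat.lt_floor_add_one t]

lemma upperAt_of_one_le {b w : ℝ} (hb : 1 ≤ b) : UpperAt b w :=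
  ⟨0, le_rfl, fun _ ht y _ _ => (PsiR_floor_le ht y).trans (le_mul_of_one_le_right ht hb)⟩

lemma lowerAt_of_eventually {a v : ℝ} (hv : 0 < v) (h : ∀ᶠ x in atTop, a ≤ smoothRatio v x) :
    LowerAt a v := by
  obtain ⟨M, hM⟩ := eventually_atTop.1 h
  refine ⟨max M 1, by positivity, fun t ht y hy hty => ?_⟩
  have ht1 : 1 ≤ t := (le_max_right _ _).trans ht
  have h1 := hM t ((le_max_left _ _).trans ht)
  rw [smoothRatio, le_div_iff₀ (by linarith), mul_comm] at h1
  refine h1.trans ?_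
  have h2 : t ^ (1 / v) ≤ y := by
    rw [one_div]
    exact (rpow_inv_le_iff_of_pos (by linarith) (by linarith) hv).2 hty
  exact_mod_cast PsiR_mono _ h2

lemma upperAt_of_eventually {b v : ℝ} (hv : 0 < v) (h : ∀ᶠ x in atTop, smoothRatio v x ≤ b) :
    UpperAt b v := by
  obtain ⟨M, hM⟩ := eventually_atTop.1 h
  refine ⟨max M 1, by positivity, fun t ht y hy hty => ?_⟩
  have ht1 : 1 ≤ t := (le_max_right _ _).trans ht
  have h1 := hM t ((le_max_left _ _).trans ht)
  rw [smoothRatio, div_le_iff₀ (by linarith), mul_comm] at h1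
  refine le_trans ?_ h1
  have h2 : y ≤ t ^ (1 / v) := by
    rw [one_div]
    exact (le_rpow_inv_iff_of_pos (by linarith) (by linarith) hv).2 hty
  exact_mod_cast PsiR_mono _ h2

lemma tendsto_smoothRatio {c v : ℝ} (hv : 0 < v)
    (h : ∀ ε > 0, LowerAt (c - ε) v ∧ UpperAt (c + ε) v) :
    Tendsto (smoothRatio v) atTop (𝓝 c) := by
  refine Metric.tendsto_nhds.2 fun ε hε => ?_
  obtain ⟨⟨M, _, hM⟩, M', _, hM'⟩ := h (ε / 2) (by positivity)
  filter_upwards [eventually_ge_atTop M, eventually_ge_atTop M', eventually_ge_atTop 1]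
    with x hxM hxM' hx1
  have hx0 : 0 < x := by linarith
  have hy : 1 ≤ x ^ (1 / v) := one_le_rpow hx1 (by positivity)
  have hyx : (x ^ (1 / v)) ^ v = x := by
    rw [← rpow_mul hx0.le, one_div_mul_cancel hv.ne', rpow_one]
  have h1 := hM x hxM _ hy hyx.ge
  have h2 := hM' x hxM' _ hy hyx.le
  have h3 : c - ε / 2 ≤ smoothRatio v x := by
    rw [smoothRatio, le_div_iff₀ hx0]; linarith
  have h4 : smoothRatio v x ≤ c + ε / 2 := by
    rw [smoothRatio, div_le_iff₀ hx0]; linarith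
  rw [Real.dist_eq, abs_lt]
  constructor <;> linarith

lemma eventually_primeCounting_le_mul {c : ℝ} (hc : 0 < c) :
    ∀ᶠ x : ℝ in atTop, (Nat.primeCounting ⌊x⌋₊ : ℝ) ≤ c * x := by
  filter_upwards [Chebyshev.eventually_primeCounting_le one_pos, eventually_gt_atTop 1,
    tendsto_log_atTop.eventually_ge_atTop ((log 4 + 1) / c)] with x hx hx1 hxl
  refine hx.trans ?_
  rw [div_le_iff₀ hc] at hxl
  rw [div_le_iff₀ (log_pos hx1)]
  nlinarith

/-- If `Ψ(t, y) ≈ r t` when `log t / log y` is in `[u - 1, v - 1]`, then Buchstab's identity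
determines the change of the smooth proportion between `u` and `v`. -/
lemma eventually_abs_smoothRatio_sub_le {u v ξ r ε : ℝ} (hu : 1 ≤ u) (huv : u < v)
    (hξu : u ≤ ξ) (hξv : ξ ≤ v) (hε : 0 < ε) (hε1 : ε ≤ 1) (hvu : v - u ≤ ε)
    (hlow : LowerAt (r - ε) (v - 1)) (hup : UpperAt (r + ε) (u - 1)) :
    ∀ᶠ x in atTop, |smoothRatio u x - smoothRatio v x - r * ((v - u) / ξ)| ≤
      ε * (3 + 2 * |r|) * (v - u) := by
  obtain ⟨M₁, hM₁, hlow⟩ := hlow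
  obtain ⟨M₂, hM₂, hup⟩ := hup
  have hd : 0 < v - u := by linarith
  have hu0 : 0 < u := by linarith
  have hv0 : 0 < v := by linarith
  have hξ0 : 0 < ξ := by linarith
  set K := (max M₁ M₂ + 1) * (1 + |r|) with hK
  have hK0 : 0 < K := by positivity
  filter_upwards [eventually_sum_inv_bounds hu0 huv.le (mul_pos hε hd),
    eventually_primeCounting_le_mul (c := ε * (v - u) / K) (by positivity),
    eventually_ge_atTop 1] with x hS hπ hx1
  have hx0 : 0 < x := by linarith
  have hyz : x ^ (1 / v) ≤ x ^ (1 / u) :=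
    rpow_le_rpow_of_exponent_le hx1 (one_div_le_one_div_of_le hu0 huv.le)
  have hzx : x ^ (1 / u) ≤ x := by
    conv_rhs => rw [← rpow_one x]
    exact rpow_le_rpow_of_exponent_le hx1 ((div_le_one hu0).2 hu)
  have hB := PsiR_eq_add_sum ⌊x⌋₊ (by positivity) hyz
  set P := primesIoc (x ^ (1 / v)) (x ^ (1 / u)) with hP
  set S := ∑ p ∈ P, 1 / (p : ℝ)
  have hcard : K * (P.card : ℝ) ≤ ε * (v - u) * x := by
    have h1 : (P.card : ℝ) ≤ Nat.primeCounting ⌊x⌋₊ := by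
      rw [← Nat.primesLE_card_eq_primeCounting]
      exact_mod_cast Finset.card_le_card
        (Finset.sdiff_subset.trans (Nat.primesLE_mono (Nat.floor_mono hzx)))
    have h2 := h1.trans hπ
    rw [div_mul_eq_mul_div, le_div_iff₀ hK0] at h2
    linarith
  have hterm : ∀ p ∈ P, |(PsiR (⌊x⌋₊ / p) p : ℝ) - r * (x * (1 / p))| ≤
      ε * (x * (1 / p)) + K := by
    intro p hp
    obtain ⟨hpp, hyp, hpz⟩ := (mem_primesIoc (by positivity) (by positivity)).1 hp
    have hp0 : 0 < (p : ℝ) := by exact_mod_cast hpp.pos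
    have hp1 : 1 ≤ (p : ℝ) := by exact_mod_cast hpp.one_lt.le
    rw [← Nat.floor_div_natCast, mul_one_div]
    set t := x / p with ht
    have ht0 : 0 < t := by positivity
    have hle := PsiR_floor_le ht0.le p
    have hnn : (0 : ℝ) ≤ PsiR ⌊t⌋₊ p := Nat.cast_nonneg _
    by_cases hMt : max M₁ M₂ ≤ t
    · have h1 := hlow t ((le_max_left _ _).trans hMt) p hp1 (by
        rw [ht, rpow_sub_one hp0.ne']
        refine div_le_div_of_nonneg_right ?_ hp0.le
        rw [one_div] at hyp
        exact (rpow_inv_le_iff_of_pos hx0.le hp0.le hv0).1 hyp.le)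
      have h2 := hup t ((le_max_right _ _).trans hMt) p hp1 (by
        rw [ht, rpow_sub_one hp0.ne']
        refine div_le_div_of_nonneg_right ?_ hp0.le
        rw [one_div] at hpz
        exact (le_rpow_inv_iff_of_pos hp0.le hx0.le hu0).1 hpz)
      rw [abs_le]
      constructor <;> linarith
    · have h3 : t * (1 + |r|) ≤ K := by
        rw [hK]
        exact mul_le_mul_of_nonneg_right (by linarith [not_le.1 hMt]) (by positivity)
      have h4 : |r * t| = |r| * t := by rw [abs_mul, abs_of_pos ht0]
      have h5 := abs_le.1 h4.le
      have h6 : 0 ≤ ε * t := by positivity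
      have h7 : 0 ≤ |r| * t := by positivity
      rw [abs_le]
      constructor <;> linarith
  have hsum : |∑ p ∈ P, (PsiR (⌊x⌋₊ / p) p : ℝ) - r * (x * S)| ≤ ε * (x * S) + K * P.card := by
    have h1 : ∑ p ∈ P, (PsiR (⌊x⌋₊ / p) p : ℝ) - r * (x * S) =
        ∑ p ∈ P, ((PsiR (⌊x⌋₊ / p) p : ℝ) - r * (x * (1 / p))) := by
      rw [Finset.sum_sub_distrib, Finset.mul_sum, Finset.mul_sum]
    have h2 : ε * (x * S) + K * P.card = ∑ p ∈ P, (ε * (x * (1 / p)) + K) := by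
      rw [Finset.sum_add_distrib, Finset.mul_sum, Finset.mul_sum, Finset.sum_const, nsmul_eq_mul,
        mul_comm K]
    rw [h1, h2]
    exact (Finset.abs_sum_le_sum_abs _ _).trans (Finset.sum_le_sum hterm)
  have hF : smoothRatio u x - smoothRatio v x = (∑ p ∈ P, (PsiR (⌊x⌋₊ / p) p : ℝ)) / x := by
    rw [smoothRatio, smoothRatio, hB]
    push_cast
    ring
  have hmain : |smoothRatio u x - smoothRatio v x - r * S| ≤ ε * S + ε * (v - u) := by
    have h1 : smoothRatio u x - smoothRatio v x - r * S =
        (∑ p ∈ P, (PsiR (⌊x⌋₊ / p) p : ℝ) - r * (x * S)) / x := by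
      rw [hF]; field_simp
    rw [h1, abs_div, abs_of_pos hx0, div_le_iff₀ hx0]
    linarith
  have hSu : S ≤ (v - u) + ε * (v - u) := by
    have : v / u - 1 ≤ v - u := by
      rw [div_sub_one hu0.ne', div_le_iff₀ hu0]; nlinarith
    linarith [hS.2]
  have hSξ : |S - (v - u) / ξ| ≤ 2 * (ε * (v - u)) := by
    have h1 : (v - u) / v ≤ (v - u) / ξ := div_le_div_of_nonneg_left hd.le hξ0 hξv
    have h2 : (v - u) / ξ ≤ (v - u) / u := div_le_div_of_nonneg_left hd.le hu0 hξu
    have h3 : (v - u) / u - (v - u) / v ≤ ε * (v - u) := by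
      have h4 : (v - u) / u - (v - u) / v = (v - u) * (v - u) / (u * v) := by field_simp
      rw [h4]
      refine (div_le_self (by positivity) (by nlinarith)).trans ?_
      exact mul_le_mul_of_nonneg_right hvu hd.le
    have h5 : 1 - u / v = (v - u) / v := by field_simp
    have h6 : v / u - 1 = (v - u) / u := by field_simp
    rw [h5, h6] at hS
    rw [abs_le]
    constructor <;> linarith [hS.1, hS.2]
  have hεS : ε * S ≤ 2 * (ε * (v - u)) := by nlinarith [mul_pos hε hd]
  calc |smoothRatio u x - smoothRatio v x - r * ((v - u) / ξ)|
      = |(smoothRatio u x - smoothRatio v x - r * S) + r * (S - (v - u) / ξ)| := by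
        congr 1; ring
    _ ≤ |smoothRatio u x - smoothRatio v x - r * S| + |r| * |S - (v - u) / ξ| := by
        rw [← abs_mul]; exact abs_add_le _ _
    _ ≤ (ε * S + ε * (v - u)) + |r| * (2 * (ε * (v - u))) :=
        add_le_add hmain (mul_le_mul_of_nonneg_left hSξ (abs_nonneg r))
    _ ≤ ε * (3 + 2 * |r|) * (v - u) := by linarith

lemma lowerAt_and_upperAt_succ {ρ : ℝ → ℝ} (hρ_cont : ContinuousOn ρ (Set.Ici (0 : ℝ)))
    (hρ_delay : ∀ u : ℝ, 1 < u → HasDerivAt ρ (-ρ (u - 1) / u) u) {a : ℝ} (ha : 1 ≤ a)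
    (h : ∀ w, 0 ≤ w → w ≤ a → ∀ ε > 0, LowerAt (ρ w - ε) w ∧ UpperAt (ρ w + ε) w)
    {v : ℝ} (hav : a ≤ v) (hva : v ≤ a + 1) {η : ℝ} (hη : 0 < η) :
    LowerAt (ρ v - η) v ∧ UpperAt (ρ v + η) v := by
  have hcont : ContinuousOn ρ (Set.Icc 0 (a + 1)) := hρ_cont.mono fun w hw => hw.1
  obtain ⟨R, hR⟩ := isCompact_Icc.exists_bound_of_continuousOn hcont
  have hR0 : 0 ≤ R := (norm_nonneg _).trans (hR 0 ⟨le_rfl, by linarith⟩)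
  set ε := min 1 (η / (4 + 2 * R)) with hεdef
  have hε : 0 < ε := by positivity
  have hεη : ε * (4 + 2 * R) ≤ η := (le_div_iff₀ (by positivity)).1 (min_le_right _ _)
  obtain ⟨δ₀, hδ₀, hunif⟩ := Metric.uniformContinuousOn_iff.1
    (isCompact_Icc.uniformContinuousOn_of_continuous hcont) (ε / 2) (by positivity)
  set δ := min (δ₀ / 2) ε
  have hδ : 0 < δ := by positivity
  have hδε : δ ≤ ε := min_le_right _ _
  have hδδ : δ < δ₀ := (min_le_left _ _).trans_lt (by linarith)
  have key : ∀ k : ℕ, ∀ v, a ≤ v → v ≤ a + 1 → v ≤ a + k * δ →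
      ∀ᶠ x in atTop, |smoothRatio v x - ρ v| ≤ ε + ε * (3 + 2 * R) * (v - a) := by
    intro k
    induction k with
    | zero =>
      intro v hav _ hvk
      have hva : v = a := le_antisymm (by simpa using hvk) hav
      subst hva
      have h1 := tendsto_smoothRatio (by linarith) (h v (by linarith) le_rfl)
      filter_upwards [(Metric.tendsto_nhds.1 h1) ε hε] with x hx
      rw [Real.dist_eq] at hx
      linarith
    | succ k ih =>
      intro v hav hva hvk
      by_cases hvk' : v ≤ a + k * δ
      · exact ih v hav hva hvk'
      set u := a + k * δ with hu
      have huv : u < v := not_le.1 hvk'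
      have hau : a ≤ u := by rw [hu]; linarith [mul_nonneg (Nat.cast_nonneg (α := ℝ) k) hδ.le]
      have hvu : v - u ≤ δ := by push_cast at hvk; rw [hu]; linarith
      obtain ⟨ξ, ⟨hξu, hξv⟩, hξ⟩ := exists_hasDerivAt_eq_slope ρ (fun u => -ρ (u - 1) / u) huv
        (hρ_cont.mono fun w hw => by simp only [Set.mem_Ici]; linarith [hw.1])
        (fun w hw => hρ_delay w (by linarith [hw.1]))
      have hξ0 : 0 < ξ := by linarith
      have hslope : ρ u - ρ v = ρ (ξ - 1) * ((v - u) / ξ) := by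
        have : v - u ≠ 0 := by linarith
        field_simp at hξ ⊢
        linarith
      have hosc : ∀ w, u - 1 ≤ w → w ≤ v - 1 → |ρ w - ρ (ξ - 1)| < ε / 2 := by
        intro w hw1 hw2
        refine hunif w ⟨by linarith, by linarith⟩ (ξ - 1) ⟨by linarith, by linarith⟩ ?_
        rw [Real.dist_eq, abs_lt]
        constructor <;> linarith
      have hlow : LowerAt (ρ (ξ - 1) - ε) (v - 1) :=
        (h (v - 1) (by linarith) (by linarith) (ε / 2) (by positivity)).1.mono (by
          linarith [(abs_lt.1 (hosc (v - 1) (by linarith) le_rfl)).1])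
      have hup : UpperAt (ρ (ξ - 1) + ε) (u - 1) :=
        (h (u - 1) (by linarith) (by linarith) (ε / 2) (by positivity)).2.mono (by
          linarith [(abs_lt.1 (hosc (u - 1) le_rfl (by linarith))).2])
      have hr : |ρ (ξ - 1)| ≤ R := hR (ξ - 1) ⟨by linarith, by linarith⟩
      filter_upwards [ih u hau (by linarith) le_rfl,
        eventually_abs_smoothRatio_sub_le (by linarith) huv hξu.le hξv.le hε (min_le_left _ _)
          (hvu.trans hδε) hlow hup] with x hx1 hx2
      have h3 : ε * (3 + 2 * |ρ (ξ - 1)|) * (v - u) ≤ ε * (3 + 2 * R) * (v - u) := by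
        have : 0 ≤ v - u := by linarith
        gcongr
      rw [← hslope] at hx2
      rw [abs_le] at hx1 hx2 ⊢
      constructor <;> linarith [hx1.1, hx1.2, hx2.1, hx2.2]
  obtain ⟨k, hk⟩ := exists_nat_ge (1 / δ)
  rw [div_le_iff₀ hδ] at hk
  have hev : ∀ᶠ x in atTop, |smoothRatio v x - ρ v| ≤ η := by
    filter_upwards [key k v hav hva (by linarith)] with x hx
    have h1 : ε * (3 + 2 * R) * (v - a) ≤ ε * (3 + 2 * R) :=
      mul_le_of_le_one_right (by positivity) (by linarith)
    linarith
  exact ⟨lowerAt_of_eventually (by linarith) (hev.mono fun x hx => by linarith [(abs_le.1 hx).1]),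
    upperAt_of_eventually (by linarith) (hev.mono fun x hx => by linarith [(abs_le.1 hx).2])⟩

lemma lowerAt_and_upperAt {ρ : ℝ → ℝ} (hρ_cont : ContinuousOn ρ (Set.Ici (0 : ℝ)))
    (hρ_init : ∀ u : ℝ, 0 ≤ u → u ≤ 1 → ρ u = 1)
    (hρ_delay : ∀ u : ℝ, 1 < u → HasDerivAt ρ (-ρ (u - 1) / u) u) (n : ℕ) :
    ∀ w, 0 ≤ w → w ≤ (n : ℝ) + 1 → ∀ ε > 0, LowerAt (ρ w - ε) w ∧ UpperAt (ρ w + ε) w := by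
  induction n with
  | zero =>
    intro w hw0 hw1 ε hε
    have hw1 : w ≤ 1 := by simpa using hw1
    rw [hρ_init w hw0 hw1]
    exact ⟨lowerAt_of_le_one hw1 hε, upperAt_of_one_le (by linarith)⟩
  | succ n ih =>
    intro w hw0 hw1 ε hε
    rcases le_total w ((n : ℝ) + 1) with hw | hw
    · exact ih w hw0 hw ε hε
    · refine lowerAt_and_upperAt_succ hρ_cont hρ_delay ?_ ih hw ?_ hε
      · linarith [Nat.cast_nonneg (α := ℝ) n]
      · push_cast at hw1; exact hw1

end Dickman

/-- (Dickman) For every real `x > 0`, the proportion of `n^(1/x)`-smooth integers up to `n`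
converges to `ρ(x)`, where `ρ` is the Dickman function. -/
theorem dickman_limit
    (ρ : ℝ → ℝ)
    (hρ_cont : ContinuousOn ρ (Set.Ici (0 : ℝ)))
    (hρ_init : ∀ u : ℝ, 0 ≤ u → u ≤ 1 → ρ u = 1)
    (hρ_delay : ∀ u : ℝ, 1 < u → HasDerivAt ρ (-ρ (u - 1) / u) u)
    (x : ℝ) (hx : 0 < x) :
    Tendsto (fun n : ℕ => (PsiR n ((n : ℝ) ^ (1 / x)) : ℝ) / n) atTop (𝓝 (ρ x)) := by
  obtain ⟨N, hN⟩ := exists_nat_ge x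
  have h := Dickman.tendsto_smoothRatio hx
    (Dickman.lowerAt_and_upperAt hρ_cont hρ_init hρ_delay N x hx.le (by linarith))
  refine (h.comp tendsto_natCast_atTop_atTop).congr fun n => ?_
  simp [Dickman.smoothRatio]
end

section
/- (Ramaswami) For every fixed real x ≥ 1 there exists a constant C_x > 0 such that for all integers n ≥ 2, |Ψ(n, n^{1/x})/n − ρ(x)| ≤ C_x/log(n). -/
open Real
open scoped Classical

lemma log_factorial_eq_sum_primesLE (n : ℕ) :
    Real.log (n.factorial : ℝ) =
      ∑ p ∈ Nat.primesLE n, (n.factorial.factorization p : ℝ) * Real.log p := by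
  rw [Real.log_nat_eq_sum_factorization, Finsupp.sum]
  refine Finset.sum_subset (fun p hp => ?_) (fun p _ hp => ?_)
  · have hp' : p ∈ n.factorial.primeFactors := by simpa using hp
    rw [Nat.mem_primesLE]
    exact ⟨(Nat.prime_of_mem_primeFactors hp').dvd_factorial.1 (Nat.dvd_of_mem_primeFactors hp'),
      Nat.prime_of_mem_primeFactors hp'⟩
  · simp [Finsupp.notMem_support_iff.1 hp]

lemma exists_sum_log_div_mul_pred_le :
    ∃ B : ℝ, 0 ≤ B ∧ ∀ n : ℕ, ∑ p ∈ Nat.primesLE n, Real.log p / (p * (p - 1)) ≤ B := by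
  have hs : Summable (fun m : ℕ => 4 * (1 / (m : ℝ) ^ (3 / 2 : ℝ))) :=
    (Real.summable_one_div_nat_rpow.2 (by norm_num)).mul_left 4
  refine ⟨∑' m : ℕ, 4 * (1 / (m : ℝ) ^ (3 / 2 : ℝ)), tsum_nonneg fun m => by positivity,
    fun n => le_trans (Finset.sum_le_sum fun p hp => ?_)
      (hs.sum_le_tsum (Nat.primesLE n) fun m _ => by positivity)⟩
  have hp2 : (2 : ℝ) ≤ p := by exact_mod_cast Nat.two_le_of_mem_primesLE hp
  have hp0 : (0 : ℝ) < p := by linarith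
  have hlog : Real.log p ≤ 2 * (p : ℝ) ^ (1 / 2 : ℝ) := by
    have := Real.log_le_rpow_div hp0.le (show (0 : ℝ) < 1 / 2 by norm_num)
    linarith
  have hpow : (p : ℝ) ^ (3 / 2 : ℝ) * (p : ℝ) ^ (1 / 2 : ℝ) = p ^ 2 := by
    rw [← Real.rpow_add hp0]
    norm_num
  have h32 : 0 < (p : ℝ) ^ (3 / 2 : ℝ) := by positivity
  rw [mul_one_div, div_le_div_iff₀ (by nlinarith) h32]
  have := mul_le_mul_of_nonneg_right hlog h32.le
  nlinarith

lemma exists_abs_sum_log_div_sub_log_le :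
    ∃ A : ℝ, 0 < A ∧ ∀ x : ℝ, 1 ≤ x →
      |∑ p ∈ Nat.primesLE ⌊x⌋₊, Real.log p / p - Real.log x| ≤ A := by
  obtain ⟨B, hB0, hB⟩ := exists_sum_log_div_mul_pred_le
  refine ⟨Real.log 4 + 1 + B, by positivity, fun x hx => ?_⟩
  set n := ⌊x⌋₊ with hn
  have hn1 : 1 ≤ n := Nat.one_le_floor_iff x |>.2 hx
  have hnR : (1 : ℝ) ≤ n := by exact_mod_cast hn1
  have hn0 : (0 : ℝ) < n := by linarith
  have hnx : (n : ℝ) ≤ x := Nat.floor_le (by linarith)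
  have hxn : x ≤ 2 * n := by have := Nat.lt_floor_add_one x; rw [← hn] at this; linarith
  have hl1 : Real.log n ≤ Real.log x := Real.log_le_log hn0 hnx
  have hl2 : Real.log x ≤ Real.log 2 + Real.log n := by
    rw [← Real.log_mul (by norm_num) hn0.ne']
    exact Real.log_le_log (by linarith) hxn
  have h24 : Real.log 2 ≤ Real.log 4 := Real.log_le_log (by norm_num) (by norm_num)
  have hup : n * ∑ p ∈ Nat.primesLE n, Real.log p / p ≤ n * (Real.log n + Real.log 4) := by
    have h1 : (n : ℝ) * ∑ p ∈ Nat.primesLE n, Real.log p / p ≤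
        Real.log (n.factorial : ℝ) + Chebyshev.theta n := by
      rw [Chebyshev.theta_eq_sum_primesLE_log, log_factorial_eq_sum_primesLE,
        ← Finset.sum_add_distrib, Finset.mul_sum]
      refine Finset.sum_le_sum fun p hp => ?_
      have hpp := Nat.prime_of_mem_primesLE hp
      have hlogp : 0 ≤ Real.log p := Real.log_natCast_nonneg p
      have hv : n / p ≤ n.factorial.factorization p := by
        rw [Nat.factorization_factorial hpp
          (show Nat.log p n < Nat.log p n + 2 by omega)]
        have := Finset.single_le_sum (f := fun i => n / p ^ i) (fun _ _ => Nat.zero_le _)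
          (show 1 ∈ Finset.Ico 1 (Nat.log p n + 2) by simp)
        simpa using this
      have hdiv : (n : ℝ) / p ≤ n.factorial.factorization p + 1 := by
        have h2 : (n : ℝ) / p < (n / p : ℕ) + 1 := by
          rw [← Nat.floor_div_eq_div (K := ℝ)]
          exact Nat.lt_floor_add_one _
        have h3 : ((n / p : ℕ) : ℝ) ≤ n.factorial.factorization p := by exact_mod_cast hv
        linarith
      calc (n : ℝ) * (Real.log p / p) = (n / p) * Real.log p := by ring
        _ ≤ (n.factorial.factorization p + 1) * Real.log p := by gcongr
        _ = _ := by ring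
    have h2 : Real.log (n.factorial : ℝ) ≤ n * Real.log n := by
      rw [← Real.log_pow]
      exact Real.log_le_log (by exact_mod_cast n.factorial_pos)
        (by exact_mod_cast n.factorial_le_pow)
    have h3 := Chebyshev.theta_le_log4_mul_x hn0.le
    linarith
  have hlow : n * (Real.log n - 1) ≤ n * (∑ p ∈ Nat.primesLE n, Real.log p / p + B) := by
    have h1 : Real.log (n.factorial : ℝ) ≤
        n * (∑ p ∈ Nat.primesLE n, Real.log p / p +
          ∑ p ∈ Nat.primesLE n, Real.log p / (p * (p - 1))) := by
      rw [log_factorial_eq_sum_primesLE, ← Finset.sum_add_distrib, Finset.mul_sum]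
      refine Finset.sum_le_sum fun p hp => ?_
      have hpp := Nat.prime_of_mem_primesLE hp
      have hp2 : (2 : ℝ) ≤ p := by exact_mod_cast hpp.two_le
      have hlogp : 0 ≤ Real.log p := Real.log_natCast_nonneg p
      have hv : (n.factorial.factorization p : ℝ) ≤ n / (p - 1) := by
        have h2 : (n.factorial.factorization p : ℝ) ≤ (n / (p - 1) : ℕ) := by
          exact_mod_cast Nat.factorization_factorial_le_div_pred hpp n
        refine h2.trans (Nat.cast_div_le.trans ?_)
        rw [Nat.cast_pred hpp.pos]
      have hp1 : (p : ℝ) - 1 ≠ 0 := by linarith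
      have hp0 : (p : ℝ) ≠ 0 := by linarith
      calc (n.factorial.factorization p : ℝ) * Real.log p ≤ n / (p - 1) * Real.log p := by gcongr
        _ = _ := by field_simp; ring
    have h2 := Stirling.le_log_factorial_stirling (n := n) (by omega)
    have h3 : 0 ≤ Real.log n := Real.log_nonneg hnR
    have h4 : 0 ≤ Real.log (2 * Real.pi) := Real.log_nonneg (by linarith [Real.pi_gt_three])
    have h5 := mul_le_mul_of_nonneg_left (hB n) hn0.le
    linarith
  have hup' := le_of_mul_le_mul_left hup hn0
  have hlow' := le_of_mul_le_mul_left hlow hn0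
  rw [abs_le]
  constructor <;> linarith

lemma integral_inv_div_log_sq_mul_log_add {a b : ℝ} (ha : 2 ≤ a) (hab : a ≤ b) (A : ℝ) :
    IntervalIntegrable (fun t => t⁻¹ / Real.log t ^ 2 * (Real.log t + A)) MeasureTheory.volume a b ∧
    ∫ t in a..b, t⁻¹ / Real.log t ^ 2 * (Real.log t + A) =
      (Real.log (Real.log b) - Real.log (Real.log a)) + A * (1 / Real.log a - 1 / Real.log b) := by
  have hne : ∀ t ∈ Set.uIcc a b, t ≠ 0 ∧ Real.log t ≠ 0 := by
    intro t ht
    rw [Set.uIcc_of_le hab] at ht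
    have : 2 ≤ t := ha.trans ht.1
    exact ⟨by linarith, (Real.log_pos (by linarith)).ne'⟩
  have hint : IntervalIntegrable (fun t => t⁻¹ / Real.log t ^ 2 * (Real.log t + A))
      MeasureTheory.volume a b := by
    refine ContinuousOn.intervalIntegrable ?_
    have hl : ContinuousOn Real.log (Set.uIcc a b) :=
      Real.continuousOn_log.mono fun t ht => (hne t ht).1
    exact ((continuousOn_id.inv₀ fun t ht => (hne t ht).1).div (hl.pow 2)
      fun t ht => pow_ne_zero 2 (hne t ht).2).mul (hl.add continuousOn_const)
  refine ⟨hint, ?_⟩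
  rw [intervalIntegral.integral_eq_sub_of_hasDerivAt
    (f := fun t => Real.log (Real.log t) - A * (Real.log t)⁻¹) (fun t ht => ?_) hint]
  · ring
  · obtain ⟨h0, h1⟩ := hne t ht
    have hd := Real.hasDerivAt_log h0
    convert! (hd.log h1).sub ((hd.inv h1).const_mul A) using 1
    field_simp
    ring

lemma exists_abs_sum_inv_prime_sub_le :
    ∃ A : ℝ, 0 < A ∧ ∀ a b : ℝ, 2 ≤ a → a ≤ b →
      |∑ p ∈ Finset.Ioc ⌊a⌋₊ ⌊b⌋₊ with p.Prime, 1 / (p : ℝ) -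
        (Real.log (Real.log b) - Real.log (Real.log a))| ≤ A / Real.log a := by
  obtain ⟨A, hA, hm⟩ := exists_abs_sum_log_div_sub_log_le
  refine ⟨2 * A, by positivity, fun a b ha hab => ?_⟩
  set c : ℕ → ℝ := fun k => if k.Prime then Real.log k / k else 0 with hc
  set m : ℝ → ℝ := fun t => ∑ k ∈ Finset.Icc 0 ⌊t⌋₊, c k with hmdef
  have hmE : ∀ t, 1 ≤ t → |m t - Real.log t| ≤ A := by
    intro t ht
    have := hm t ht
    rwa [Nat.primesLE_eq_filter_Icc_zero, Finset.sum_filter] at this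
  have hne : ∀ t ∈ Set.Icc a b, t ≠ 0 ∧ 0 < Real.log t := fun t ht =>
    ⟨by linarith [ht.1], Real.log_pos (by linarith [ht.1])⟩
  have hder : ∀ t ∈ Set.Icc a b,
      HasDerivAt (fun s => (Real.log s)⁻¹) (-(t⁻¹ / Real.log t ^ 2)) t := by
    intro t ht
    convert! (Real.hasDerivAt_log (hne t ht).1).inv (hne t ht).2.ne' using 1
    ring
  have hcont : ContinuousOn (fun t => t⁻¹ / Real.log t ^ 2) (Set.Icc a b) :=
    (continuousOn_id.inv₀ fun t ht => (hne t ht).1).div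
      ((Real.continuousOn_log.mono fun t ht => (hne t ht).1).pow 2)
      fun t ht => pow_ne_zero 2 (hne t ht).2.ne'
  have hInt : MeasureTheory.IntegrableOn (fun t => t⁻¹ / Real.log t ^ 2) (Set.Icc a b) :=
    hcont.integrableOn_Icc
  have habel := sum_mul_eq_sub_sub_integral_mul c (f := fun s => (Real.log s)⁻¹)
    (show 0 ≤ a by linarith) hab (fun t ht => (hder t ht).differentiableAt)
    (hInt.neg.congr_fun (fun t ht => (hder t ht).deriv.symm) measurableSet_Icc)
  have hsum : ∑ p ∈ Finset.Ioc ⌊a⌋₊ ⌊b⌋₊ with p.Prime, 1 / (p : ℝ) =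
      ∑ k ∈ Finset.Ioc ⌊a⌋₊ ⌊b⌋₊, (Real.log k)⁻¹ * c k := by
    rw [Finset.sum_filter]
    refine Finset.sum_congr rfl fun k _ => ?_
    by_cases hk : k.Prime
    · have : Real.log k ≠ 0 := (Real.log_pos (by exact_mod_cast hk.one_lt)).ne'
      simp only [hc, hk, if_true]
      field_simp
    · simp [hc, hk]
  have hI : -(∫ t in Set.Ioc a b, deriv (fun s => (Real.log s)⁻¹) t * m t) =
      ∫ t in a..b, t⁻¹ / Real.log t ^ 2 * m t := by
    rw [intervalIntegral.integral_of_le hab, ← MeasureTheory.integral_neg]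
    refine MeasureTheory.setIntegral_congr_fun measurableSet_Ioc fun t ht => ?_
    simp only [(hder t (Set.Ioc_subset_Icc_self ht)).deriv]
    ring
  have hmint : IntervalIntegrable (fun t => t⁻¹ / Real.log t ^ 2 * m t)
      MeasureTheory.volume a b := by
    rw [intervalIntegrable_iff_integrableOn_Icc_of_le hab]
    exact integrableOn_mul_sum_Icc c (by linarith) hInt
  have hpos : ∀ t ∈ Set.Icc a b, 0 ≤ t⁻¹ / Real.log t ^ 2 := fun t ht => by
    have : 0 < t := by linarith [ht.1]
    positivity
  obtain ⟨i1, e1⟩ := integral_inv_div_log_sq_mul_log_add ha hab A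
  obtain ⟨i2, e2⟩ := integral_inv_div_log_sq_mul_log_add ha hab (-A)
  have hup := intervalIntegral.integral_mono_on hab hmint i1 fun t ht =>
    mul_le_mul_of_nonneg_left
      (by have := (abs_le.1 (hmE t (by linarith [ht.1]))).2; linarith) (hpos t ht)
  have hlow := intervalIntegral.integral_mono_on hab i2 hmint fun t ht =>
    mul_le_mul_of_nonneg_left
      (by have := (abs_le.1 (hmE t (by linarith [ht.1]))).1; linarith) (hpos t ht)
  rw [e1] at hup
  rw [e2] at hlow
  have hend : ∀ t, 2 ≤ t → |(Real.log t)⁻¹ * m t - 1| ≤ A * (1 / Real.log t) := by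
    intro t ht
    have hl : 0 < Real.log t := Real.log_pos (by linarith)
    have : (Real.log t)⁻¹ * m t - 1 = (m t - Real.log t) * (1 / Real.log t) := by field_simp
    rw [this, abs_mul, abs_of_pos (show 0 < 1 / Real.log t by positivity)]
    exact mul_le_mul_of_nonneg_right (hmE t (by linarith)) (by positivity)
  have ea := abs_le.1 (hend a ha)
  have eb := abs_le.1 (hend b (ha.trans hab))
  rw [hsum, habel, sub_eq_add_neg _ (∫ t in Set.Ioc a b, _), hI, abs_le,
    show 2 * A / Real.log a = 2 * (A * (1 / Real.log a)) by ring]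
  constructor <;> linarith

lemma exists_card_primes_le :
    ∃ K : ℝ, 0 < K ∧ ∀ (N : ℕ) (x : ℝ), 1 < x →
      (((Finset.Ioc N ⌊x⌋₊).filter Nat.Prime).card : ℝ) ≤ K * x / Real.log x := by
  refine ⟨2 * Real.log 4 + 2, by positivity, fun N x hx => ?_⟩
  have hl : 0 < Real.log x := Real.log_pos hx
  have h1 : ((Finset.Ioc N ⌊x⌋₊).filter Nat.Prime).card ≤ Nat.primeCounting ⌊x⌋₊ := by
    rw [Nat.primeCounting, Nat.primeCounting', Nat.count_eq_card_filter_range]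
    refine Finset.card_le_card fun p hp => ?_
    simp only [Finset.mem_filter, Finset.mem_Ioc, Finset.mem_range] at hp ⊢
    exact ⟨by omega, hp.2⟩
  have h2 : (((Finset.Ioc N ⌊x⌋₊).filter Nat.Prime).card : ℝ) ≤ Nat.primeCounting ⌊x⌋₊ := by
    exact_mod_cast h1
  refine h2.trans ((Chebyshev.pi_le_log4_mul_div hx).trans ?_)
  have hsq : 0 < √x := Real.sqrt_pos.2 (by linarith)
  have hlog : Real.log x ≤ 2 * √x := by
    have := Real.log_le_rpow_div (show 0 ≤ x by linarith) (show (0 : ℝ) < 1 / 2 by norm_num)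
    rw [← Real.sqrt_eq_rpow] at this
    linarith
  have h3 : √x ≤ 2 * x / Real.log x := by
    rw [le_div_iff₀ hl]
    nlinarith [Real.mul_self_sqrt (show 0 ≤ x by linarith)]
  rw [Real.log_sqrt (by linarith)]
  have : (2 * Real.log 4 + 2) * x / Real.log x =
    Real.log 4 * x / (Real.log x / 2) + 2 * x / Real.log x := by field_simp
  linarith

lemma sup_primeFactors_le_iff {m b : ℕ} (hm : m ≠ 0) :
    m.primeFactors.sup id ≤ b ↔ ∀ q : ℕ, q.Prime → q ∣ m → q ≤ b := by
  simp only [Finset.sup_le_iff, Nat.mem_primeFactors, id]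
  exact ⟨fun h q hq hqm => h q ⟨hq, hqm, hm⟩, fun h q hq => h q hq.1 hq.2.1⟩

lemma PsiR_add_sum_PsiR_div (N : ℕ) {y : ℝ} (hy : 0 ≤ y) :
    PsiR N y + ∑ p ∈ Finset.Ioc ⌊y⌋₊ N with p.Prime, PsiR (N / p) p = N := by
  have hmem : ∀ m ≠ 0, ∀ p : ℕ, p.Prime → m.primeFactors.sup id = p → p ∣ m := by
    intro m hm p hp h
    have hne : m.primeFactors.Nonempty := by
      rw [Finset.nonempty_iff_ne_empty]
      intro h0
      rw [h0] at h
      exact hp.ne_zero (by simpa using h.symm)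
    obtain ⟨q, hq, hqs⟩ := Finset.exists_mem_eq_sup _ hne (id : ℕ → ℕ)
    have : q = p := by rw [← h, hqs]; rfl
    exact this ▸ Nat.dvd_of_mem_primeFactors hq
  have hnot : ((Finset.Icc 1 N).filter
      (fun k => ¬ ∀ p : ℕ, p.Prime → p ∣ k → (p : ℝ) ≤ y)).card =
      ∑ p ∈ Finset.Ioc ⌊y⌋₊ N with p.Prime, PsiR (N / p) p := by
    rw [Finset.card_eq_sum_card_fiberwise (f := fun m => m.primeFactors.sup id)
      (t := (Finset.Ioc ⌊y⌋₊ N).filter Nat.Prime)]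
    · refine Finset.sum_congr rfl fun p hp => ?_
      simp only [Finset.mem_filter, Finset.mem_Ioc] at hp
      obtain ⟨⟨hyp, hpN⟩, hpp⟩ := hp
      have hyp' : y < p := (Nat.floor_lt hy).1 hyp
      rw [PsiR]
      refine Eq.trans (congrArg Finset.card ?_)
        (Finset.card_image_of_injective _ (mul_right_injective₀ hpp.ne_zero))
      ext m
      simp only [Finset.mem_filter, Finset.mem_Icc, Finset.mem_image, Nat.cast_le]
      constructor
      · rintro ⟨⟨⟨h1, hN⟩, -⟩, hs⟩
        obtain ⟨k, rfl⟩ := hmem m (by omega) p hpp hs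
        have hk : k ≠ 0 := by rintro rfl; simp at h1
        refine ⟨k, ⟨⟨by omega, ?_⟩, fun q hq hqk => ?_⟩, rfl⟩
        · rw [Nat.le_div_iff_mul_le hpp.pos, mul_comm]
          exact hN
        · exact (sup_primeFactors_le_iff (by omega)).1 hs.le q hq (hqk.mul_left p)
      · rintro ⟨k, ⟨⟨h1, hN⟩, hs⟩, rfl⟩
        have hpk : 0 < p * k := Nat.mul_pos hpp.pos h1
        refine ⟨⟨⟨hpk, ?_⟩, fun h => ?_⟩, le_antisymm ?_ ?_⟩
        · rw [Nat.le_div_iff_mul_le hpp.pos, mul_comm] at hN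
          exact hN
        · exact absurd (h p hpp (dvd_mul_right p k)) (not_le.2 hyp')
        · rw [sup_primeFactors_le_iff hpk.ne']
          intro q hq hqd
          rcases (Nat.Prime.dvd_mul hq).1 hqd with h | h
          · exact ((Nat.prime_dvd_prime_iff_eq hq hpp).1 h).le
          · exact hs q hq h
        · exact Finset.le_sup (f := id)
            (Nat.mem_primeFactors.2 ⟨hpp, dvd_mul_right p k, hpk.ne'⟩)
    · intro m hm
      simp only [Finset.coe_filter, Finset.mem_Icc, Set.mem_ofPred_eq, not_forall, not_le] at hm
      obtain ⟨⟨h1, hN⟩, q, hq, hqm, hyq⟩ := hm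
      have hm0 : m ≠ 0 := by omega
      have hqmem : q ∈ m.primeFactors := Nat.mem_primeFactors.2 ⟨hq, hqm, hm0⟩
      obtain ⟨r, hr, hrs⟩ := Finset.exists_mem_eq_sup _ ⟨q, hqmem⟩ (id : ℕ → ℕ)
      have hqr : q ≤ r := by
        have := Finset.le_sup (f := (id : ℕ → ℕ)) hqmem
        rwa [hrs] at this
      simp only [Finset.coe_filter, Finset.mem_Ioc, Set.mem_ofPred_eq, hrs, id]
      refine ⟨⟨?_, (Nat.le_of_mem_primeFactors hr).trans hN⟩, Nat.prime_of_mem_primeFactors hr⟩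
      exact lt_of_lt_of_le ((Nat.floor_lt hy).2 hyq) hqr
  rw [← hnot, PsiR, Finset.card_filter_add_card_filter_not]
  simp

lemma PsiR_eq_self_of_le {N : ℕ} {y : ℝ} (h : (N : ℝ) ≤ y) : PsiR N y = N := by
  rw [PsiR, Finset.filter_true_of_mem, Nat.card_Icc, Nat.add_sub_cancel]
  intro k hk p _ hpk
  rw [Finset.mem_Icc] at hk
  have : p ≤ N := (Nat.le_of_dvd hk.1 hpk).trans hk.2
  exact le_trans (by exact_mod_cast this) h

lemma PsiR_le (N : ℕ) (y : ℝ) : PsiR N y ≤ N := by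
  have := Finset.card_filter_le (Finset.Icc 1 N)
    (fun k => ∀ p : ℕ, p.Prime → p ∣ k → (p : ℝ) ≤ y)
  simpa [PsiR] using this

/-- The negative of the right derivative of the Dickman function. -/
noncomputable def dickmanKernel (ρ : ℝ → ℝ) : ℝ → ℝ :=
  (Set.Ici 1).indicator fun v => ρ (v - 1) / v

section Dickman

variable {ρ : ℝ → ℝ}

lemma continuousOn_dickman_sub_one_div (hρ_cont : ContinuousOn ρ (Set.Ici (0 : ℝ))) :
    ContinuousOn (fun v => ρ (v - 1) / v) (Set.Ici 1) :=
  (hρ_cont.comp (continuousOn_id.sub continuousOn_const)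
    fun _ hv => sub_nonneg.2 (Set.mem_Ici.1 hv)).div continuousOn_id
    fun _ hv => (zero_lt_one.trans_le (Set.mem_Ici.1 hv)).ne'

lemma hasDerivAt_dickman (hρ_init : ∀ u : ℝ, 0 ≤ u → u ≤ 1 → ρ u = 1)
    (hρ_delay : ∀ u : ℝ, 1 < u → HasDerivAt ρ (-ρ (u - 1) / u) u)
    {v : ℝ} (hv : 0 < v) (hv1 : v ≠ 1) : HasDerivAt ρ (-dickmanKernel ρ v) v := by
  rcases lt_or_gt_of_ne hv1 with h | h
  · have : dickmanKernel ρ v = 0 := Set.indicator_of_notMem (by simpa using h) _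
    rw [this, neg_zero]
    refine (hasDerivAt_const v (1 : ℝ)).congr_of_eventuallyEq ?_
    filter_upwards [Ioo_mem_nhds hv h] with w hw
    exact hρ_init w hw.1.le hw.2.le
  · have : dickmanKernel ρ v = ρ (v - 1) / v :=
      Set.indicator_of_mem (Set.mem_Ici.2 h.le) _
    rw [this, ← neg_div]
    exact hρ_delay v h

lemma intervalIntegrable_dickmanKernel (hρ_cont : ContinuousOn ρ (Set.Ici (0 : ℝ)))
    {U : ℝ} (hU : 0 ≤ U) :
    IntervalIntegrable (dickmanKernel ρ) MeasureTheory.volume 0 U := by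
  rw [intervalIntegrable_iff_integrableOn_Icc_of_le hU, dickmanKernel,
    MeasureTheory.integrableOn_indicator_iff measurableSet_Ici]
  have h : MeasureTheory.IntegrableOn (fun v => ρ (v - 1) / v) (Set.Icc 1 U) :=
    ((continuousOn_dickman_sub_one_div hρ_cont).mono Set.Icc_subset_Ici_self).integrableOn_Icc
  exact h.mono_set fun v hv => ⟨hv.1, hv.2.2⟩

lemma exists_abs_dickmanKernel_le (hρ_cont : ContinuousOn ρ (Set.Ici (0 : ℝ))) (U : ℝ) :
    ∃ B : ℝ, 0 ≤ B ∧ ∀ v ≤ U, |dickmanKernel ρ v| ≤ B := by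
  obtain ⟨B, hB⟩ := isCompact_Icc.exists_bound_of_continuousOn
    ((continuousOn_dickman_sub_one_div hρ_cont).mono fun v (hv : v ∈ Set.Icc 1 U) => hv.1)
  refine ⟨max B 0, le_max_right _ _, fun v hv => ?_⟩
  by_cases h : 1 ≤ v
  · rw [dickmanKernel, Set.indicator_of_mem (Set.mem_Ici.2 h)]
    exact (hB v ⟨h, hv⟩).trans (le_max_left _ _)
  · rw [dickmanKernel, Set.indicator_of_notMem (by simpa using h)]
    simp

lemma integral_dickmanKernel (hρ_cont : ContinuousOn ρ (Set.Ici (0 : ℝ)))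
    (hρ_init : ∀ u : ℝ, 0 ≤ u → u ≤ 1 → ρ u = 1)
    (hρ_delay : ∀ u : ℝ, 1 < u → HasDerivAt ρ (-ρ (u - 1) / u) u)
    {U : ℝ} (hU : 0 ≤ U) :
    ∫ v in (0 : ℝ)..U, dickmanKernel ρ v = 1 - ρ U := by
  have h := MeasureTheory.integral_eq_of_hasDerivAt_off_countable (fun v => -ρ v)
    (dickmanKernel ρ) (a := 0) (b := U) (Set.countable_singleton (1 : ℝ))
    (by
      rw [Set.uIcc_of_le hU]
      exact (hρ_cont.mono Set.Icc_subset_Ici_self).neg)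
    (fun v hv => by
      rw [min_eq_left hU] at hv
      convert! (hasDerivAt_dickman hρ_init hρ_delay hv.1.1 hv.2).neg using 1
      rw [neg_neg])
    (intervalIntegrable_dickmanKernel hρ_cont hU)
  rw [h, hρ_init 0 le_rfl zero_le_one]
  ring

lemma intervalIntegrable_dickmanKernel_mul_log (hρ_cont : ContinuousOn ρ (Set.Ici (0 : ℝ)))
    {U : ℝ} (hU : 0 ≤ U) :
    IntervalIntegrable (fun v => dickmanKernel ρ v * (Real.log (1 + U) - Real.log (1 + v)))
      MeasureTheory.volume 0 U := by
  refine (intervalIntegrable_dickmanKernel hρ_cont hU).mul_continuousOn ?_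
  rw [Set.uIcc_of_le hU]
  exact continuousOn_const.sub ((continuousOn_const.add continuousOn_id).log
    fun v hv => (show (0 : ℝ) < 1 + v by linarith [hv.1]).ne')

lemma integral_dickmanKernel_mul_log (hρ_cont : ContinuousOn ρ (Set.Ici (0 : ℝ)))
    (hρ_init : ∀ u : ℝ, 0 ≤ u → u ≤ 1 → ρ u = 1)
    (hρ_delay : ∀ u : ℝ, 1 < u → HasDerivAt ρ (-ρ (u - 1) / u) u)
    {U : ℝ} (hU : 0 ≤ U) :
    ∫ v in (0 : ℝ)..U, dickmanKernel ρ v * (Real.log (1 + U) - Real.log (1 + v)) =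
      Real.log (1 + U) - (1 - ρ (1 + U)) := by
  have hlog : ContinuousOn (fun v : ℝ => Real.log (1 + v)) (Set.Icc 0 U) :=
    (continuousOn_const.add continuousOn_id).log
      fun v hv => (show (0 : ℝ) < 1 + v by linarith [hv.1]).ne'
  have h := MeasureTheory.integral_eq_of_hasDerivAt_off_countable
    (fun v => ρ (1 + v) - ρ v * (Real.log (1 + U) - Real.log (1 + v)))
    (fun v => dickmanKernel ρ v * (Real.log (1 + U) - Real.log (1 + v)))
    (a := 0) (b := U) (Set.countable_singleton (1 : ℝ))
    (by
      rw [Set.uIcc_of_le hU]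
      refine ContinuousOn.sub (hρ_cont.comp (continuousOn_const.add continuousOn_id)
        fun v hv => ?_) ((hρ_cont.mono Set.Icc_subset_Ici_self).mul (continuousOn_const.sub hlog))
      have := hv.1
      simp only [Set.mem_Ici]
      positivity)
    (fun v hv => by
      rw [min_eq_left hU] at hv
      have hv0 : 0 < v := hv.1.1
      have hv1 : (1 : ℝ) + v ≠ 0 := by positivity
      have hadd : HasDerivAt (fun w : ℝ => 1 + w) 1 v := (hasDerivAt_id v).const_add 1
      have h1 : HasDerivAt (fun w => ρ (1 + w)) (-ρ v / (1 + v)) v := by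
        have h2 := hρ_delay (1 + v) (by linarith)
        rw [add_sub_cancel_left] at h2
        convert! h2.comp v hadd using 1
        rw [mul_one]
      convert! h1.sub ((hasDerivAt_dickman hρ_init hρ_delay hv0 hv.2).mul
        ((hadd.log hv1).const_sub (Real.log (1 + U)))) using 1
      field_simp
      ring)
    (intervalIntegrable_dickmanKernel_mul_log hρ_cont hU)
  rw [h, add_zero, hρ_init 0 le_rfl zero_le_one, hρ_init 1 zero_le_one le_rfl]
  simp
  ring

end Dickman

lemma exists_abs_sum_inv_prime_mul_dickman_sub_le {ρ : ℝ → ℝ}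
    (hρ_cont : ContinuousOn ρ (Set.Ici (0 : ℝ)))
    (hρ_init : ∀ u : ℝ, 0 ≤ u → u ≤ 1 → ρ u = 1)
    (hρ_delay : ∀ u : ℝ, 1 < u → HasDerivAt ρ (-ρ (u - 1) / u) u) {K : ℝ} (hK : 0 ≤ K) :
    ∃ D : ℝ, 0 < D ∧ ∀ y X : ℝ, 2 ≤ y → y ≤ X → Real.log X ≤ (K + 1) * Real.log y →
      |∑ p ∈ Finset.Ioc ⌊y⌋₊ ⌊X⌋₊ with p.Prime,
          1 / (p : ℝ) * ρ (Real.log (X / p) / Real.log p) -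
        (1 - ρ (Real.log X / Real.log y))| ≤ D / Real.log y := by
  obtain ⟨A, hA, hM⟩ := exists_abs_sum_inv_prime_sub_le
  obtain ⟨B, hB0, hB⟩ := exists_abs_dickmanKernel_le hρ_cont K
  refine ⟨A + B * A * K, by positivity, fun y X hy hyX hXK => ?_⟩
  have hL : 0 < Real.log y := Real.log_pos (by linarith)
  have hLX : Real.log y ≤ Real.log X := Real.log_le_log (by linarith) hyX
  have hX0 : 0 < X := by linarith
  set U := Real.log X / Real.log y - 1 with hU
  have hUu : 1 + U = Real.log X / Real.log y := by rw [hU]; ring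
  have hU0 : 0 ≤ U := by rw [hU, sub_nonneg, le_div_iff₀ hL]; linarith
  have hUK : U ≤ K := by rw [hU, sub_le_iff_le_add, div_le_iff₀ hL]; exact hXK
  have hlogu : Real.log (1 + U) = Real.log (Real.log X) - Real.log (Real.log y) := by
    rw [hUu, Real.log_div (by linarith) hL.ne']
  set P := (Finset.Ioc ⌊y⌋₊ ⌊X⌋₊).filter Nat.Prime with hP
  set w : ℕ → ℝ := fun p => Real.log (X / p) / Real.log p with hw
  have hPmem : ∀ p ∈ P, (y < p ∧ (p : ℝ) ≤ X) ∧ p.Prime := by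
    intro p hp
    simp only [hP, Finset.mem_filter, Finset.mem_Ioc] at hp
    exact ⟨⟨(Nat.floor_lt (by linarith)).1 hp.1.1, (Nat.le_floor_iff hX0.le).1 hp.1.2⟩, hp.2⟩
  have hw_le : ∀ p ∈ P, ∀ v : ℝ, v ≤ w p ↔ (1 + v) * Real.log p ≤ Real.log X := by
    intro p hp v
    obtain ⟨⟨h1, h2⟩, -⟩ := hPmem p hp
    have hp0 : (0 : ℝ) < p := by linarith
    have hlp : 0 < Real.log p := Real.log_pos (by linarith)
    rw [hw]
    simp only
    rw [le_div_iff₀ hlp, Real.log_div hX0.ne' hp0.ne']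
    constructor <;> intro h <;> linarith
  have hw0 : ∀ p ∈ P, 0 ≤ w p := by
    intro p hp
    obtain ⟨⟨h1, h2⟩, -⟩ := hPmem p hp
    rw [hw_le p hp, add_zero, one_mul]
    exact Real.log_le_log (by linarith) h2
  have hwU : ∀ p ∈ P, w p ≤ U := by
    intro p hp
    obtain ⟨⟨h1, h2⟩, -⟩ := hPmem p hp
    by_contra! h
    have h3 := (hw_le p hp (w p)).1 le_rfl
    have h4 : Real.log y ≤ Real.log p := Real.log_le_log (by linarith) h1.le
    have h5 : (1 + U) * Real.log y = Real.log X := by rw [hUu]; field_simp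
    nlinarith [mul_le_mul_of_nonneg_left h4 (show 0 ≤ 1 + U by linarith)]
  have hkint : MeasureTheory.IntegrableOn (dickmanKernel ρ) (Set.Ioc 0 U) :=
    (intervalIntegrable_iff_integrableOn_Ioc_of_le hU0).1
      (intervalIntegrable_dickmanKernel hρ_cont hU0)
  set S : ℝ → ℝ := fun v => ∑ p ∈ P, if v ≤ w p then 1 / (p : ℝ) else 0 with hS
  have hterm : ∀ p : ℕ, (fun v => dickmanKernel ρ v * if v ≤ w p then 1 / (p : ℝ) else 0) =
      fun v => 1 / (p : ℝ) * (Set.Iic (w p)).indicator (dickmanKernel ρ) v := by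
    intro p
    ext v
    by_cases h : v ≤ w p
    · rw [if_pos h, Set.indicator_of_mem (Set.mem_Iic.2 h), mul_comm]
    · rw [if_neg h, Set.indicator_of_notMem (by simpa using h), mul_zero, mul_zero]
  have htint : ∀ p ∈ P, MeasureTheory.IntegrableOn
      (fun v => dickmanKernel ρ v * if v ≤ w p then 1 / (p : ℝ) else 0) (Set.Ioc 0 U) := by
    intro p _
    rw [hterm]
    exact (MeasureTheory.Integrable.indicator hkint measurableSet_Iic).const_mul _
  have hSint : MeasureTheory.IntegrableOn (fun v => dickmanKernel ρ v * S v) (Set.Ioc 0 U) := by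
    simp only [hS, Finset.mul_sum]
    exact MeasureTheory.integrable_finsetSum P htint
  have hsum : ∑ p ∈ P, 1 / (p : ℝ) * ρ (w p) =
      ∑ p ∈ P, 1 / (p : ℝ) - ∫ v in Set.Ioc 0 U, dickmanKernel ρ v * S v := by
    simp only [hS, Finset.mul_sum]
    rw [MeasureTheory.integral_finsetSum P htint, ← Finset.sum_sub_distrib]
    refine Finset.sum_congr rfl fun p hp => ?_
    rw [hterm, MeasureTheory.integral_const_mul,
      MeasureTheory.setIntegral_indicator measurableSet_Iic,
      show Set.Ioc 0 U ∩ Set.Iic (w p) = Set.Ioc 0 (w p) by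
        ext v
        simp only [Set.mem_inter_iff, Set.mem_Ioc, Set.mem_Iic]
        exact ⟨fun h => ⟨h.1.1, h.2⟩, fun h => ⟨⟨h.1, h.2.trans (hwU p hp)⟩, h.2⟩⟩,
      ← intervalIntegral.integral_of_le (hw0 p hp),
      integral_dickmanKernel hρ_cont hρ_init hρ_delay (hw0 p hp)]
    ring
  have hSapprox : ∀ v ∈ Set.Ioc 0 U,
      |S v - (Real.log (1 + U) - Real.log (1 + v))| ≤ A / Real.log y := by
    intro v hv
    have hv1 : 0 < 1 + v := by linarith [hv.1]
    have hlb : Real.log y ≤ Real.log X / (1 + v) := by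
      rw [le_div_iff₀ hv1]
      have : (1 + U) * Real.log y = Real.log X := by rw [hUu]; field_simp
      nlinarith [hv.2]
    have hXv : Real.log X / (1 + v) ≤ Real.log X :=
      div_le_self (by linarith) (by linarith [hv.1])
    set b := Real.exp (Real.log X / (1 + v)) with hb
    have hyb : y ≤ b := by rwa [hb, ← Real.log_le_iff_le_exp (by linarith)]
    have hbX : b ≤ X := by rwa [hb, ← Real.le_log_iff_exp_le hX0]
    have hSb : S v = ∑ p ∈ Finset.Ioc ⌊y⌋₊ ⌊b⌋₊ with p.Prime, 1 / (p : ℝ) := by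
      rw [hS]
      simp only
      rw [← Finset.sum_filter]
      congr 1
      ext p
      have hiff : p ∈ P → (v ≤ w p ↔ p ≤ ⌊b⌋₊) := by
        intro hp
        have hp0 : (0 : ℝ) < p := by linarith [(hPmem p hp).1.1]
        rw [hw_le p hp, Nat.le_floor_iff (by linarith), hb, ← Real.log_le_iff_le_exp hp0,
          le_div_iff₀ hv1, mul_comm]
      have hbX' : ⌊b⌋₊ ≤ ⌊X⌋₊ := Nat.floor_le_floor hbX
      constructor
      · intro h
        rw [Finset.mem_filter] at h
        have h2 := (hiff h.1).1 h.2
        simp only [hP, Finset.mem_filter, Finset.mem_Ioc] at h ⊢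
        exact ⟨⟨h.1.1.1, h2⟩, h.1.2⟩
      · intro h
        simp only [Finset.mem_filter, Finset.mem_Ioc] at h
        have hp : p ∈ P := by
          simp only [hP, Finset.mem_filter, Finset.mem_Ioc]
          exact ⟨⟨h.1.1, h.1.2.trans hbX'⟩, h.2⟩
        exact Finset.mem_filter.2 ⟨hp, (hiff hp).2 h.1.2⟩
    have := hM y b hy hyb
    rw [hb, Real.log_exp, Real.log_div (by linarith) hv1.ne', ← hb, ← hSb] at this
    rw [hlogu]
    convert! this using 2
    ring
  have hkl := integral_dickmanKernel_mul_log hρ_cont hρ_init hρ_delay hU0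
  have hklint := (intervalIntegrable_iff_integrableOn_Ioc_of_le hU0).1
    (intervalIntegrable_dickmanKernel_mul_log hρ_cont hU0)
  rw [intervalIntegral.integral_of_le hU0] at hkl
  have hdiff : |(∫ v in Set.Ioc 0 U, dickmanKernel ρ v * S v) -
      (Real.log (1 + U) - (1 - ρ (1 + U)))| ≤ B * A * K / Real.log y := by
    rw [← hkl, ← MeasureTheory.integral_sub hSint hklint]
    have := MeasureTheory.norm_setIntegral_le_of_norm_le_const
      (f := fun v => dickmanKernel ρ v * S v -
        dickmanKernel ρ v * (Real.log (1 + U) - Real.log (1 + v)))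
      (C := B * (A / Real.log y))
      (measure_Ioc_lt_top (μ := MeasureTheory.volume) (a := (0 : ℝ)) (b := U))
      (fun v hv => by
        rw [← mul_sub, Real.norm_eq_abs, abs_mul]
        exact mul_le_mul (hB v (hv.2.trans hUK)) (hSapprox v hv) (abs_nonneg _) hB0)
    rw [Real.norm_eq_abs, Real.volume_real_Ioc_of_le hU0, sub_zero] at this
    refine this.trans ?_
    calc B * (A / Real.log y) * U ≤ B * (A / Real.log y) * K := by gcongr
      _ = _ := by ring
  have hS0 := hM y X hy hyX
  rw [← hlogu, ← hP] at hS0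
  rw [hsum, ← hUu, add_div]
  rw [abs_le] at *
  constructor <;> linarith [hS0.1, hS0.2, hdiff.1, hdiff.2]

lemma exists_abs_PsiR_sub_mul_dickman_le {ρ : ℝ → ℝ}
    (hρ_cont : ContinuousOn ρ (Set.Ici (0 : ℝ)))
    (hρ_init : ∀ u : ℝ, 0 ≤ u → u ≤ 1 → ρ u = 1)
    (hρ_delay : ∀ u : ℝ, 1 < u → HasDerivAt ρ (-ρ (u - 1) / u) u) (k : ℕ) :
    ∃ C : ℝ, 0 ≤ C ∧ ∀ y X : ℝ, 2 ≤ y → 1 ≤ X → Real.log X ≤ (k + 1) * Real.log y →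
      |(PsiR ⌊X⌋₊ y : ℝ) - X * ρ (Real.log X / Real.log y)| ≤ C * X / Real.log y + 1 := by
  have hbase : ∀ y X : ℝ, 2 ≤ y → 1 ≤ X → X ≤ y →
      |(PsiR ⌊X⌋₊ y : ℝ) - X * ρ (Real.log X / Real.log y)| ≤ 1 := by
    intro y X hy hX hXy
    have hL : 0 < Real.log y := Real.log_pos (by linarith)
    have hfl := Nat.floor_le (show 0 ≤ X by linarith)
    rw [PsiR_eq_self_of_le (hfl.trans hXy), hρ_init _ (div_nonneg (Real.log_nonneg hX) hL.le)
      ((div_le_one hL).2 (Real.log_le_log (by linarith) hXy)), mul_one, abs_le]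
    constructor <;> linarith [Nat.lt_floor_add_one X]
  induction k with
  | zero =>
    refine ⟨0, le_rfl, fun y X hy hX hXy => ?_⟩
    have : X ≤ y := (Real.log_le_log_iff (by linarith) (by linarith)).1 (by simpa using hXy)
    simpa using hbase y X hy hX this
  | succ k ih =>
    obtain ⟨C, hC, ih⟩ := ih
    obtain ⟨A, hA, hM⟩ := exists_abs_sum_inv_prime_sub_le
    obtain ⟨K, hK, hπ⟩ := exists_card_primes_le
    obtain ⟨D, hD, hmain⟩ := exists_abs_sum_inv_prime_mul_dickman_sub_le hρ_cont hρ_init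
      hρ_delay (K := (k + 1 : ℕ)) (by positivity)
    have hl2 : 0 < Real.log 2 := Real.log_pos (by norm_num)
    refine ⟨C * (k + 1 + A / Real.log 2) + K + D, by positivity, fun y X hy hX hXy => ?_⟩
    have hL : 0 < Real.log y := Real.log_pos (by linarith)
    have hX0 : 0 < X := by linarith
    rcases le_or_gt X y with hle | hlt
    · refine (hbase y X hy hX hle).trans ?_
      have : 0 ≤ (C * (k + 1 + A / Real.log 2) + K + D) * X / Real.log y := by positivity
      linarith
    have hLX : Real.log y ≤ Real.log X := Real.log_le_log (by linarith) hlt.le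
    set P := (Finset.Ioc ⌊y⌋₊ ⌊X⌋₊).filter Nat.Prime with hP
    have hPmem : ∀ p ∈ P, (y < p ∧ (p : ℝ) ≤ X) ∧ p.Prime := by
      intro p hp
      simp only [hP, Finset.mem_filter, Finset.mem_Ioc] at hp
      exact ⟨⟨(Nat.floor_lt (by linarith)).1 hp.1.1, (Nat.le_floor_iff hX0.le).1 hp.1.2⟩, hp.2⟩
    have hbuch : (PsiR ⌊X⌋₊ y : ℝ) + ∑ p ∈ P, (PsiR ⌊X / p⌋₊ p : ℝ) = ⌊X⌋₊ := by
      simp only [Nat.floor_div_natCast]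
      exact_mod_cast PsiR_add_sum_PsiR_div ⌊X⌋₊ (show 0 ≤ y by linarith)
    have hstep : ∀ p ∈ P,
        |(PsiR ⌊X / p⌋₊ p : ℝ) - X / p * ρ (Real.log (X / p) / Real.log p)| ≤
          C * X / Real.log y * (1 / p) + 1 := by
      intro p hp
      obtain ⟨⟨h1, h2⟩, -⟩ := hPmem p hp
      have hp0 : (0 : ℝ) < p := by linarith
      have hlp : Real.log y ≤ Real.log p := Real.log_le_log (by linarith) h1.le
      refine (ih p (X / p) (by linarith) ((one_le_div hp0).2 h2) ?_).trans ?_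
      · rw [Real.log_div hX0.ne' hp0.ne']
        push_cast at hXy
        have : ((k : ℝ) + 1 + 1) * Real.log y ≤ (k + 1 + 1) * Real.log p := by gcongr
        linarith
      · have : C * (X / p) / Real.log p ≤ C * (X / p) / Real.log y := by gcongr
        calc C * (X / p) / Real.log p + 1 ≤ C * (X / p) / Real.log y + 1 := by linarith
          _ = _ := by ring
    have hsum : |∑ p ∈ P, (PsiR ⌊X / p⌋₊ p : ℝ) -
        X * ∑ p ∈ P, 1 / (p : ℝ) * ρ (Real.log (X / p) / Real.log p)| ≤
        C * X / Real.log y * ∑ p ∈ P, 1 / (p : ℝ) + P.card := by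
      rw [Finset.mul_sum, ← Finset.sum_sub_distrib]
      refine (Finset.abs_sum_le_sum_abs _ _).trans ?_
      rw [Finset.mul_sum, Finset.cast_card, ← Finset.sum_add_distrib]
      refine Finset.sum_le_sum fun p hp => ?_
      convert! hstep p hp using 2
      ring
    have hinv : ∑ p ∈ P, 1 / (p : ℝ) ≤ k + 1 + A / Real.log 2 := by
      have h1 := (abs_le.1 (hM y X hy hlt.le)).2
      have h2 : Real.log (Real.log X) - Real.log (Real.log y) ≤ k + 1 := by
        rw [← Real.log_div (by linarith) hL.ne']
        have h3 : Real.log X / Real.log y ≤ k + 1 + 1 := by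
          rw [div_le_iff₀ hL]
          exact_mod_cast hXy
        have h4 := Real.log_le_sub_one_of_pos
          (show 0 < Real.log X / Real.log y from div_pos (by linarith) hL)
        linarith
      have h3 : A / Real.log y ≤ A / Real.log 2 :=
        div_le_div_of_nonneg_left hA.le hl2 (Real.log_le_log (by norm_num) hy)
      rw [← hP] at h1
      linarith
    have hcard : (P.card : ℝ) ≤ K * X / Real.log y :=
      (hπ ⌊y⌋₊ X (by linarith)).trans (by gcongr)
    have hinv' := mul_le_mul_of_nonneg_left hinv
      (show 0 ≤ C * X / Real.log y by positivity)
    have hm := hmain y X hy hlt.le hXy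
    rw [← hP] at hm
    set T := ∑ p ∈ P, 1 / (p : ℝ) * ρ (Real.log (X / p) / Real.log p)
    have hmX : |X * T - X * (1 - ρ (Real.log X / Real.log y))| ≤ X * (D / Real.log y) := by
      rw [← mul_sub, abs_mul, abs_of_pos hX0]
      gcongr
    have hfl := Nat.floor_le hX0.le
    have hfl' := Nat.lt_floor_add_one X
    have htot : (C * (k + 1 + A / Real.log 2) + K + D) * X / Real.log y =
      C * X / Real.log y * (k + 1 + A / Real.log 2) + K * X / Real.log y +
        X * (D / Real.log y) := by ring
    rw [htot]
    rw [abs_le] at hsum hmX ⊢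
    constructor <;> linarith [hsum.1, hsum.2, hmX.1, hmX.2]

/-- (Ramaswami) For every fixed real `x ≥ 1` there exists `C_x > 0` such that for all integers
`n ≥ 2`, `|Ψ(n, n^(1/x))/n − ρ(x)| ≤ C_x/log n`, where `ρ` is the Dickman function. -/
theorem ramaswami_rate
    (ρ : ℝ → ℝ)
    (hρ_cont : ContinuousOn ρ (Set.Ici (0 : ℝ)))
    (hρ_init : ∀ u : ℝ, 0 ≤ u → u ≤ 1 → ρ u = 1)
    (hρ_delay : ∀ u : ℝ, 1 < u → HasDerivAt ρ (-ρ (u - 1) / u) u)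
    (x : ℝ) (hx : 1 ≤ x) :
    ∃ C : ℝ, 0 < C ∧ ∀ n : ℕ, 2 ≤ n →
      |(PsiR n ((n : ℝ) ^ (1 / x)) : ℝ) / n - ρ x| ≤ C / Real.log n := by
  obtain ⟨C, hC, h⟩ := exists_abs_PsiR_sub_mul_dickman_le hρ_cont hρ_init hρ_delay ⌈x⌉₊
  have hx0 : 0 < x := by linarith
  have hl2 : 0 < Real.log 2 := Real.log_pos (by norm_num)
  refine ⟨(C * x + 1) + (1 + |ρ x|) * (x * Real.log 2), by positivity, fun n hn => ?_⟩
  have hn2 : (2 : ℝ) ≤ n := by exact_mod_cast hn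
  have hn0 : (0 : ℝ) < n := by linarith
  have hln : 0 < Real.log n := Real.log_pos (by linarith)
  set y := (n : ℝ) ^ (1 / x) with hy
  have hy0 : 0 < y := Real.rpow_pos_of_pos hn0 _
  have hlogy : Real.log y = Real.log n / x := by rw [hy, Real.log_rpow hn0]; ring
  rw [add_div]
  rcases le_or_gt 2 y with h2 | h2
  · have hxk := Nat.le_ceil x
    have hb := h y n h2 (by linarith) (by
      rw [hlogy, mul_div_assoc', le_div_iff₀ hx0, mul_comm]
      gcongr
      linarith)
    have hdiv : Real.log n / Real.log y = x := by rw [hlogy]; field_simp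
    rw [Nat.floor_natCast, hdiv] at hb
    have heq : (PsiR n y : ℝ) / n - ρ x = ((PsiR n y : ℝ) - n * ρ x) / n := by field_simp
    have h1 : 1 / (n : ℝ) ≤ 1 / Real.log n :=
      one_div_le_one_div_of_le hln (by linarith [Real.log_le_sub_one_of_pos hn0])
    have h3 : 0 ≤ (1 + |ρ x|) * (x * Real.log 2) / Real.log n := by positivity
    rw [heq, abs_div, abs_of_pos hn0]
    calc |(PsiR n y : ℝ) - n * ρ x| / n ≤ (C * n / Real.log y + 1) / n := by gcongr
      _ = C * x / Real.log n + 1 / n := by rw [hlogy]; field_simp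
      _ ≤ C * x / Real.log n + 1 / Real.log n := by linarith
      _ = (C * x + 1) / Real.log n := by ring
      _ ≤ _ := by linarith
  · have hlog : Real.log n ≤ x * Real.log 2 := by
      have := Real.log_le_log hy0 h2.le
      rw [hlogy, div_le_iff₀ hx0] at this
      linarith
    have h1 : |(PsiR n y : ℝ) / n| ≤ 1 := by
      rw [abs_of_nonneg (by positivity), div_le_one hn0]
      exact_mod_cast PsiR_le n y
    have h3 : 1 + |ρ x| ≤ (1 + |ρ x|) * (x * Real.log 2) / Real.log n := by
      rw [le_div_iff₀ hln]
      gcongr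
    have h4 : 0 ≤ (C * x + 1) / Real.log n := by positivity
    linarith [abs_sub ((PsiR n y : ℝ) / n) (ρ x)]
end

section
/- If D is a random variable following the Dickman law, then for every bounded continuous function f : ℝ → ℝ, E[D·f(D)] = ∫₀¹ E[f(D + t)] dt. -/
open Real MeasureTheory ProbabilityTheory

/-- Integrated form of the delay equation `u ρ'(u) = -ρ(u - 1)` on `[1, ∞)`. -/
lemma dickman_mul_self_eq_integral {ρ : ℝ → ℝ}
    (hρ_cont : ContinuousOn ρ (Set.Ici (0 : ℝ)))
    (hρ_init : ∀ u : ℝ, 0 ≤ u → u ≤ 1 → ρ u = 1)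
    (hρ_delay : ∀ u : ℝ, 1 < u → HasDerivAt ρ (-ρ (u - 1) / u) u)
    {x : ℝ} (hx : 1 ≤ x) : x * ρ x = ∫ y in (x - 1)..x, ρ y := by
  have hp : Continuous fun y : ℝ => ρ (max 0 y) :=
    hρ_cont.comp_continuous (by fun_prop) fun y => le_max_left 0 y
  have hint : ∀ a b : ℝ, IntervalIntegrable (fun y => ρ (max 0 y)) volume a b :=
    fun a b => hp.intervalIntegrable a b
  have hderiv : ∀ u : ℝ,
      HasDerivAt (fun u => ∫ y in (0 : ℝ)..u, ρ (max 0 y)) (ρ (max 0 u)) u := fun u =>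
    intervalIntegral.integral_hasDerivAt_right (hint 0 u)
      hp.stronglyMeasurable.stronglyMeasurableAtFilter hp.continuousAt
  have hcont : Continuous fun u => ∫ y in (0 : ℝ)..u, ρ (max 0 y) :=
    continuous_iff_continuousAt.2 fun u => (hderiv u).continuousAt
  let h : ℝ → ℝ := fun u =>
    u * ρ u - (∫ y in (0 : ℝ)..u, ρ (max 0 y)) + ∫ y in (0 : ℝ)..(u - 1), ρ (max 0 y)
  have h_one : h 1 = 0 := by
    have : ∫ y in (0 : ℝ)..1, ρ (max 0 y) = ∫ y in (0 : ℝ)..1, (1 : ℝ) := by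
      refine intervalIntegral.integral_congr fun y hy => ?_
      rw [Set.uIcc_of_le zero_le_one] at hy
      simp only [max_eq_right hy.1]
      exact hρ_init y hy.1 hy.2
    simp [h, this, hρ_init 1 zero_le_one le_rfl]
  have h_zero : h x = 0 := by
    rcases hx.eq_or_lt with rfl | hx1
    · exact h_one
    have hhc : ContinuousOn h (Set.Icc 1 x) := by
      have h1 : ContinuousOn ρ (Set.Icc 1 x) :=
        hρ_cont.mono fun y hy => zero_le_one.trans hy.1
      have h2 : Continuous fun u => ∫ y in (0 : ℝ)..(u - 1), ρ (max 0 y) :=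
        hcont.comp (continuous_id.sub continuous_const)
      exact ((continuousOn_id.mul h1).sub hcont.continuousOn).add h2.continuousOn
    have hhd : ∀ u ∈ Set.Ioo 1 x, HasDerivAt h 0 u := by
      intro u hu
      have hu0 : (0 : ℝ) < u := zero_lt_one.trans hu.1
      have key := (((hasDerivAt_id u).mul (hρ_delay u hu.1)).sub (hderiv u)).add
        ((hderiv (u - 1)).comp_sub_const u 1)
      refine key.congr_deriv ?_
      rw [max_eq_right hu0.le, max_eq_right (sub_nonneg.2 hu.1.le)]
      simp only [id]
      field_simp
      ring
    obtain ⟨c, -, hc⟩ := exists_hasDerivAt_eq_slope h (fun _ => 0) hx1 hhc hhd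
    have := (div_eq_zero_iff.1 hc.symm).resolve_right (sub_pos.2 hx1).ne'
    linarith
  have hsub := intervalIntegral.integral_interval_sub_left (hint 0 x) (hint 0 (x - 1))
  have hcongr : ∫ y in (x - 1)..x, ρ (max 0 y) = ∫ y in (x - 1)..x, ρ y := by
    refine intervalIntegral.integral_congr fun y hy => ?_
    rw [Set.uIcc_of_le (by linarith)] at hy
    simp only [max_eq_right (show (0 : ℝ) ≤ y by linarith [hy.1])]
  simp only [h] at h_zero
  linarith

lemma dickman_pos {ρ : ℝ → ℝ}
    (hρ_cont : ContinuousOn ρ (Set.Ici (0 : ℝ)))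
    (hρ_init : ∀ u : ℝ, 0 ≤ u → u ≤ 1 → ρ u = 1)
    (hρ_delay : ∀ u : ℝ, 1 < u → HasDerivAt ρ (-ρ (u - 1) / u) u)
    {x : ℝ} (hx : 0 ≤ x) : 0 < ρ x := by
  by_contra! hneg
  let S : Set ℝ := Set.Ici 0 ∩ ρ ⁻¹' Set.Iic 0
  have hS : IsClosed S := hρ_cont.preimage_isClosed_of_isClosed isClosed_Ici isClosed_Iic
  have hbdd : BddBelow S := ⟨0, fun y hy => hy.1⟩
  have hmem : sInf S ∈ S := hS.csInf_mem ⟨x, hx, hneg⟩ hbdd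
  set s := sInf S with hs
  have hs0 : 0 ≤ s := hmem.1
  have hρs : ρ s ≤ 0 := hmem.2
  have hs1 : 1 < s := by
    by_contra! hle
    linarith [hρ_init s hs0 hle]
  have hpos : ∀ y ∈ Set.Ioo (s - 1) s, 0 < ρ y := by
    intro y hy
    by_contra! hle
    exact absurd (csInf_le hbdd (show y ∈ S from ⟨show (0 : ℝ) ≤ y by linarith [hy.1], hle⟩))
      (not_le.2 hy.2)
  have hint : IntervalIntegrable ρ volume (s - 1) s := by
    refine (hρ_cont.mono fun y hy => ?_).intervalIntegrable
    rw [Set.uIcc_of_le (by linarith)] at hy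
    exact show (0 : ℝ) ≤ y by linarith [hy.1]
  have := intervalIntegral.intervalIntegral_pos_of_pos_on hint hpos (by linarith)
  rw [← dickman_mul_self_eq_integral hρ_cont hρ_init hρ_delay hs1.le] at this
  nlinarith

/-- Extending `ρ` by zero to the negative half-line, `x ρ(x) = ∫₀¹ ρ(x - t) dt` for all real `x`. -/
lemma dickman_mul_self_eq_integral_indicator {ρ : ℝ → ℝ}
    (hρ_cont : ContinuousOn ρ (Set.Ici (0 : ℝ)))
    (hρ_init : ∀ u : ℝ, 0 ≤ u → u ≤ 1 → ρ u = 1)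
    (hρ_delay : ∀ u : ℝ, 1 < u → HasDerivAt ρ (-ρ (u - 1) / u) u) (x : ℝ) :
    ∫ t in (0 : ℝ)..1, (Set.Ici 0).indicator ρ (x - t) = x * (Set.Ici 0).indicator ρ x := by
  rw [intervalIntegral.integral_comp_sub_left (fun y => (Set.Ici 0).indicator ρ y) x, sub_zero]
  rcases lt_or_ge x 0 with hx | hx
  · rw [Set.indicator_of_notMem (by simpa using hx), mul_zero,
      intervalIntegral.integral_of_le (by linarith)]
    refine setIntegral_eq_zero_of_forall_eq_zero fun y hy => Set.indicator_of_notMem ?_ _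
    simpa using hy.2.trans_lt hx
  rw [Set.indicator_of_mem (Set.mem_Ici.2 hx)]
  rcases le_total 1 x with hx1 | hx1
  · rw [dickman_mul_self_eq_integral hρ_cont hρ_init hρ_delay hx1]
    refine intervalIntegral.integral_congr fun y hy => Set.indicator_of_mem ?_ _
    rw [Set.uIcc_of_le (by linarith)] at hy
    exact show (0 : ℝ) ≤ y by linarith [hy.1]
  · rw [hρ_init x hx hx1, mul_one, intervalIntegral.integral_of_le (by linarith),
      setIntegral_indicator measurableSet_Ici]
    have hset : (Set.Ioc (x - 1) x ∩ Set.Ici 0 : Set ℝ) =ᵐ[volume] (Set.Icc 0 x : Set ℝ) := by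
      have hsub : ∀ᵐ y : ℝ ∂volume, y ≠ 0 := by simp [ae_iff]
      filter_upwards [hsub] with y hy
      refine propext ⟨fun h => ⟨h.2, h.1.2⟩, fun h => ⟨⟨?_, h.2⟩, h.1⟩⟩
      have : 0 < y := lt_of_le_of_ne h.1 hy.symm
      linarith
    rw [setIntegral_congr_set hset, setIntegral_congr_fun measurableSet_Icc
      (fun y hy => hρ_init y hy.1 (hy.2.trans hx1))]
    simp [hx]

/-- If `D` follows the Dickman law, i.e. `D` has density `x ↦ e^{−γ} ρ(x)` on `[0,∞)` where `ρ`
is the Dickman function, then for every bounded continuous `f : ℝ → ℝ`,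
`E[D f(D)] = ∫₀¹ E[f(D + t)] dt`. -/
theorem dickman_bias_transform
    (ρ : ℝ → ℝ)
    (hρ_cont : ContinuousOn ρ (Set.Ici (0 : ℝ)))
    (hρ_init : ∀ u : ℝ, 0 ≤ u → u ≤ 1 → ρ u = 1)
    (hρ_delay : ∀ u : ℝ, 1 < u → HasDerivAt ρ (-ρ (u - 1) / u) u)
    (Ω : Type*) [MeasurableSpace Ω] (μ : Measure Ω) [IsProbabilityMeasure μ]
    (D : Ω → ℝ) (hD : Measurable D)
    (hlaw : Measure.map D μ =
      (volume.restrict (Set.Ici (0 : ℝ))).withDensity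
        (fun x => ENNReal.ofReal (Real.exp (-Real.eulerMascheroniConstant) * ρ x)))
    (f : ℝ → ℝ) (hf_cont : Continuous f) (hf_bdd : ∃ M : ℝ, ∀ x : ℝ, |f x| ≤ M) :
    ∫ ω, D ω * f (D ω) ∂μ = ∫ t in (0 : ℝ)..1, (∫ ω, f (D ω + t) ∂μ) := by
  obtain ⟨M, hM⟩ := hf_bdd
  set c := Real.exp (-Real.eulerMascheroniConstant) with hc
  have hc0 : 0 < c := Real.exp_pos _
  let r : ℝ → ℝ := (Set.Ici 0).indicator ρ
  have hnonneg : ∀ x ∈ Set.Ici (0 : ℝ), 0 ≤ c * ρ x := fun x hx =>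
    mul_nonneg hc0.le (dickman_pos hρ_cont hρ_init hρ_delay hx).le
  have hmeas : AEMeasurable ρ (volume.restrict (Set.Ici (0 : ℝ))) :=
    hρ_cont.aemeasurable measurableSet_Ici
  have hexp : ∀ g : ℝ → ℝ, Continuous g → ∫ ω, g (D ω) ∂μ = c * ∫ x, r x * g x := by
    intro g hg
    rw [← integral_map (φ := D) hD.aemeasurable hg.aestronglyMeasurable, hlaw,
      integral_withDensity_eq_integral_toReal_smul₀ (hmeas.const_mul c).ennreal_ofReal
        (by simp), ← integral_const_mul, ← integral_indicator measurableSet_Ici]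
    congr 1 with x
    by_cases hx : x ∈ Set.Ici (0 : ℝ)
    · simp [r, hx, ENNReal.toReal_ofReal (hnonneg x hx), mul_assoc]
    · simp [r, hx]
  have hr : Integrable r := by
    refine (integrable_indicator_iff measurableSet_Ici).2 ?_
    have hfin : ∫⁻ x in Set.Ici (0 : ℝ), ENNReal.ofReal (c * ρ x) ≠ ⊤ := by
      have := congrArg (fun ν : Measure ℝ => ν Set.univ) hlaw
      simp only [withDensity_apply _ MeasurableSet.univ, Measure.restrict_univ] at this
      rw [← this]
      exact measure_ne_top _ _
    have hcr : IntegrableOn (fun x => c * ρ x) (Set.Ici 0) := by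
      refine (lintegral_ofReal_ne_top_iff_integrable
        (hmeas.const_mul c).aestronglyMeasurable ?_).1 hfin
      exact (ae_restrict_iff' measurableSet_Ici).2 (ae_of_all _ hnonneg)
    exact (integrable_const_mul_iff hc0.ne'.isUnit _).1 hcr
  have hprod : Integrable (fun p : ℝ × ℝ => r (p.1 - p.2) * f p.1)
      (volume.prod (volume.restrict (Set.Ioc (0 : ℝ) 1))) := by
    have h1 := (integrable_const (μ := volume.restrict (Set.Ioc (0 : ℝ) 1)) (1 : ℝ)
      ).convolution_integrand (ContinuousLinearMap.mul ℝ ℝ) hr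
    simp only [ContinuousLinearMap.mul_apply', one_mul] at h1
    exact h1.mul_bdd (c := M) (hf_cont.comp continuous_fst).aestronglyMeasurable (ae_of_all _ fun p => hM p.1)
  rw [hexp (fun x => x * f x) (by fun_prop)]
  have hshift : ∀ t : ℝ, ∫ ω, f (D ω + t) ∂μ = c * ∫ x, r (x - t) * f x := by
    intro t
    rw [hexp (fun x => f (x + t)) (by fun_prop),
      ← integral_sub_right_eq_self (fun x => r x * f (x + t)) t]
    simp
  simp only [hshift]
  rw [intervalIntegral.integral_const_mul, intervalIntegral.integral_of_le zero_le_one,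
    ← integral_integral_swap hprod]
  congr 2 with x
  rw [integral_mul_const, ← intervalIntegral.integral_of_le zero_le_one,
    dickman_mul_self_eq_integral_indicator hρ_cont hρ_init hρ_delay x]
  ring
end

section
/- If D is a random variable following the Dickman law and U is uniformly distributed on (0,1) and independent of D, then U·(D + 1) also follows the Dickman law, i.e., D and U(D+1) have the same distribution. -/
open Real MeasureTheory ProbabilityTheory

/-- A continuous solution of the Dickman delay equation, extended by `1` to the left of `0`,
satisfies `u r(u) = ∫_{u-1}^u r`. -/
lemma dickman_mul_self_eq_integral_s16 {r : ℝ → ℝ} (hc : Continuous r)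
    (h_one : ∀ u ≤ 1, r u = 1) (hd : ∀ u, 1 < u → HasDerivAt r (-r (u - 1) / u) u)
    {u : ℝ} (hu : 1 ≤ u) : u * r u = ∫ t in (u - 1)..u, r t := by
  have hF : ∀ x, HasDerivAt (fun x => ∫ t in (0 : ℝ)..x, r t) (r x) x := fun x =>
    intervalIntegral.integral_hasDerivAt_right (hc.intervalIntegrable _ _)
      hc.stronglyMeasurable.stronglyMeasurableAtFilter hc.continuousAt
  have hFc : Continuous fun x => ∫ t in (0 : ℝ)..x, r t :=
    continuous_iff_continuousAt.2 fun x => (hF x).continuousAt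
  set H : ℝ → ℝ := fun x =>
    x * r x - ((∫ t in (0 : ℝ)..x, r t) - ∫ t in (0 : ℝ)..(x - 1), r t) with hH
  have hHc : Continuous H := by
    have := hFc.comp (continuous_id.sub (continuous_const (y := (1 : ℝ))))
    exact (continuous_id.mul hc).sub (hFc.sub this)
  have hHd : ∀ x, 1 < x → HasDerivAt H 0 x := by
    intro x hx
    have h1 := (hF (x - 1)).comp_sub_const x 1
    have h2 := ((hasDerivAt_id x).mul (hd x hx)).sub ((hF x).sub h1)
    refine h2.congr_deriv ?_
    have : x ≠ 0 := by positivity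
    simp only [id]
    field_simp
    ring
  have h_H1 : H 1 = 0 := by
    have : ∫ t in (0 : ℝ)..1, r t = 1 := by
      rw [intervalIntegral.integral_congr (g := fun _ => (1 : ℝ))]
      · simp
      · intro t ht
        rw [Set.uIcc_of_le zero_le_one] at ht
        exact h_one t ht.2
    simp [hH, this, h_one 1 le_rfl]
  have h_Hu : H u = H 1 := by
    rcases hu.eq_or_lt with rfl | hlt
    · rfl
    obtain ⟨c, hcm, h⟩ := exists_hasDerivAt_eq_slope H (fun _ => 0) hlt hHc.continuousOn
      (fun x hx => hHd x hx.1)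
    rw [eq_div_iff (sub_pos.2 hlt).ne'] at h
    linarith
  rw [h_H1] at h_Hu
  have := intervalIntegral.integral_interval_sub_left (hc.intervalIntegrable (μ := volume) 0 u)
    (hc.intervalIntegrable (μ := volume) 0 (u - 1))
  simp only [hH] at h_Hu
  linarith

lemma dickman_pos_s16 {r : ℝ → ℝ} (hc : Continuous r)
    (h_one : ∀ u ≤ 1, r u = 1) (hd : ∀ u, 1 < u → HasDerivAt r (-r (u - 1) / u) u)
    (u : ℝ) : 0 < r u := by
  by_contra! hu
  set S : Set ℝ := {x | r x ≤ 0}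
  have hS : IsClosed S := isClosed_le hc continuous_const
  have h_lb : ∀ x ∈ S, 1 < x := fun x hx => by
    by_contra! h
    have : r x ≤ 0 := hx
    rw [h_one x h] at this
    linarith
  have h_bdd : BddBelow S := ⟨1, fun x hx => (h_lb x hx).le⟩
  have h_mem : sInf S ∈ S := hS.csInf_mem ⟨u, hu⟩ h_bdd
  have h1 := h_lb _ h_mem
  have h_int := dickman_mul_self_eq_integral_s16 hc h_one hd h1.le
  have h_pos : 0 < ∫ t in (sInf S - 1)..(sInf S), r t :=
    intervalIntegral.intervalIntegral_pos_of_pos_on (hc.intervalIntegrable _ _)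
      (fun x hx => by
        by_contra! h
        exact absurd (csInf_le h_bdd h) (not_le.2 hx.2)) (by linarith)
  have : r (sInf S) ≤ 0 := h_mem
  nlinarith

lemma dickman_antitone {r : ℝ → ℝ} (hc : Continuous r)
    (h_one : ∀ u ≤ 1, r u = 1) (hd : ∀ u, 1 < u → HasDerivAt r (-r (u - 1) / u) u) :
    AntitoneOn r (Set.Ici 1) := by
  refine antitoneOn_of_deriv_nonpos (convex_Ici 1) hc.continuousOn ?_ ?_
  · intro x hx
    rw [interior_Ici] at hx
    exact (hd x hx).differentiableAt.differentiableWithinAt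
  · intro x hx
    rw [interior_Ici] at hx
    rw [(hd x hx).deriv]
    have := dickman_pos_s16 hc h_one hd (x - 1)
    have hx0 : 0 < x := zero_lt_one.trans hx
    rw [neg_div]
    exact neg_nonpos.2 (div_pos this hx0).le

/-- An antitone, positive, integrable function tends to `0` at infinity. -/
lemma AntitoneOn.tendsto_zero_of_integrableOn {r : ℝ → ℝ} {a : ℝ}
    (hr : AntitoneOn r (Set.Ici a)) (h_pos : ∀ u, 0 ≤ r u)
    (h_int : IntegrableOn r (Set.Ici a)) : Filter.Tendsto r Filter.atTop (nhds 0) := by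
  rw [Metric.tendsto_atTop]
  intro ε hε
  obtain ⟨N, hN, hrN⟩ : ∃ N, a ≤ N ∧ r N < ε := by
    by_contra! h
    have h_const : IntegrableOn (fun _ : ℝ => ε) (Set.Ici a) := by
      refine Integrable.mono' h_int aestronglyMeasurable_const ?_
      filter_upwards [ae_restrict_mem measurableSet_Ici] with x hx
      rw [Real.norm_of_nonneg hε.le]
      exact h x hx
    rw [integrableOn_const_iff] at h_const
    simp [hε.ne'] at h_const
  refine ⟨N, fun n hn => ?_⟩
  rw [Real.dist_eq, sub_zero, abs_of_nonneg (h_pos n)]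
  exact (hr hN (hN.trans hn) hn).trans_lt hrN

lemma dickman_lintegral_Ioi {r : ℝ → ℝ} (hc : Continuous r)
    (h_one : ∀ u ≤ 1, r u = 1) (hd : ∀ u, 1 < u → HasDerivAt r (-r (u - 1) / u) u)
    (h_int : IntegrableOn r (Set.Ici 0)) {a : ℝ} (ha : 0 ≤ a) :
    ∫⁻ d in Set.Ioi a, ENNReal.ofReal (r d * (d + 1)⁻¹) = ENNReal.ofReal (r (a + 1)) := by
  have h_pos := dickman_pos_s16 hc h_one hd
  have h_lim := (dickman_antitone hc h_one hd).tendsto_zero_of_integrableOn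
    (fun u => (h_pos u).le) (h_int.mono_set (Set.Ici_subset_Ici.2 zero_le_one))
  have h_lim' : Filter.Tendsto (fun d => - r (d + 1)) Filter.atTop (nhds 0) := by
    simpa using (h_lim.comp (Filter.tendsto_atTop_add_const_right _ 1 Filter.tendsto_id)).neg
  have h_der : ∀ d ∈ Set.Ioi a, HasDerivAt (fun d => - r (d + 1)) (r d * (d + 1)⁻¹) d := by
    intro d hda
    have hda : a < d := hda
    refine ((hd (d + 1) (by linarith)).comp_add_const d 1).neg.congr_deriv ?_
    rw [add_sub_cancel_right, neg_div, neg_neg, div_eq_mul_inv]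
  have h_cont : ContinuousWithinAt (fun d => - r (d + 1)) (Set.Ici a) a :=
    (hc.comp (continuous_add_const 1)).neg.continuousWithinAt
  have h_nonneg : ∀ d ∈ Set.Ioi a, 0 ≤ r d * (d + 1)⁻¹ := fun d hda => by
    have hda : a < d := hda
    exact mul_nonneg (h_pos d).le (inv_nonneg.2 (by linarith))
  rw [← ofReal_integral_eq_lintegral_ofReal
    (integrableOn_Ioi_deriv_of_nonneg h_cont h_der h_nonneg h_lim')
    ((ae_restrict_mem measurableSet_Ioi).mono h_nonneg),
    integral_Ioi_of_hasDerivAt_of_nonneg h_cont h_der h_nonneg h_lim']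
  simp

/-- The law of `y ↦ u y` for `u` uniform on `(0,1)` is uniform on `(0,y)`. -/
lemma volume_Ioo_preimage_mul {y : ℝ} (hy : 0 < y) {A : Set ℝ} (hA : MeasurableSet A) :
    volume.restrict (Set.Ioo (0 : ℝ) 1) ((fun u => u * y) ⁻¹' A) =
      ENNReal.ofReal y⁻¹ * ∫⁻ x in A, (Set.Ioo 0 y).indicator 1 x := by
  have h : (fun u => u * y) ⁻¹' A ∩ Set.Ioo 0 1 = (fun u => u * y) ⁻¹' (Set.Ioo 0 y ∩ A) := by
    ext u
    have : u * y < y ↔ u < 1 := by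
      rw [mul_lt_iff_lt_one_left hy]
    simp [this, mul_pos_iff_of_pos_right hy, and_comm]
  rw [Measure.restrict_apply (measurable_mul_const y hA), h,
    Real.volume_preimage_mul_right hy.ne', lintegral_indicator_one measurableSet_Ioo,
    Measure.restrict_apply measurableSet_Ioo, abs_of_pos (inv_pos.2 hy)]

/-- If `D` follows the Dickman law (density `x ↦ e^{−γ} ρ(x)` on `[0,∞)`, `ρ` the Dickman
function) and `U` is uniform on `(0,1)` and independent of `D`, then `U(D+1)` follows the
Dickman law as well, i.e. `D` and `U(D+1)` have the same distribution. -/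
theorem dickman_fixed_point
    (ρ : ℝ → ℝ)
    (hρ_cont : ContinuousOn ρ (Set.Ici (0 : ℝ)))
    (hρ_init : ∀ u : ℝ, 0 ≤ u → u ≤ 1 → ρ u = 1)
    (hρ_delay : ∀ u : ℝ, 1 < u → HasDerivAt ρ (-ρ (u - 1) / u) u)
    (Ω : Type*) [MeasurableSpace Ω] (μ : Measure Ω) [IsProbabilityMeasure μ]
    (D U : Ω → ℝ) (hD : Measurable D) (hU : Measurable U)
    (hDlaw : Measure.map D μ =
      (volume.restrict (Set.Ici (0 : ℝ))).withDensity
        (fun x => ENNReal.ofReal (Real.exp (-Real.eulerMascheroniConstant) * ρ x)))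
    (hUlaw : Measure.map U μ = volume.restrict (Set.Ioo (0 : ℝ) 1))
    (hindep : IndepFun D U μ) :
    Measure.map (fun ω => U ω * (D ω + 1)) μ = Measure.map D μ := by
  set c := Real.exp (-Real.eulerMascheroniConstant)
  have hc : 0 < c := Real.exp_pos _
  set r : ℝ → ℝ := fun x => ρ (max x 0) with hr
  have hr_eq : ∀ x, 0 ≤ x → r x = ρ x := fun x hx => by simp [hr, max_eq_left hx]
  have hr_cont : Continuous r :=
    hρ_cont.comp_continuous (continuous_id.max continuous_const) (fun x => Set.mem_Ici.2 (le_max_right _ _))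
  have h_one : ∀ u ≤ 1, r u = 1 := fun u hu =>
    hρ_init _ (le_max_right _ _) (max_le hu zero_le_one)
  have h_deriv : ∀ u, 1 < u → HasDerivAt r (-r (u - 1) / u) u := fun u hu => by
    rw [hr_eq (u - 1) (by linarith)]
    refine (hρ_delay u hu).congr_of_eventuallyEq ?_
    filter_upwards [lt_mem_nhds hu] with x hx
    exact hr_eq x (by linarith)
  have h_pos := dickman_pos_s16 hr_cont h_one h_deriv
  have h_law : Measure.map D μ = (volume.restrict (Set.Ici (0 : ℝ))).withDensity
      (fun x => ENNReal.ofReal (c * r x)) := by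
    rw [hDlaw]
    refine withDensity_congr_ae ?_
    filter_upwards [ae_restrict_mem measurableSet_Ici] with x hx
    rw [hr_eq x hx]
  have h_meas : Measurable r := hr_cont.measurable
  have h_dens : Measurable fun x => ENNReal.ofReal (c * r x) := by fun_prop
  have h_int : IntegrableOn r (Set.Ici 0) := by
    have h_mass : ∫⁻ x in Set.Ici (0 : ℝ), ENNReal.ofReal (c * r x) = 1 := by
      have := Measure.isProbabilityMeasure_map (μ := μ) hD.aemeasurable
      rw [← setLIntegral_univ, ← withDensity_apply _ MeasurableSet.univ, ← h_law, measure_univ]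
    have h_cr : IntegrableOn (fun x => c * r x) (Set.Ici 0) := by
      refine ⟨by fun_prop, ?_⟩
      rw [hasFiniteIntegral_iff_ofReal (ae_of_all _ fun x => (mul_pos hc (h_pos x)).le), h_mass]
      exact ENNReal.one_lt_top
    exact (integrable_const_mul_iff hc.ne'.isUnit r).1 h_cr
  have h_kernel : ∀ y : ℝ, y ≠ 0 →
      ∫⁻ d in Set.Ici (0 : ℝ), ENNReal.ofReal (c * r d) *
        (ENNReal.ofReal (d + 1)⁻¹ * (Set.Ioo 0 (d + 1)).indicator 1 y) =
      (Set.Ici (0 : ℝ)).indicator (fun x => ENNReal.ofReal (c * r x)) y := by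
    intro y hy
    rcases hy.lt_or_gt with hy | hy
    · simp [hy.le.not_gt, hy.not_ge]
    have h_max : r (max 0 (y - 1) + 1) = r y := by
      rcases le_total y 1 with h | h
      · rw [max_eq_left (by linarith), h_one y h, h_one _ (by simp)]
      · rw [max_eq_right (by linarith), sub_add_cancel]
    rw [Set.indicator_of_mem (Set.mem_Ici.2 hy.le), ← h_max, ENNReal.ofReal_mul hc.le,
      ← dickman_lintegral_Ioi hr_cont h_one h_deriv h_int (le_max_left 0 (y - 1)),
      ← lintegral_const_mul _ (by fun_prop), setLIntegral_congr Ioi_ae_eq_Ici.symm,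
      ← lintegral_indicator measurableSet_Ioi, ← lintegral_indicator measurableSet_Ioi]
    congr 1
    ext d
    by_cases hd : 0 < d
    · by_cases hdy : y < d + 1
      · rw [Set.indicator_of_mem (Set.mem_Ioi.2 hd), Set.indicator_of_mem
          (Set.mem_Ioi.2 (max_lt hd (by linarith))), Set.indicator_of_mem (Set.mem_Ioo.2 ⟨hy, hdy⟩),
          ENNReal.ofReal_mul hc.le, ENNReal.ofReal_mul (h_pos d).le]
        simp [mul_assoc]
      · have : ¬ max 0 (y - 1) < d := fun h => hdy (by linarith [(max_lt_iff.1 h).2])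
        rw [Set.indicator_of_notMem (s := Set.Ioi (max 0 (y - 1))) this]
        simp [hd, hdy]
    · have : ¬ max 0 (y - 1) < d := fun h => hd (max_lt_iff.1 h).1
      rw [Set.indicator_of_notMem (by simpa using hd), Set.indicator_of_notMem (by simpa using this)]
  have h_joint := (indepFun_iff_map_prod_eq_prod_map_map hD.aemeasurable hU.aemeasurable).1 hindep
  have h_prod : Measurable fun p : ℝ × ℝ => p.2 * (p.1 + 1) := by fun_prop
  have h_map : Measure.map (fun ω => U ω * (D ω + 1)) μ =
      Measure.map (fun p : ℝ × ℝ => p.2 * (p.1 + 1)) ((Measure.map D μ).prod (Measure.map U μ)) := by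
    rw [← h_joint, Measure.map_map h_prod (hD.prodMk hU)]
    rfl
  have h_ind : Measurable fun p : ℝ × ℝ =>
      (Set.Ioo 0 (p.1 + 1)).indicator (1 : ℝ → ENNReal) p.2 := by
    have h_set : MeasurableSet {p : ℝ × ℝ | 0 < p.2 ∧ p.2 < p.1 + 1} :=
      (measurableSet_lt measurable_const measurable_snd).inter
        (measurableSet_lt measurable_snd (measurable_fst.add_const 1))
    exact (measurable_one.indicator h_set : Measurable
      ({p : ℝ × ℝ | 0 < p.2 ∧ p.2 < p.1 + 1}.indicator (1 : ℝ × ℝ → ENNReal)))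
  have h_sec : ∀ d : ℝ, Measurable ((Set.Ioo 0 (d + 1)).indicator (1 : ℝ → ENNReal)) :=
    fun d => measurable_one.indicator measurableSet_Ioo
  ext A hA
  have := Measure.isProbabilityMeasure_map (μ := μ) hU.aemeasurable
  rw [h_map, Measure.map_apply h_prod hA, Measure.prod_apply (h_prod hA), h_law,
    lintegral_withDensity_eq_lintegral_mul _ h_dens (measurable_measure_prodMk_left (h_prod hA)),
    withDensity_apply _ hA, hUlaw]
  calc
    _ = ∫⁻ d in Set.Ici (0 : ℝ), ∫⁻ y in A, ENNReal.ofReal (c * r d) *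
        (ENNReal.ofReal (d + 1)⁻¹ * (Set.Ioo 0 (d + 1)).indicator 1 y) := by
      refine setLIntegral_congr_fun measurableSet_Ici fun d hd => ?_
      have hd : 0 ≤ d := hd
      have h := volume_Ioo_preimage_mul (y := d + 1) (by linarith) hA
      rw [lintegral_const_mul _ ((h_sec d).const_mul _), lintegral_const_mul _ (h_sec d), ← h]
      rfl
    _ = ∫⁻ y in A, ∫⁻ d in Set.Ici (0 : ℝ), ENNReal.ofReal (c * r d) *
        (ENNReal.ofReal (d + 1)⁻¹ * (Set.Ioo 0 (d + 1)).indicator 1 y) :=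
      lintegral_lintegral_swap (by
        refine Measurable.aemeasurable ?_
        exact (h_dens.comp measurable_fst).mul (Measurable.mul (by fun_prop) h_ind))
    _ = ∫⁻ y in A, (Set.Ici (0 : ℝ)).indicator (fun x => ENNReal.ofReal (c * r x)) y :=
      lintegral_congr_ae (ae_restrict_of_ae
        ((Measure.ae_ne volume (0 : ℝ)).mono fun y hy => h_kernel y hy))
    _ = _ := by
      rw [lintegral_indicator measurableSet_Ici, Measure.restrict_comm measurableSet_Ici]
end
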